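/- Let p be a prime and ψ : ℕ → ℝ a non-negative function with Σ_{n∈ℕ} μ_p(E_n(ψ)) = ∞. If limsup_{N→∞} (Σ_{n≤N} φ(n)ψ(n)) / (Σ_{n≤N} n·ψ(n)) > 0, where φ is Euler's totient function, then μ_p(W_p(ψ)) = 1. -/

import Mathlib

open MeasureTheory Filter

noncomputable section

/-- The set `E_n(ψ) ⊆ ℤ_p`: union over integers `a` with `|a| ≤ n`, `gcd(a,n) = 1`
of the closed balls `{x : |x - a/n|_p ≤ ψ(n)}`. -/
def padicE (p : ℕ) [Fact p.Prime] (ψ : ℕ → ℝ) (n : ℕ) : Set ℤ_[p] :=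
  {x | ∃ a : ℤ, |a| ≤ (n : ℤ) ∧ Int.gcd a n = 1 ∧
    ‖(x : ℚ_[p]) - (a : ℚ_[p]) / (n : ℚ_[p])‖ ≤ ψ n}

/-- `W_p(ψ)`: the points of `ℤ_p` lying in infinitely many of the sets `E_n(ψ)`. -/
def padicW (p : ℕ) [Fact p.Prime] (ψ : ℕ → ℝ) : Set ℤ_[p] :=
  {x | {n : ℕ | x ∈ padicE p ψ n}.Infinite}

theorem sum_pow_sub_le {r : ℝ} (h0 : 0 ≤ r) (h1 : r < 1) (i : ℕ) :
    ∑ j ∈ Finset.range i, r ^ (i - j) ≤ r / (1 - r) := by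
  have h2 : 0 < 1 - r := by linarith
  induction i with
  | zero => simp; positivity
  | succ i ih =>
    have e : ∑ j ∈ Finset.range (i + 1), r ^ (i + 1 - j)
        = r * (∑ j ∈ Finset.range i, r ^ (i - j) + 1) := by
      rw [Finset.sum_range_succ, mul_add, Finset.mul_sum]
      congr 1
      · refine Finset.sum_congr rfl fun j hj => ?_
        rw [Nat.succ_sub (Finset.mem_range.1 hj).le, pow_succ']
      · simp
    rw [e]
    calc r * (∑ j ∈ Finset.range i, r ^ (i - j) + 1) ≤ r * (r / (1 - r) + 1) := by gcongr
      _ = r / (1 - r) := by field_simp; ring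

theorem sum_pow_sub_le' {r : ℝ} (h0 : 0 ≤ r) (h1 : r < 1) (i n : ℕ) :
    ∑ j ∈ Finset.Ico (i + 1) n, r ^ (j - i) ≤ r / (1 - r) := by
  have h2 : 0 < 1 - r := by linarith
  rw [Finset.sum_Ico_eq_sum_range]
  have : ∀ d ∈ Finset.range (n - (i + 1)), r ^ (i + 1 + d - i) = r * r ^ d := by
    intro d _
    rw [← pow_succ']; congr 1; omega
  rw [Finset.sum_congr rfl this, ← Finset.mul_sum, div_eq_mul_inv]
  gcongr
  rw [← tsum_geometric_of_lt_one h0 h1]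
  exact (summable_geometric_of_lt_one h0 h1).sum_le_tsum _ (fun _ _ => by positivity)

/-- The absolute difference of two natural numbers. -/
def natGap (i j : ℕ) : ℕ := (i - j) + (j - i)

theorem natGap_comm (i j : ℕ) : natGap i j = natGap j i := by
  unfold natGap; omega

theorem sum_pow_natGap_le {r : ℝ} (h0 : 0 ≤ r) (h1 : r < 1) (i n : ℕ) :
    ∑ j ∈ (Finset.range n).filter (· ≠ i), r ^ natGap i j ≤ 2 * (r / (1 - r)) := by
  have hsub : (Finset.range n).filter (· ≠ i) ⊆ Finset.range i ∪ Finset.Ico (i + 1) n := by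
    intro j hj
    simp only [Finset.mem_filter, Finset.mem_range, Finset.mem_union, Finset.mem_Ico] at hj ⊢
    omega
  have hd : Disjoint (Finset.range i) (Finset.Ico (i + 1) n) := by
    rw [Finset.disjoint_left]; intro j hj; simp at hj ⊢; omega
  calc _ ≤ ∑ j ∈ Finset.range i ∪ Finset.Ico (i + 1) n, r ^ natGap i j :=
        Finset.sum_le_sum_of_subset_of_nonneg hsub (fun _ _ _ => by positivity)
    _ = ∑ j ∈ Finset.range i, r ^ (i - j) + ∑ j ∈ Finset.Ico (i + 1) n, r ^ (j - i) := by
        rw [Finset.sum_union hd]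
        congr 1
        · refine Finset.sum_congr rfl fun j hj => ?_
          have := Finset.mem_range.1 hj
          unfold natGap; congr 1; omega
        · refine Finset.sum_congr rfl fun j hj => ?_
          have := Finset.mem_Ico.1 hj
          unfold natGap; congr 1; omega
    _ ≤ _ := by
        have := sum_pow_sub_le h0 h1 i
        have := sum_pow_sub_le' h0 h1 i n
        linarith

theorem four_mul_cube_mul_le (y s : ℝ) : 4 * (y ^ 3 * s) ≤ 3 * y ^ 4 + s ^ 4 := by
  nlinarith [sq_nonneg (y ^ 2 - s ^ 2), sq_nonneg (y * (y - s)), sq_nonneg (y - s),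
    mul_nonneg (sq_nonneg (y - s)) (sq_nonneg (y + s)), mul_nonneg (sq_nonneg (y - s)) (sq_nonneg y),
    mul_nonneg (sq_nonneg (y - s)) (sq_nonneg (s))]

/-- Off-diagonal part of the bilinear form, restricted to arbitrary finite index sets. -/
theorem sum_offDiag_le {n : ℕ} {x y : ℕ → ℝ} {r X Y : ℝ} (h0 : 0 ≤ r) (h1 : r < 1)
    (P : ℕ → Prop) [DecidablePred P]
    (hx : ∑ i ∈ (Finset.range n).filter P, x i ^ 6 ≤ X)
    (hy : ∑ i ∈ (Finset.range n).filter P, y i ^ 6 ≤ Y) :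
    ∑ i ∈ (Finset.range n).filter P, ∑ j ∈ ((Finset.range n).filter P).filter (· ≠ i),
      r ^ natGap i j * (x i * y j) ^ 3 ≤ (r / (1 - r)) * (X + Y) := by
  have h2 : 0 < 1 - r := by linarith
  have h3 : 0 ≤ r / (1 - r) := by positivity
  set s := (Finset.range n).filter P with hs
  have key : ∀ i, ∑ j ∈ s.filter (· ≠ i), r ^ natGap i j ≤ 2 * (r / (1 - r)) := by
    intro i
    refine le_trans ?_ (sum_pow_natGap_le h0 h1 i n)
    refine Finset.sum_le_sum_of_subset_of_nonneg ?_ (fun _ _ _ => by positivity)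
    exact Finset.filter_subset_filter _ (Finset.filter_subset _ _)
  calc _ ≤ ∑ i ∈ s, ∑ j ∈ s.filter (· ≠ i),
        (r ^ natGap i j * (x i ^ 6 / 2) + r ^ natGap i j * (y j ^ 6 / 2)) := by
        refine Finset.sum_le_sum fun i _ => Finset.sum_le_sum fun j _ => ?_
        rw [← mul_add]
        refine mul_le_mul_of_nonneg_left ?_ (by positivity)
        nlinarith [sq_nonneg (x i ^ 3 - y j ^ 3)]
    _ = ∑ i ∈ s, (∑ j ∈ s.filter (· ≠ i), r ^ natGap i j) * (x i ^ 6 / 2)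
        + ∑ j ∈ s, (∑ i ∈ s.filter (· ≠ j), r ^ natGap j i) * (y j ^ 6 / 2) := by
        simp_rw [Finset.sum_add_distrib, Finset.sum_mul]
        congr 1
        rw [Finset.sum_comm' (t' := s) (s' := fun j => s.filter (· ≠ j))]
        · simp_rw [natGap_comm]
        · intro i j; simp only [Finset.mem_filter]; tauto
    _ ≤ ∑ i ∈ s, (2 * (r / (1 - r))) * (x i ^ 6 / 2)
        + ∑ j ∈ s, (2 * (r / (1 - r))) * (y j ^ 6 / 2) := by
        gcongr with i _ j _
        · exact key i
        · exact key j
    _ = (r / (1 - r)) * (∑ i ∈ s, x i ^ 6 + ∑ j ∈ s, y j ^ 6) := by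
        rw [mul_add, Finset.mul_sum, Finset.mul_sum]
        congr 1 <;> exact Finset.sum_congr rfl fun _ _ => by ring
    _ ≤ _ := by gcongr

theorem sum_block_le {n : ℕ} {x y : ℕ → ℝ} {m : ℕ → ℕ → ℝ} {r c X Y : ℝ} (h0 : 0 ≤ r) (h1 : r < 1)
    (hc : 0 ≤ c)
    (hm : ∀ i j, m i j ≤ (if i = j then 1 else c * r ^ natGap i j) * (x i * y j) ^ 3)
    (P : ℕ → Prop) [DecidablePred P]
    (hx : ∑ i ∈ (Finset.range n).filter P, x i ^ 6 ≤ X)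
    (hy : ∑ i ∈ (Finset.range n).filter P, y i ^ 6 ≤ Y) :
    ∑ i ∈ (Finset.range n).filter P, ∑ j ∈ (Finset.range n).filter P, m i j ≤
      ∑ i ∈ (Finset.range n).filter P, (x i * y i) ^ 3 + c * ((r / (1 - r)) * (X + Y)) := by
  set s := (Finset.range n).filter P with hs
  have h := sum_offDiag_le h0 h1 P hx hy
  calc ∑ i ∈ s, ∑ j ∈ s, m i j ≤ ∑ i ∈ s, ((x i * y i) ^ 3 +
        c * ∑ j ∈ s.filter (· ≠ i), r ^ natGap i j * (x i * y j) ^ 3) := by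
        refine Finset.sum_le_sum fun i hi => ?_
        have e : s.filter (· ≠ i) = s.erase i := by ext; simp [Finset.mem_erase, and_comm]
        rw [e, ← Finset.add_sum_erase s _ hi, Finset.mul_sum]
        refine add_le_add (by simpa using hm i i) (Finset.sum_le_sum fun j hj => ?_)
        have := hm i j
        rw [if_neg (Finset.ne_of_mem_erase hj).symm] at this
        linarith
    _ = ∑ i ∈ s, (x i * y i) ^ 3 +
        c * ∑ i ∈ s, ∑ j ∈ s.filter (· ≠ i), r ^ natGap i j * (x i * y j) ^ 3 := by
        rw [Finset.sum_add_distrib, Finset.mul_sum]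
    _ ≤ _ := by gcongr

theorem pow_six_sum_le {s : Finset ℕ} {x : ℕ → ℝ} {e X : ℝ}
    (h : ∑ i ∈ s, x i ^ 4 ≤ X) (he : 0 ≤ e) (hX : X ≤ e ^ 2) : ∑ i ∈ s, x i ^ 6 ≤ e * X := by
  calc ∑ i ∈ s, x i ^ 6 ≤ ∑ i ∈ s, e * x i ^ 4 := by
        refine Finset.sum_le_sum fun i hi => ?_
        have h1 : x i ^ 4 ≤ e ^ 2 :=
          (Finset.single_le_sum (f := fun i => x i ^ 4) (fun i _ => by positivity) hi).trans
            (h.trans hX)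
        have h2 : x i ^ 2 ≤ e := by
          refine le_of_sq_le_sq ?_ he
          calc (x i ^ 2) ^ 2 = x i ^ 4 := by ring
            _ ≤ _ := h1
        calc x i ^ 6 = x i ^ 2 * x i ^ 4 := by ring
          _ ≤ _ := by gcongr
    _ = e * ∑ i ∈ s, x i ^ 4 := by rw [Finset.mul_sum]
    _ ≤ _ := by gcongr

theorem diag_sum_le {s : Finset ℕ} {x y : ℕ → ℝ} {X Y : ℝ}
    (hx : ∑ i ∈ s, x i ^ 6 ≤ X) (hy : ∑ i ∈ s, y i ^ 6 ≤ Y) :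
    ∑ i ∈ s, (x i * y i) ^ 3 ≤ (X + Y) / 2 := by
  calc ∑ i ∈ s, (x i * y i) ^ 3 ≤ ∑ i ∈ s, (x i ^ 6 / 2 + y i ^ 6 / 2) := by
        refine Finset.sum_le_sum fun i _ => ?_
        nlinarith [sq_nonneg (x i ^ 3 - y i ^ 3)]
    _ = (∑ i ∈ s, x i ^ 6 + ∑ i ∈ s, y i ^ 6) / 2 := by
        rw [Finset.sum_add_distrib, ← Finset.sum_div, ← Finset.sum_div]; ring
    _ ≤ _ := by linarith

/-- The crude bound for the bilinear form, valid for every prime. -/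
theorem bilinear_crude {n : ℕ} {x y : ℕ → ℝ} {m : ℕ → ℕ → ℝ} {r c : ℝ} (h0 : 0 ≤ r) (h1 : r < 1)
    (hc : 0 ≤ c)
    (hx : ∑ i ∈ Finset.range n, x i ^ 4 ≤ 1) (hy : ∑ i ∈ Finset.range n, y i ^ 4 ≤ 1)
    (hm : ∀ i j, m i j ≤ (if i = j then 1 else c * r ^ natGap i j) * (x i * y j) ^ 3) :
    ∑ i ∈ Finset.range n, ∑ j ∈ Finset.range n, m i j ≤ 1 + c * (2 * (r / (1 - r))) := by
  have hx6 := pow_six_sum_le hx zero_le_one (by norm_num)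
  have hy6 := pow_six_sum_le hy zero_le_one (by norm_num)
  have := sum_block_le (n := n) h0 h1 hc hm (fun _ => True) (X := 1) (Y := 1)
    (by simpa using hx6) (by simpa using hy6)
  have hd := diag_sum_le hx6 hy6
  simp only [Finset.filter_true] at this
  linarith

/-- One arm of the bilinear form. -/
theorem arm_le {s : Finset ℕ} {y m : ℕ → ℝ} {r c X Y G κ : ℝ} {k : ℕ} (hc : 0 ≤ c)
    (hκ : 0 < κ) (hX0 : 0 ≤ X) (hX : X ≤ 1) (hy0 : ∀ i, 0 ≤ y i) (h0 : 0 ≤ r)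
    (hm : ∀ j ∈ s, m j ≤ c * r ^ natGap k j * (X * y j) ^ 3)
    (hY : ∑ j ∈ s, y j ^ 4 ≤ Y) (hG : ∑ j ∈ s, (r ^ 4) ^ natGap k j ≤ G) :
    ∑ j ∈ s, m j ≤ c * (3 / 4 * κ ^ 4 * Y + 1 / 4 * (G / κ ^ 12)) := by
  calc ∑ j ∈ s, m j ≤ ∑ j ∈ s,
        (c * (3 / 4 * κ ^ 4) * y j ^ 4 + c * (1 / 4 / κ ^ 12) * (r ^ 4) ^ natGap k j) := by
        refine Finset.sum_le_sum fun j hj => (hm j hj).trans ?_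
        have h := four_mul_cube_mul_le (κ * y j) (r ^ natGap k j / κ ^ 3)
        have e1 : (κ * y j) ^ 3 * (r ^ natGap k j / κ ^ 3) = y j ^ 3 * r ^ natGap k j := by
          field_simp
        have e2 : (r ^ natGap k j / κ ^ 3) ^ 4 = (r ^ 4) ^ natGap k j / κ ^ 12 := by
          rw [div_pow, ← pow_mul, ← pow_mul, ← pow_mul, mul_comm]
        rw [e1, e2] at h
        have hX3 : X ^ 3 ≤ 1 := pow_le_one₀ hX0 hX
        have hp : 0 ≤ y j ^ 3 * r ^ natGap k j :=
          mul_nonneg (pow_nonneg (hy0 j) 3) (pow_nonneg h0 _)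
        calc c * r ^ natGap k j * (X * y j) ^ 3
            = c * (X ^ 3 * (y j ^ 3 * r ^ natGap k j)) := by ring
          _ ≤ c * (1 * (y j ^ 3 * r ^ natGap k j)) := by gcongr
          _ ≤ c * ((3 * (κ * y j) ^ 4 + (r ^ 4) ^ natGap k j / κ ^ 12) / 4) := by
              gcongr; linarith
          _ = _ := by ring
    _ = c * (3 / 4 * κ ^ 4 * ∑ j ∈ s, y j ^ 4 + 1 / 4 * ((∑ j ∈ s, (r ^ 4) ^ natGap k j) / κ ^ 12)) := by
        rw [Finset.sum_add_distrib, ← Finset.mul_sum, ← Finset.mul_sum]; ring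
    _ ≤ _ := by gcongr

theorem sum_sum_split {n k : ℕ} (hk : k ∈ Finset.range n) (m : ℕ → ℕ → ℝ) :
    ∑ i ∈ Finset.range n, ∑ j ∈ Finset.range n, m i j =
      m k k + ∑ j ∈ (Finset.range n).filter (· ≠ k), m k j
        + ∑ i ∈ (Finset.range n).filter (· ≠ k), m i k
        + ∑ i ∈ (Finset.range n).filter (· ≠ k), ∑ j ∈ (Finset.range n).filter (· ≠ k), m i j := by
  have e : (Finset.range n).filter (· ≠ k) = (Finset.range n).erase k := by
    ext; simp [Finset.mem_erase, and_comm]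
  have h1 := Finset.add_sum_erase _ (fun i => ∑ j ∈ Finset.range n, m i j) hk
  have h2 := Finset.add_sum_erase _ (m k) hk
  have h3 : ∑ i ∈ (Finset.range n).erase k, ∑ j ∈ Finset.range n, m i j =
      ∑ i ∈ (Finset.range n).erase k, m i k
        + ∑ i ∈ (Finset.range n).erase k, ∑ j ∈ (Finset.range n).erase k, m i j := by
    rw [← Finset.sum_add_distrib]
    exact Finset.sum_congr rfl fun i _ => (Finset.add_sum_erase _ (m i) hk).symm
  rw [e, ← h1, h3, ← h2]
  ring

theorem sum_sum_le_min_split {n k : ℕ} {m : ℕ → ℕ → ℝ} (h0 : ∀ i j, 0 ≤ m i j)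
    (hk : k ∈ Finset.range n) :
    ∑ i ∈ Finset.range n, ∑ j ∈ Finset.range n, m i j ≤
      (∑ i ∈ Finset.range n, ∑ j ∈ Finset.range n, if min i j = k then m i j else 0)
        + ∑ j ∈ (Finset.range n).filter (· < k), m k j
        + ∑ i ∈ (Finset.range n).filter (· < k), m i k
        + ∑ i ∈ (Finset.range n).filter (· ≠ k), ∑ j ∈ (Finset.range n).filter (· ≠ k), m i j := by
  have e1 : ∑ j ∈ (Finset.range n).filter (· < k), m k j
      = ∑ i ∈ Finset.range n, ∑ j ∈ Finset.range n, if i = k ∧ j < k then m i j else 0 := by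
    symm
    rw [Finset.sum_eq_single k]
    · rw [Finset.sum_filter]; simp
    · intro b _ hb; simp [hb]
    · intro h; exact absurd hk h
  have e2 : ∑ i ∈ (Finset.range n).filter (· < k), m i k
      = ∑ i ∈ Finset.range n, ∑ j ∈ Finset.range n, if j = k ∧ i < k then m i j else 0 := by
    symm
    rw [Finset.sum_comm, Finset.sum_eq_single k]
    · rw [Finset.sum_filter]; simp
    · intro b _ hb; simp [hb]
    · intro h; exact absurd hk h
  have e3 : ∑ i ∈ (Finset.range n).filter (· ≠ k), ∑ j ∈ (Finset.range n).filter (· ≠ k), m i j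
      = ∑ i ∈ Finset.range n, ∑ j ∈ Finset.range n, if i ≠ k ∧ j ≠ k then m i j else 0 := by
    rw [Finset.sum_filter]
    refine Finset.sum_congr rfl fun i _ => ?_
    split_ifs with h
    · simp [Finset.sum_filter, h]
    · simp [h]
  rw [e1, e2, e3]
  simp_rw [← Finset.sum_add_distrib]
  refine Finset.sum_le_sum fun i _ => Finset.sum_le_sum fun j _ => ?_
  have hm := h0 i j
  have a1 : 0 ≤ (if min i j = k then m i j else 0) := by split_ifs <;> simp [hm]
  have a2 : 0 ≤ (if i = k ∧ j < k then m i j else 0) := by split_ifs <;> simp [hm]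
  have a3 : 0 ≤ (if j = k ∧ i < k then m i j else 0) := by split_ifs <;> simp [hm]
  have a4 : 0 ≤ (if i ≠ k ∧ j ≠ k then m i j else 0) := by split_ifs <;> simp [hm]
  by_cases h1 : min i j = k
  · rw [if_pos h1] at a1 ⊢; linarith
  by_cases h2 : i = k ∧ j < k
  · rw [if_pos h2] at a2 ⊢; linarith
  by_cases h3 : j = k ∧ i < k
  · rw [if_pos h3] at a3 ⊢; linarith
  have h4 : i ≠ k ∧ j ≠ k := by omega
  rw [if_pos h4] at a4 ⊢; linarith

theorem rpow_three_quarters_le {a b : ℝ} (ha : a ≤ 1) (hb : b ≤ 1) :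
    ((1 - a) * (1 - b)) ^ (3 / 4 : ℝ) ≤ (1 - 3 / 4 * a) * (1 - 3 / 4 * b) := by
  have h1 := rpow_one_add_le_one_add_mul_self (s := -a) (p := 3 / 4) (by linarith) (by norm_num)
    (by norm_num)
  have h2 := rpow_one_add_le_one_add_mul_self (s := -b) (p := 3 / 4) (by linarith) (by norm_num)
    (by norm_num)
  rw [Real.mul_rpow (by linarith) (by linarith)]
  have h3 : 0 ≤ (1 - b) ^ (3 / 4 : ℝ) := Real.rpow_nonneg (by linarith) _
  refine mul_le_mul (by simpa [sub_eq_add_neg] using h1) (by simpa [sub_eq_add_neg] using h2) h3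
    (by linarith)

set_option maxHeartbeats 2000000 in
/-- The refined bound for the bilinear form, valid for large primes `p = r⁻⁴`. -/
theorem bilinear_refined {n : ℕ} {x y : ℕ → ℝ} {m : ℕ → ℕ → ℝ} {r c : ℝ} (h0 : 0 < r)
    (hr : r ≤ 1 / 2 ^ 22) (hc : 1 ≤ c) (hc' : c ≤ 64) (hx0 : ∀ i, 0 ≤ x i) (hy0 : ∀ i, 0 ≤ y i)
    (hm0 : ∀ i j, 0 ≤ m i j)
    (hx : ∑ i ∈ Finset.range n, x i ^ 4 ≤ 1) (hy : ∑ i ∈ Finset.range n, y i ^ 4 ≤ 1)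
    (hm : ∀ i j, m i j ≤ (if i = j then 1 else c * r ^ natGap i j) * (x i * y j) ^ 3)
    (hk : ∀ k, (∑ i ∈ Finset.range n, ∑ j ∈ Finset.range n, if min i j = k then m i j else 0) ≤
      (if k = 0 then 1 else (1 - r ^ 4) ^ (1 / 2 : ℝ)) *
        ((∑ i ∈ (Finset.range n).filter (k ≤ ·), x i ^ 4) *
          (∑ i ∈ (Finset.range n).filter (k ≤ ·), y i ^ 4)) ^ (3 / 4 : ℝ)) :
    ∑ i ∈ Finset.range n, ∑ j ∈ Finset.range n, m i j ≤
      1 + 2 ^ 100 * (r ^ 6 + (c - 1) * r ^ 4) := by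
  have hr1 : r < 1 := by norm_num at hr ⊢; linarith
  have hc0 : 0 ≤ c := by linarith
  have herr : 0 ≤ 2 ^ 100 * (r ^ 6 + (c - 1) * r ^ 4) := by
    have : 0 ≤ c - 1 := by linarith
    positivity
  rcases Nat.eq_zero_or_pos n with rfl | hn
  · simp; linarith
  have hgeo : r / (1 - r) ≤ 2 * r := by
    rw [div_le_iff₀ (by linarith)]; norm_num at hr; nlinarith
  have hgeo0 : 0 ≤ r / (1 - r) := div_nonneg h0.le (by linarith)
  obtain ⟨k, hkn, hmax⟩ := Finset.exists_max_image (Finset.range n) (fun i => x i * y i)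
    ⟨0, Finset.mem_range.2 hn⟩
  have hxk4 : x k ^ 4 + ∑ i ∈ (Finset.range n).filter (· ≠ k), x i ^ 4 ≤ 1 := by
    have e : (Finset.range n).filter (· ≠ k) = (Finset.range n).erase k := by
      ext; simp [Finset.mem_erase, and_comm]
    rw [e, Finset.add_sum_erase _ (fun i => x i ^ 4) hkn]; exact hx
  have hyk4 : y k ^ 4 + ∑ i ∈ (Finset.range n).filter (· ≠ k), y i ^ 4 ≤ 1 := by
    have e : (Finset.range n).filter (· ≠ k) = (Finset.range n).erase k := by
      ext; simp [Finset.mem_erase, and_comm]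
    rw [e, Finset.add_sum_erase _ (fun i => y i ^ 4) hkn]; exact hy
  set X := ∑ i ∈ (Finset.range n).filter (· ≠ k), x i ^ 4 with hX
  set Y := ∑ i ∈ (Finset.range n).filter (· ≠ k), y i ^ 4 with hY
  have hX0 : 0 ≤ X := Finset.sum_nonneg fun i _ => by positivity
  have hY0 : 0 ≤ Y := Finset.sum_nonneg fun i _ => by positivity
  have hxk1 : x k ≤ 1 := by
    by_contra h; push Not at h
    have : 1 < x k ^ 4 := one_lt_pow₀ h (by norm_num)
    linarith
  have hyk1 : y k ≤ 1 := by
    by_contra h; push Not at h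
    have : 1 < y k ^ 4 := one_lt_pow₀ h (by norm_num)
    linarith
  rcases le_or_gt (x k * y k) (1 - 256 * r) with hS | hS
  · -- spread-out case
    have hx6 := pow_six_sum_le hx zero_le_one (by norm_num)
    have hy6 := pow_six_sum_le hy zero_le_one (by norm_num)
    have hb := sum_block_le (n := n) h0.le hr1 hc0 hm (fun _ => True) (X := 1) (Y := 1)
      (by simpa using hx6) (by simpa using hy6)
    simp only [Finset.filter_true] at hb
    have hS0 : 0 ≤ 1 - 256 * r := by norm_num at hr; linarith
    have hd : ∑ i ∈ Finset.range n, (x i * y i) ^ 3 ≤ (1 - 256 * r) * 1 := by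
      calc ∑ i ∈ Finset.range n, (x i * y i) ^ 3
          ≤ ∑ i ∈ Finset.range n, (1 - 256 * r) * (x i ^ 4 / 2 + y i ^ 4 / 2) := by
            refine Finset.sum_le_sum fun i hi => ?_
            have h1 := (hmax i hi).trans hS
            have h2 : (x i * y i) ^ 2 ≤ x i ^ 4 / 2 + y i ^ 4 / 2 := by
              nlinarith [sq_nonneg (x i ^ 2 - y i ^ 2)]
            calc (x i * y i) ^ 3 = (x i * y i) * (x i * y i) ^ 2 := by ring
              _ ≤ _ := mul_le_mul h1 h2 (by positivity) hS0
        _ = (1 - 256 * r) * ((∑ i ∈ Finset.range n, x i ^ 4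
              + ∑ i ∈ Finset.range n, y i ^ 4) / 2) := by
            rw [← Finset.mul_sum, Finset.sum_add_distrib, ← Finset.sum_div, ← Finset.sum_div]
            ring
        _ ≤ _ := by gcongr; linarith
    have : c * (r / (1 - r) * (1 + 1)) ≤ 64 * (2 * r * (1 + 1)) := by gcongr
    linarith
  -- concentrated case
  have hxk : 1 - 256 * r ≤ x k := by
    nlinarith [hx0 k, hy0 k, mul_nonneg (hx0 k) (sub_nonneg.2 hyk1)]
  have hyk : 1 - 256 * r ≤ y k := by
    nlinarith [hx0 k, hy0 k, mul_nonneg (hy0 k) (sub_nonneg.2 hxk1)]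
  have bern : ∀ z : ℝ, 1 - 256 * r ≤ z → 1 - 1024 * r ≤ z ^ 4 := by
    intro z hz
    have h2 := one_add_mul_le_pow (a := -(256 * r)) (by norm_num at hr; linarith) 4
    have h3 : (1 + -(256 * r)) ^ 4 ≤ z ^ 4 := by
      apply pow_le_pow_left₀
      · norm_num at hr; linarith
      · linarith
    push_cast at h2
    linarith
  have hXr : X ≤ 1024 * r := by linarith [bern _ hxk]
  have hYr : Y ≤ 1024 * r := by linarith [bern _ hyk]
  obtain ⟨M, hXM, hYM, hMr, hMc⟩ : ∃ M, X ≤ M ∧ Y ≤ M ∧ M ≤ 1024 * r ∧ (M = X ∨ M = Y) :=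
    ⟨max X Y, le_max_left _ _, le_max_right _ _, max_le hXr hYr, max_choice X Y⟩
  have hM0 : 0 ≤ M := hX0.trans hXM
  obtain ⟨e, he0, he2⟩ : ∃ e, 0 ≤ e ∧ e ^ 2 = M := ⟨√M, Real.sqrt_nonneg _, Real.sq_sqrt hM0⟩
  have hcross : ∑ i ∈ (Finset.range n).filter (· ≠ k), ∑ j ∈ (Finset.range n).filter (· ≠ k), m i j
      ≤ 2 * (e * M) := by
    have hx6 := pow_six_sum_le (hX.symm.le.trans hXM) he0 he2.symm.le
    have hy6 := pow_six_sum_le (hY.symm.le.trans hYM) he0 he2.symm.le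
    have hb := sum_block_le (n := n) h0.le hr1 hc0 hm (fun i => i ≠ k) hx6 hy6
    have hd := diag_sum_le hx6 hy6
    have heM : 0 ≤ e * M := by positivity
    have : c * (r / (1 - r) * (e * M + e * M)) ≤ 64 * (2 * r * (e * M + e * M)) := by gcongr
    have h2 : 64 * (2 * r * (e * M + e * M)) ≤ e * M := by
      have : 256 * r ≤ 1 := by norm_num at hr; linarith
      nlinarith
    linarith
  have hu0 : 0 < r ^ 4 := by positivity
  have hu1 : r ^ 4 < 1 := pow_lt_one₀ h0.le hr1 (by norm_num)
  have husmall : r ^ 4 ≤ 1 / 2 ^ 88 := by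
    calc r ^ 4 ≤ (1 / 2 ^ 22) ^ 4 := by gcongr
      _ = _ := by norm_num
  rcases le_or_gt (2 ^ 44 * r ^ 4) M with hbig | hsmall
  · -- the mass off `k` is not tiny
    rw [sum_sum_split hkn]
    have hG : ∑ j ∈ (Finset.range n).filter (· ≠ k), (r ^ 4) ^ natGap k j ≤ 4 * r ^ 4 := by
      refine (sum_pow_natGap_le hu0.le hu1 k n).trans ?_
      have : r ^ 4 / (1 - r ^ 4) ≤ 2 * r ^ 4 := by
        rw [div_le_iff₀ (by linarith)]; norm_num at husmall; nlinarith
      linarith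
    have hne : ∀ j ∈ (Finset.range n).filter (· ≠ k), j ≠ k := fun j hj => (Finset.mem_filter.1 hj).2
    have arm1 := arm_le (s := (Finset.range n).filter (· ≠ k)) (y := y) (m := fun j => m k j)
      (κ := 1 / 8) (X := x k) (Y := M) hc0 (by norm_num) (hx0 k) hxk1 hy0 h0.le
      (fun j hj => by have := hm k j; rwa [if_neg (hne j hj).symm] at this) hYM hG
    have arm2 := arm_le (s := (Finset.range n).filter (· ≠ k)) (y := x) (m := fun j => m j k)
      (κ := 1 / 8) (X := y k) (Y := M) hc0 (by norm_num) (hy0 k) hyk1 hx0 h0.le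
      (fun j hj => by
        have := hm j k; rwa [if_neg (hne j hj), natGap_comm, mul_comm (x j)] at this) hXM hG
    have hnn : 0 ≤ 3 / 4 * (1 / 8 : ℝ) ^ 4 * M + 1 / 4 * (4 * r ^ 4 / (1 / 8) ^ 12) := by positivity
    have hcc := mul_le_mul_of_nonneg_right hc' hnn
    have hmain : m k k ≤ 1 - 3 / 4 * M := by
      have h1 := hm k k
      rw [if_pos rfl, one_mul] at h1
      have h3 := four_mul_cube_mul_le (x k) 1
      have h4 := four_mul_cube_mul_le (y k) 1
      have h5 : x k ^ 3 ≤ 1 - 3 / 4 * X := by linarith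
      have h6 : y k ^ 3 ≤ 1 - 3 / 4 * Y := by linarith
      have h7 : x k ^ 3 ≤ 1 := pow_le_one₀ (hx0 k) hxk1
      have h8 : y k ^ 3 ≤ 1 := pow_le_one₀ (hy0 k) hyk1
      have h9 : 0 ≤ x k ^ 3 := pow_nonneg (hx0 k) 3
      have h10 : 0 ≤ y k ^ 3 := pow_nonneg (hy0 k) 3
      rw [mul_pow] at h1
      rcases hMc with h | h
      · have := mul_le_mul h5 h8 h10 (h9.trans h5)
        linarith
      · have := mul_le_mul h7 h6 h10 zero_le_one
        linarith
    have he64 : e ≤ 1 / 64 := by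
      refine le_of_sq_le_sq ?_ (by norm_num)
      rw [he2]; norm_num at hr ⊢; linarith
    have heM : e * M ≤ 1 / 64 * M := by gcongr
    norm_num at hcc hbig arm1 arm2
    linarith
  · -- the mass off `k` is `O(1 / p)`
    have heb : e ≤ 2 ^ 22 * r ^ 2 := by
      refine le_of_sq_le_sq ?_ (by positivity)
      rw [he2]; nlinarith
    have hcross' : 2 * (e * M) ≤ 2 ^ 67 * r ^ 6 := by
      calc 2 * (e * M) ≤ 2 * ((2 ^ 22 * r ^ 2) * (2 ^ 44 * r ^ 4)) := by gcongr
        _ = _ := by ring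
    refine (sum_sum_le_min_split hm0 hkn).trans ?_
    have hkk := hk k
    have sumle : ∀ z : ℕ → ℝ, (∀ i, 0 ≤ z i) → ∑ i ∈ Finset.range n, z i ^ 4 ≤ 1 →
        ∑ i ∈ (Finset.range n).filter (k ≤ ·), z i ^ 4 ≤
          1 - ∑ i ∈ (Finset.range n).filter (· < k), z i ^ 4 := by
      intro z _ hz
      have := Finset.sum_filter_add_sum_filter_not (Finset.range n) (· < k) (fun i => z i ^ 4)
      simp only [not_lt] at this
      linarith
    have subk : ∀ z : ℕ → ℝ, ∑ i ∈ (Finset.range n).filter (· < k), z i ^ 4 ≤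
        ∑ i ∈ (Finset.range n).filter (· ≠ k), z i ^ 4 := by
      intro z
      refine Finset.sum_le_sum_of_subset_of_nonneg ?_ (fun _ _ _ => by positivity)
      intro i; simp only [Finset.mem_filter]; rintro ⟨h1, h2⟩; exact ⟨h1, h2.ne⟩
    have hx' := sumle x hx0 hx
    have hy' := sumle y hy0 hy
    have hxs := subk x
    have hys := subk y
    set X' := ∑ i ∈ (Finset.range n).filter (· < k), x i ^ 4 with hX'
    set Y' := ∑ i ∈ (Finset.range n).filter (· < k), y i ^ 4 with hY'
    have hX'0 : 0 ≤ X' := Finset.sum_nonneg fun i _ => by positivity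
    have hY'0 : 0 ≤ Y' := Finset.sum_nonneg fun i _ => by positivity
    have hX'M : X' ≤ 2 ^ 44 * r ^ 4 := by linarith
    have hY'M : Y' ≤ 2 ^ 44 * r ^ 4 := by linarith
    have hX'1 : X' ≤ 1 := by norm_num at hX'M husmall ⊢; linarith
    have hY'1 : Y' ≤ 1 := by norm_num at hY'M husmall ⊢; linarith
    have hpw : ((∑ i ∈ (Finset.range n).filter (k ≤ ·), x i ^ 4) *
          (∑ i ∈ (Finset.range n).filter (k ≤ ·), y i ^ 4)) ^ (3 / 4 : ℝ)
        ≤ (1 - 3 / 4 * X') * (1 - 3 / 4 * Y') := by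
      refine le_trans ?_ (rpow_three_quarters_le hX'1 hY'1)
      refine Real.rpow_le_rpow ?_ ?_ (by norm_num)
      · exact mul_nonneg (Finset.sum_nonneg fun i _ => by positivity)
          (Finset.sum_nonneg fun i _ => by positivity)
      · refine mul_le_mul hx' hy' (Finset.sum_nonneg fun i _ => by positivity) (by linarith)
    have hcr : 0 ≤ (c - 1) * r ^ 4 := mul_nonneg (by linarith) hu0.le
    have hr6 : 0 ≤ r ^ 6 := by positivity
    rcases Nat.eq_zero_or_pos k with rfl | hkpos
    · rw [if_pos rfl, one_mul] at hkk
      have : (1 - 3 / 4 * X') * (1 - 3 / 4 * Y') ≤ 1 := by nlinarith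
      have hemp : (Finset.range n).filter (· < 0) = ∅ := by simp
      rw [hemp, Finset.sum_empty, Finset.sum_empty, add_zero, add_zero]
      have h100 : (2 ^ 67 : ℝ) * r ^ 6 ≤ 2 ^ 100 * r ^ 6 := mul_le_mul_of_nonneg_right (by norm_num) hr6
      have h101 : 0 ≤ (2 ^ 100 : ℝ) * ((c - 1) * r ^ 4) := mul_nonneg (pow_nonneg zero_le_two 100) hcr
      rw [mul_add]
      linarith
    · rw [if_neg hkpos.ne'] at hkk
      have hg : (1 - r ^ 4) ^ (1 / 2 : ℝ) ≤ 1 - r ^ 4 / 2 := by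
        have := rpow_one_add_le_one_add_mul_self (s := -r ^ 4) (p := 1 / 2) (by linarith)
          (by norm_num) (by norm_num)
        rw [sub_eq_add_neg]
        linarith
      have hlt : ∀ j ∈ (Finset.range n).filter (· < k), j ≠ k :=
        fun j hj => (Finset.mem_filter.1 hj).2.ne
      have hG : ∑ j ∈ (Finset.range n).filter (· < k), (r ^ 4) ^ natGap k j
          ≤ r ^ 4 + 2 * (r ^ 4) ^ 2 := by
        calc _ ≤ ∑ j ∈ Finset.range k, (r ^ 4) ^ (k - j) := by
              calc _ = ∑ j ∈ (Finset.range n).filter (· < k), (r ^ 4) ^ (k - j) := by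
                    refine Finset.sum_congr rfl fun j hj => ?_
                    have := (Finset.mem_filter.1 hj).2
                    unfold natGap; congr 1; omega
                _ ≤ _ := by
                    refine Finset.sum_le_sum_of_subset_of_nonneg ?_ (fun _ _ _ => by positivity)
                    intro i; simp
          _ ≤ r ^ 4 / (1 - r ^ 4) := sum_pow_sub_le hu0.le hu1 k
          _ ≤ _ := by
            rw [div_le_iff₀ (by linarith)]; norm_num at husmall; nlinarith [sq_nonneg (r ^ 4)]
      have arm1 := arm_le (s := (Finset.range n).filter (· < k)) (y := y) (m := fun j => m k j)
        (κ := 1) (X := x k) (Y := Y') hc0 (by norm_num) (hx0 k) hxk1 hy0 h0.le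
        (fun j hj => by have := hm k j; rwa [if_neg (hlt j hj).symm] at this) le_rfl hG
      have arm2 := arm_le (s := (Finset.range n).filter (· < k)) (y := x) (m := fun j => m j k)
        (κ := 1) (X := y k) (Y := X') hc0 (by norm_num) (hy0 k) hyk1 hx0 h0.le
        (fun j hj => by
          have := hm j k; rwa [if_neg (hlt j hj), natGap_comm, mul_comm (x j)] at this) le_rfl hG
      have hmain := hkk.trans (mul_le_mul hg hpw (Real.rpow_nonneg (mul_nonneg
        (Finset.sum_nonneg fun i _ => by positivity)
        (Finset.sum_nonneg fun i _ => by positivity)) _) (by linarith))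
      set u := r ^ 4 with hu
      have hu2 : u ^ 2 ≤ r ^ 6 := by
        have : u ^ 2 = r ^ 6 * r ^ 2 := by rw [hu]; ring
        rw [this]
        exact mul_le_of_le_one_right hr6 (pow_le_one₀ h0.le hr1.le)
      have hprod : (1 - u / 2) * ((1 - 3 / 4 * X') * (1 - 3 / 4 * Y')) ≤
          1 - u / 2 - 3 / 4 * X' - 3 / 4 * Y' + 2 ^ 90 * u ^ 2 := by
        have a1 : X' * Y' ≤ (2 ^ 44 * u) * (2 ^ 44 * u) := by gcongr
        have a2 : u * X' ≤ u * (2 ^ 44 * u) := by gcongr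
        have a3 : u * Y' ≤ u * (2 ^ 44 * u) := by gcongr
        have a4 : 0 ≤ u * (X' * Y') := by positivity
        have a5 : 0 ≤ u ^ 2 := by positivity
        norm_num at a1 a2 a3 ⊢
        nlinarith
      have b1 : (c - 1) * X' ≤ (c - 1) * (2 ^ 44 * u) := by gcongr
      have b2 : (c - 1) * Y' ≤ (c - 1) * (2 ^ 44 * u) := by gcongr
      have b3 : c * u ^ 2 ≤ 64 * u ^ 2 := by gcongr
      norm_num at arm1 arm2 b1 b2 hprod hcross' ⊢
      nlinarith

/-- The product of the weights `d q` over the `q ∈ P` dividing `v`. -/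
def dvdProd (P : Finset ℕ) (d : ℕ → ℝ) (v : ℕ) : ℝ := ∏ q ∈ P.filter (· ∣ v), d q

theorem dvdProd_insert {P : Finset ℕ} {d : ℕ → ℝ} {p : ℕ} (hp : p ∉ P) (v : ℕ) :
    dvdProd (insert p P) d v = (if p ∣ v then d p else 1) * dvdProd P d v := by
  unfold dvdProd
  rw [Finset.prod_filter, Finset.prod_filter, Finset.prod_insert hp]

theorem dvdProd_mul_of_notMem {P : Finset ℕ} (hP : ∀ q ∈ P, q.Prime) {d : ℕ → ℝ} {p : ℕ}
    (hpp : p.Prime) (hp : p ∉ P) (k v : ℕ) : dvdProd P d (p ^ k * v) = dvdProd P d v := by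
  unfold dvdProd
  refine Finset.prod_congr (Finset.filter_congr fun q hq => ?_) fun _ _ => rfl
  have hne : q ≠ p := fun h => hp (h ▸ hq)
  have hco : Nat.Coprime q (p ^ k) :=
    Nat.Coprime.pow_right k ((Nat.coprime_primes (hP q hq) hpp).2 hne)
  exact ⟨fun h => hco.dvd_of_dvd_mul_left h, fun h => h.mul_left _⟩

theorem dvdProd_nonneg {P : Finset ℕ} {d : ℕ → ℝ} (hd : ∀ q ∈ P, 0 ≤ d q) (v : ℕ) :
    0 ≤ dvdProd P d v :=
  Finset.prod_nonneg fun q hq => hd q (Finset.mem_filter.1 hq).1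

theorem dvdProd_pow (P : Finset ℕ) (d : ℕ → ℝ) (n v : ℕ) :
    dvdProd P (fun q => d q ^ n) v = dvdProd P d v ^ n := by
  unfold dvdProd; rw [Finset.prod_pow]

/-- Reindexing a sum over the multiples of `a`. -/
theorem sum_dvd_eq {a N : ℕ} (ha : 0 < a) {f : ℕ → ℝ} :
    ∑ v ∈ Finset.Icc 1 N, (if a ∣ v then f v else 0) = ∑ v ∈ Finset.Icc 1 (N / a), f (a * v) := by
  rw [← Finset.sum_filter]
  symm
  refine Finset.sum_bij (fun v _ => a * v) ?_ ?_ ?_ ?_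
  · intro v hv
    simp only [Finset.mem_Icc, Finset.mem_filter] at hv ⊢
    refine ⟨⟨Nat.mul_pos ha hv.1, ?_⟩, dvd_mul_right _ _⟩
    calc a * v ≤ a * (N / a) := Nat.mul_le_mul_left _ hv.2
      _ ≤ N := Nat.mul_div_le N a
  · intro v _ w _ h; exact Nat.eq_of_mul_eq_mul_left ha h
  · intro v hv
    simp only [Finset.mem_Icc, Finset.mem_filter] at hv
    obtain ⟨⟨h1, h2⟩, w, rfl⟩ := hv
    refine ⟨w, ?_, rfl⟩
    simp only [Finset.mem_Icc]
    exact ⟨Nat.pos_of_mul_pos_left h1, (Nat.le_div_iff_mul_le ha).2 (by linarith)⟩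
  · intro _ _; rfl

theorem sum_inv_sqrt_le (M : ℕ) : ∑ w ∈ Finset.Icc 1 M, (√(w : ℝ))⁻¹ ≤ 2 * √(M : ℝ) := by
  induction M with
  | zero => simp
  | succ M ih =>
    rw [Finset.sum_Icc_succ_top (by omega)]
    have h1 : 0 < √((M + 1 : ℕ) : ℝ) := Real.sqrt_pos.2 (by positivity)
    have h2 : √((M + 1 : ℕ) : ℝ) ^ 2 = M + 1 := by rw [Real.sq_sqrt (by positivity)]; push_cast; ring
    have h3 : √(M : ℝ) ^ 2 = M := Real.sq_sqrt (by positivity)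
    have h4 : 0 ≤ √(M : ℝ) := Real.sqrt_nonneg _
    have : (√((M + 1 : ℕ) : ℝ))⁻¹ ≤ 2 * √((M + 1 : ℕ) : ℝ) - 2 * √(M : ℝ) := by
      rw [inv_le_iff_one_le_mul₀ h1]
      nlinarith [sq_nonneg (√((M + 1 : ℕ) : ℝ) - √(M : ℝ))]
    linarith

theorem sum_inv_sqrt_dvdProd_le {P : Finset ℕ} (hP : ∀ q ∈ P, q.Prime) {d : ℕ → ℝ}
    (hd : ∀ q ∈ P, 1 ≤ d q) (M : ℕ) :
    ∑ w ∈ Finset.Icc 1 M, (√(w : ℝ))⁻¹ * dvdProd P d w ≤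
      2 * √(M : ℝ) * ∏ q ∈ P, (1 + (d q - 1) / q) := by
  induction P using Finset.induction_on generalizing M with
  | empty => simpa [dvdProd] using sum_inv_sqrt_le M
  | insert p P hp ih =>
    have hP' : ∀ q ∈ P, q.Prime := fun q hq => hP q (Finset.mem_insert_of_mem hq)
    have hd' : ∀ q ∈ P, 1 ≤ d q := fun q hq => hd q (Finset.mem_insert_of_mem hq)
    have hpp := hP p (Finset.mem_insert_self _ _)
    have hdp := hd p (Finset.mem_insert_self _ _)
    have ih := ih hP' hd'
    rw [Finset.prod_insert hp]
    set K := ∏ q ∈ P, (1 + (d q - 1) / (q : ℝ)) with hK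
    have hp0 : (0 : ℝ) < p := by exact_mod_cast hpp.pos
    have hK0 : 0 ≤ K := Finset.prod_nonneg fun q hq => by
      have := hd' q hq
      have : 0 ≤ (d q - 1) / (q : ℝ) := div_nonneg (by linarith) (by positivity)
      linarith
    have e : ∀ w : ℕ, (√(w : ℝ))⁻¹ * dvdProd (insert p P) d w = (√(w : ℝ))⁻¹ * dvdProd P d w +
        (d p - 1) * (if p ∣ w then (√(w : ℝ))⁻¹ * dvdProd P d w else 0) := by
      intro w; rw [dvdProd_insert hp]; split_ifs <;> ring
    simp_rw [e]
    rw [Finset.sum_add_distrib, ← Finset.mul_sum, sum_dvd_eq hpp.pos]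
    have e2 : ∀ w : ℕ, (√((p * w : ℕ) : ℝ))⁻¹ * dvdProd P d (p * w) =
        (√(p : ℝ))⁻¹ * ((√(w : ℝ))⁻¹ * dvdProd P d w) := by
      intro w
      have := dvdProd_mul_of_notMem hP' (d := d) hpp hp 1 w
      rw [pow_one] at this
      rw [this]; push_cast; rw [Real.sqrt_mul hp0.le, mul_inv]; ring
    simp_rw [e2]
    rw [← Finset.mul_sum]
    have h1 : √((M / p : ℕ) : ℝ) ≤ √(M : ℝ) * (√(p : ℝ))⁻¹ := by
      rw [← div_eq_mul_inv, ← Real.sqrt_div (by positivity)]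
      exact Real.sqrt_le_sqrt Nat.cast_div_le
    have h2 : (√(p : ℝ))⁻¹ * (√(p : ℝ))⁻¹ = (p : ℝ)⁻¹ := by
      rw [← mul_inv, Real.mul_self_sqrt hp0.le]
    have h3 : (√(p : ℝ))⁻¹ * ∑ w ∈ Finset.Icc 1 (M / p), (√(w : ℝ))⁻¹ * dvdProd P d w ≤
        2 * √(M : ℝ) * K * (p : ℝ)⁻¹ := by
      calc _ ≤ (√(p : ℝ))⁻¹ * (2 * (√(M : ℝ) * (√(p : ℝ))⁻¹) * K) := by
            refine mul_le_mul_of_nonneg_left ((ih (M / p)).trans ?_) (by positivity)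
            gcongr
        _ = 2 * √(M : ℝ) * K * ((√(p : ℝ))⁻¹ * (√(p : ℝ))⁻¹) := by ring
        _ = _ := by rw [h2]
    have h4 := mul_le_mul_of_nonneg_left h3 (sub_nonneg.2 hdp)
    calc _ ≤ 2 * √(M : ℝ) * K + (d p - 1) * (2 * √(M : ℝ) * K * (p : ℝ)⁻¹) :=
          add_le_add (ih M) h4
      _ = _ := by ring

/-- The weight of a pair: the product of `c q` over the primes where the valuations differ. -/
def diffProd (P : Finset ℕ) (c : ℕ → ℝ) (v w : ℕ) : ℝ :=
  ∏ q ∈ P.filter (fun q => v.factorization q ≠ w.factorization q), c q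

theorem diffProd_le {P : Finset ℕ} {c : ℕ → ℝ} (hc : ∀ q ∈ P, 1 ≤ c q) {v w : ℕ} :
    diffProd P c v w ≤ dvdProd P c v * dvdProd P c w := by
  unfold diffProd dvdProd
  rw [Finset.prod_filter, Finset.prod_filter, Finset.prod_filter, ← Finset.prod_mul_distrib]
  refine Finset.prod_le_prod (fun q hq => ?_) fun q hq => ?_
  · have := hc q hq; split_ifs <;> linarith
  · have := hc q hq
    by_cases h1 : q ∣ v
    · by_cases h2 : q ∣ w
      · simp only [h1, h2, if_true]; split_ifs <;> nlinarith
      · simp only [h1, h2, if_true, if_false]; split_ifs <;> nlinarith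
    · by_cases h2 : q ∣ w
      · simp only [h1, h2, if_true, if_false]; split_ifs <;> nlinarith
      · simp [h1, h2, Nat.factorization_eq_zero_of_not_dvd]

theorem diffProd_nonneg {P : Finset ℕ} {c : ℕ → ℝ} (hc : ∀ q ∈ P, 1 ≤ c q) (v w : ℕ) :
    0 ≤ diffProd P c v w :=
  Finset.prod_nonneg fun q hq => zero_le_one.trans (hc q (Finset.mem_filter.1 hq).1)

/-- `√`-form of the base case: sums over coprime pairs. -/
theorem half_base_le {P : Finset ℕ} (hP : ∀ q ∈ P, q.Prime) {d : ℕ → ℝ}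
    (hd : ∀ q ∈ P, 1 ≤ d q) {C : ℝ} (hC : ∏ q ∈ P, (1 + (d q - 1) / q) ≤ C) {N : ℕ}
    {ψ θ : ℕ → ℝ} (hψ : ∀ v, 0 ≤ ψ v) :
    ∑ v ∈ Finset.Icc 1 N, ∑ w ∈ Finset.Icc 1 N,
      (if w * ψ v ≤ 1 ∧ v * θ w ≤ 1 then
        ψ v * (√(v : ℝ) * (√(w : ℝ))⁻¹) * (√(ψ v) * √(θ w)) * dvdProd P d w else 0) ≤
      2 * C * ∑ v ∈ Finset.Icc 1 N, ψ v := by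
  rw [Finset.mul_sum]
  refine Finset.sum_le_sum fun v hv => ?_
  have hd0 : ∀ q ∈ P, 0 ≤ d q := fun q hq => zero_le_one.trans (hd q hq)
  rcases (hψ v).eq_or_lt with h0 | h0
  · simp [← h0]
  have hsum : ∑ w ∈ Finset.Icc 1 N,
      (if w * ψ v ≤ 1 ∧ v * θ w ≤ 1 then
        ψ v * (√(v : ℝ) * (√(w : ℝ))⁻¹) * (√(ψ v) * √(θ w)) * dvdProd P d w else 0) ≤
      ∑ w ∈ Finset.Icc 1 ⌊1 / ψ v⌋₊, ψ v * √(ψ v) * ((√(w : ℝ))⁻¹ * dvdProd P d w) := by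
    rw [← Finset.sum_filter]
    refine (Finset.sum_le_sum (g := fun w : ℕ => ψ v * √(ψ v) * ((√(w : ℝ))⁻¹ * dvdProd P d w))
      fun w hw => ?_).trans (Finset.sum_le_sum_of_subset_of_nonneg ?_ fun w _ _ => ?_)
    · simp only [Finset.mem_filter] at hw
      have h1 : √(v : ℝ) * √(θ w) ≤ 1 := by
        rw [← Real.sqrt_mul (by positivity)]; exact Real.sqrt_le_one.2 hw.2.2
      have h2 : 0 ≤ ψ v * √(ψ v) * ((√(w : ℝ))⁻¹ * dvdProd P d w) :=
        mul_nonneg (by positivity) (mul_nonneg (by positivity) (dvdProd_nonneg hd0 w))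
      calc _ = (ψ v * √(ψ v) * ((√(w : ℝ))⁻¹ * dvdProd P d w)) * (√(v : ℝ) * √(θ w)) := by ring
        _ ≤ _ := mul_le_of_le_one_right h2 h1
    · intro w hw
      simp only [Finset.mem_filter, Finset.mem_Icc] at hw ⊢
      exact ⟨hw.1.1, Nat.le_floor ((le_div_iff₀ h0).2 hw.2.1)⟩
    · exact mul_nonneg (by positivity) (mul_nonneg (by positivity) (dvdProd_nonneg hd0 w))
  refine hsum.trans ?_
  rw [← Finset.mul_sum]
  have h1 := sum_inv_sqrt_dvdProd_le hP hd ⌊1 / ψ v⌋₊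
  have h2 : √(⌊1 / ψ v⌋₊ : ℝ) ≤ (√(ψ v))⁻¹ := by
    rw [← Real.sqrt_inv, ← one_div]
    exact Real.sqrt_le_sqrt (Nat.floor_le (by positivity))
  have hp1 : 0 ≤ ∏ q ∈ P, (1 + (d q - 1) / (q : ℝ)) := Finset.prod_nonneg fun q hq => by
    have := hd q hq
    have : 0 ≤ (d q - 1) / (q : ℝ) := div_nonneg (by linarith) (by positivity)
    linarith
  have h3 : 0 < √(ψ v) := Real.sqrt_pos.2 h0
  calc _ ≤ ψ v * √(ψ v) * (2 * (√(ψ v))⁻¹ * C) := by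
        refine mul_le_mul_of_nonneg_left (h1.trans ?_) (by positivity)
        gcongr
    _ = _ := by field_simp

theorem base_le {P : Finset ℕ} (hP : ∀ q ∈ P, q.Prime) {c : ℕ → ℝ}
    (hc : ∀ q ∈ P, 1 ≤ c q) {C : ℝ} (hC : ∏ q ∈ P, (1 + (c q ^ 4 - 1) / q) ≤ C) {N : ℕ}
    {ψ θ : ℕ → ℝ} (hψ : ∀ v, 0 ≤ ψ v) (hθ : ∀ v, 0 ≤ θ v) :
    ∑ v ∈ Finset.Icc 1 N, ∑ w ∈ Finset.Icc 1 N,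
      (if w * ψ v ≤ 1 ∧ v * θ w ≤ 1 then ψ v * θ w * diffProd P c v w else 0) ≤
      √(2 * C) * ((∑ v ∈ Finset.Icc 1 N, ψ v) * ∑ v ∈ Finset.Icc 1 N, θ v) ^ (3 / 4 : ℝ) := by
  have hc0 : ∀ q ∈ P, 0 ≤ c q := fun q hq => zero_le_one.trans (hc q hq)
  have hd1 : ∀ q ∈ P, 1 ≤ c q ^ 4 := fun q hq => one_le_pow₀ (hc q hq)
  have hC0 : 0 ≤ C := by
    refine le_trans (Finset.prod_nonneg fun q hq => ?_) hC
    have := hd1 q hq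
    have : 0 ≤ (c q ^ 4 - 1) / (q : ℝ) := div_nonneg (by linarith) (by positivity)
    linarith
  set Ψ := ∑ v ∈ Finset.Icc 1 N, ψ v with hΨ
  set Θ := ∑ v ∈ Finset.Icc 1 N, θ v with hΘ
  have hΨ0 : 0 ≤ Ψ := Finset.sum_nonneg fun v _ => hψ v
  have hΘ0 : 0 ≤ Θ := Finset.sum_nonneg fun v _ => hθ v
  set S : Finset (ℕ × ℕ) := (Finset.Icc 1 N ×ˢ Finset.Icc 1 N).filter
    (fun z => z.2 * ψ z.1 ≤ 1 ∧ z.1 * θ z.2 ≤ 1) with hS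
  have toS : ∀ f : ℕ → ℕ → ℝ, ∑ v ∈ Finset.Icc 1 N, ∑ w ∈ Finset.Icc 1 N,
      (if w * ψ v ≤ 1 ∧ v * θ w ≤ 1 then f v w else 0) = ∑ z ∈ S, f z.1 z.2 := by
    intro f; rw [hS, Finset.sum_filter, Finset.sum_product]
  have h1 := half_base_le hP hd1 hC (N := N) (θ := θ) hψ
  have h2 := half_base_le hP hd1 hC (N := N) (θ := ψ) hθ
  rw [Finset.sum_comm] at h2
  have h2' : ∑ z ∈ S, θ z.2 * (√(z.2 : ℝ) * (√(z.1 : ℝ))⁻¹) * (√(θ z.2) * √(ψ z.1)) *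
      dvdProd P c z.1 ^ 4 ≤ 2 * C * Θ := by
    rw [← toS fun v w => θ w * (√(w : ℝ) * (√(v : ℝ))⁻¹) * (√(θ w) * √(ψ v)) * dvdProd P c v ^ 4]
    refine le_trans (le_of_eq ?_) h2
    refine Finset.sum_congr rfl fun v _ => Finset.sum_congr rfl fun w _ => ?_
    rw [dvdProd_pow]; simp only [and_comm]
  rw [toS] at h1 ⊢
  simp_rw [dvdProd_pow] at h1
  set E1 := ∑ z ∈ S, ψ z.1 * θ z.2 with hE1
  set E2 := ∑ z ∈ S, ψ z.1 * θ z.2 * (dvdProd P c z.1 ^ 2 * dvdProd P c z.2 ^ 2) with hE2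
  have hE1le : E1 ≤ Ψ * Θ := by
    rw [hΨ, hΘ, Finset.sum_mul_sum, ← Finset.sum_product']
    exact Finset.sum_le_sum_of_subset_of_nonneg (Finset.filter_subset _ _)
      fun z _ _ => mul_nonneg (hψ _) (hθ _)
  have hdv : ∀ v, 0 ≤ dvdProd P c v := dvdProd_nonneg hc0
  have hE2le : E2 ^ 2 ≤ (2 * C) ^ 2 * (Ψ * Θ) := by
    have cs := Finset.sum_mul_sq_le_sq_mul_sq S
      (fun z => √(ψ z.1 * (√(z.1 : ℝ) * (√(z.2 : ℝ))⁻¹) * (√(ψ z.1) * √(θ z.2)) *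
        dvdProd P c z.2 ^ 4))
      (fun z => √(θ z.2 * (√(z.2 : ℝ) * (√(z.1 : ℝ))⁻¹) * (√(θ z.2) * √(ψ z.1)) *
        dvdProd P c z.1 ^ 4))
    have e0 : E2 = ∑ z ∈ S, √(ψ z.1 * (√(z.1 : ℝ) * (√(z.2 : ℝ))⁻¹) * (√(ψ z.1) * √(θ z.2)) *
        dvdProd P c z.2 ^ 4) * √(θ z.2 * (√(z.2 : ℝ) * (√(z.1 : ℝ))⁻¹) * (√(θ z.2) * √(ψ z.1)) *
        dvdProd P c z.1 ^ 4) := by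
      refine Finset.sum_congr rfl fun z hz => ?_
      simp only [hS, Finset.mem_filter, Finset.mem_product, Finset.mem_Icc] at hz
      have z1 : 0 < √(z.1 : ℝ) := Real.sqrt_pos.2 (by exact_mod_cast hz.1.1.1)
      have z2 : 0 < √(z.2 : ℝ) := Real.sqrt_pos.2 (by exact_mod_cast hz.1.2.1)
      have p1 := hψ z.1
      have p2 := hθ z.2
      rw [← Real.sqrt_mul (by positivity), eq_comm, Real.sqrt_eq_iff_mul_self_eq (by positivity)
        (by have := hdv z.1; have := hdv z.2; positivity)]
      have q1 : √(ψ z.1) ^ 2 = ψ z.1 := Real.sq_sqrt p1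
      have q2 : √(θ z.2) ^ 2 = θ z.2 := Real.sq_sqrt p2
      have w1 : √(z.1 : ℝ) * (√(z.1 : ℝ))⁻¹ = 1 := mul_inv_cancel₀ z1.ne'
      have w2 : √(z.2 : ℝ) * (√(z.2 : ℝ))⁻¹ = 1 := mul_inv_cancel₀ z2.ne'
      calc _ = ψ z.1 * θ z.2 * (√(ψ z.1) ^ 2) * (√(θ z.2) ^ 2) *
            (dvdProd P c z.1 ^ 4 * dvdProd P c z.2 ^ 4) * (√(z.1 : ℝ) * (√(z.1 : ℝ))⁻¹) *
            (√(z.2 : ℝ) * (√(z.2 : ℝ))⁻¹) := by ring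
        _ = _ := by rw [q1, q2, w1, w2]; ring
    rw [← e0] at cs
    refine cs.trans ?_
    have s1 : ∀ z ∈ S, √(ψ z.1 * (√(z.1 : ℝ) * (√(z.2 : ℝ))⁻¹) * (√(ψ z.1) * √(θ z.2)) *
        dvdProd P c z.2 ^ 4) ^ 2 = ψ z.1 * (√(z.1 : ℝ) * (√(z.2 : ℝ))⁻¹) * (√(ψ z.1) * √(θ z.2)) *
        dvdProd P c z.2 ^ 4 := fun z _ => Real.sq_sqrt (by
      have := hψ z.1; have := hdv z.2; positivity)
    have s2 : ∀ z ∈ S, √(θ z.2 * (√(z.2 : ℝ) * (√(z.1 : ℝ))⁻¹) * (√(θ z.2) * √(ψ z.1)) *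
        dvdProd P c z.1 ^ 4) ^ 2 = θ z.2 * (√(z.2 : ℝ) * (√(z.1 : ℝ))⁻¹) * (√(θ z.2) * √(ψ z.1)) *
        dvdProd P c z.1 ^ 4 := fun z _ => Real.sq_sqrt (by
      have := hθ z.2; have := hdv z.1; positivity)
    rw [Finset.sum_congr rfl s1, Finset.sum_congr rfl s2]
    calc _ ≤ (2 * C * Ψ) * (2 * C * Θ) := by
          refine mul_le_mul h1 h2' (Finset.sum_nonneg fun z _ => ?_) (by positivity)
          have := hθ z.2; have := hdv z.1; positivity
      _ = _ := by ring
  have hE20 : 0 ≤ E2 := Finset.sum_nonneg fun z _ => by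
    have := hψ z.1; have := hθ z.2; positivity
  have hM : ∑ z ∈ S, ψ z.1 * θ z.2 * diffProd P c z.1 z.2 ≤
      ∑ z ∈ S, √(ψ z.1 * θ z.2) * (√(ψ z.1 * θ z.2) * (dvdProd P c z.1 * dvdProd P c z.2)) := by
    refine Finset.sum_le_sum fun z _ => ?_
    rw [← mul_assoc, Real.mul_self_sqrt (mul_nonneg (hψ _) (hθ _))]
    exact mul_le_mul_of_nonneg_left (diffProd_le hc) (mul_nonneg (hψ _) (hθ _))
  have cs := Finset.sum_mul_sq_le_sq_mul_sq S (fun z => √(ψ z.1 * θ z.2))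
    (fun z => √(ψ z.1 * θ z.2) * (dvdProd P c z.1 * dvdProd P c z.2))
  simp_rw [mul_pow, Real.sq_sqrt (mul_nonneg (hψ _) (hθ _))] at cs
  refine hM.trans ?_
  refine Real.le_sqrt_of_sq_le cs |>.trans ?_
  have hD0 : 0 ≤ Ψ * Θ := mul_nonneg hΨ0 hΘ0
  have hE2' : E2 ≤ 2 * C * √(Ψ * Θ) := by
    refine le_of_sq_le_sq ?_ (by positivity)
    rw [mul_pow, Real.sq_sqrt hD0]; exact hE2le
  have hfin : E1 * E2 ≤ (2 * C) * ((Ψ * Θ) * √(Ψ * Θ)) := by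
    calc E1 * E2 ≤ (Ψ * Θ) * (2 * C * √(Ψ * Θ)) := mul_le_mul hE1le hE2' hE20 hD0
      _ = _ := by ring
  refine (Real.sqrt_le_sqrt hfin).trans ?_
  rw [Real.sqrt_mul (by positivity)]
  refine mul_le_mul_of_nonneg_left (le_of_eq ?_) (Real.sqrt_nonneg _)
  rw [Real.sqrt_eq_rpow, Real.sqrt_eq_rpow]
  rcases hD0.eq_or_lt with h | h
  · rw [← h]; norm_num
  · nth_rewrite 1 [← Real.rpow_one (Ψ * Θ)]
    rw [← Real.rpow_add h, ← Real.rpow_mul hD0]; norm_num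

/-- `∏ (1 - 1/q)` over the `q ∈ R` dividing `v`. -/
def phiPart (R : Finset ℕ) (v : ℕ) : ℝ := dvdProd R (fun q => 1 - 1 / (q : ℝ)) v

theorem one_sub_inv_prime_pos {q : ℕ} (hq : q.Prime) : 0 < 1 - 1 / (q : ℝ) := by
  have : (1 : ℝ) < q := by exact_mod_cast hq.one_lt
  rw [sub_pos, div_lt_one (by linarith)]; exact this

theorem phiPart_nonneg {R : Finset ℕ} (hR : ∀ q ∈ R, q.Prime) (v : ℕ) : 0 ≤ phiPart R v :=
  dvdProd_nonneg (fun q hq => (one_sub_inv_prime_pos (hR q hq)).le) v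

open Classical in
/-- The contribution of a pair `(v, w)` whose gcd is supported on `R`. -/
def pairTerm (P : Finset ℕ) (c : ℕ → ℝ) (R : Finset ℕ) (ψ θ : ℕ → ℝ) (v w : ℕ) : ℝ :=
  if w * ψ v ≤ (v.gcd w : ℝ) ∧ v * θ w ≤ (v.gcd w : ℝ) ∧ (v.gcd w).primeFactors ⊆ R then
    (ψ v * phiPart R v) * (θ w * phiPart R w) * diffProd P c v w else 0

section pairTerm

variable {P : Finset ℕ} {c : ℕ → ℝ} {R : Finset ℕ} {p N : ℕ} {ψ θ : ℕ → ℝ}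

theorem pairTerm_nonneg (hR : ∀ q ∈ R, q.Prime) (hc : ∀ q ∈ P, 1 ≤ c q)
    (hψ : ∀ v, 0 ≤ ψ v) (hθ : ∀ v, 0 ≤ θ v) (v w : ℕ) : 0 ≤ pairTerm P c R ψ θ v w := by
  unfold pairTerm
  split_ifs
  · exact mul_nonneg (mul_nonneg (mul_nonneg (hψ _) (phiPart_nonneg hR _))
      (mul_nonneg (hθ _) (phiPart_nonneg hR _))) (diffProd_nonneg hc _ _)
  · exact le_rfl

theorem phiPart_insert_mul (hR : ∀ q ∈ R, q.Prime) (hp : p.Prime) (hpR : p ∉ R) (i v : ℕ) :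
    phiPart (insert p R) (p ^ i * v) =
      (if p ∣ p ^ i * v then 1 - 1 / (p : ℝ) else 1) * phiPart R v := by
  unfold phiPart
  rw [dvdProd_insert hpR, dvdProd_mul_of_notMem hR hp hpR]

theorem pairTerm_insert_le {ψ' θ' : ℕ → ℝ} {L D : ℝ} {i j v w : ℕ} (hR : ∀ q ∈ R, q.Prime)
    (hc : ∀ q ∈ P, 1 ≤ c q) (hp : p.Prime) (hpR : p ∉ R)
    (hψ' : ∀ v, 0 ≤ ψ' v) (hθ' : ∀ v, 0 ≤ θ' v) (hL : 0 ≤ L) (hD : 0 ≤ D)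
    (hgcd : (p ^ i * v).gcd (p ^ j * w) = p ^ min i j * v.gcd w) (hpd : ¬ (p ∣ v ∧ p ∣ w))
    (hψψ : ψ' v ≤ p ^ (j - i) * ψ (p ^ i * v)) (hθθ : θ' w ≤ p ^ (i - j) * θ (p ^ j * w))
    (hval : (p : ℝ) ^ natGap i j *
      ((ψ (p ^ i * v) * (if p ∣ p ^ i * v then 1 - 1 / (p : ℝ) else 1)) *
       (θ (p ^ j * w) * (if p ∣ p ^ j * w then 1 - 1 / (p : ℝ) else 1))) ≤ L * (ψ' v * θ' w))
    (hdiff : diffProd P c (p ^ i * v) (p ^ j * w) ≤ D * diffProd P c v w) :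
    (p : ℝ) ^ natGap i j * pairTerm P c (insert p R) ψ θ (p ^ i * v) (p ^ j * w) ≤
      L * D * pairTerm P c R ψ' θ' v w := by
  have hp0 : (0 : ℝ) < p := by exact_mod_cast hp.pos
  by_cases h : (p ^ j * w : ℕ) * ψ (p ^ i * v) ≤ ((p ^ i * v).gcd (p ^ j * w) : ℝ) ∧
      (p ^ i * v : ℕ) * θ (p ^ j * w) ≤ ((p ^ i * v).gcd (p ^ j * w) : ℝ) ∧
      ((p ^ i * v).gcd (p ^ j * w)).primeFactors ⊆ insert p R
  · have h' : w * ψ' v ≤ (v.gcd w : ℝ) ∧ v * θ' w ≤ (v.gcd w : ℝ) ∧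
        (v.gcd w).primeFactors ⊆ R := by
      obtain ⟨h1, h2, h3⟩ := h
      rw [hgcd] at h1 h2 h3
      push_cast at h1 h2
      have hpm : (0 : ℝ) < p ^ min i j := by positivity
      refine ⟨?_, ?_, ?_⟩
      · refine le_of_mul_le_mul_left (le_trans ?_ h1) hpm
        have e : (p : ℝ) ^ j = p ^ min i j * p ^ (j - i) := by
          rw [← pow_add]; congr 1; omega
        rw [e]
        calc (p : ℝ) ^ min i j * (w * ψ' v) ≤ p ^ min i j * (w * (p ^ (j - i) * ψ (p ^ i * v))) := by
              gcongr
          _ = _ := by ring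
      · refine le_of_mul_le_mul_left (le_trans ?_ h2) hpm
        have e : (p : ℝ) ^ i = p ^ min i j * p ^ (i - j) := by
          rw [← pow_add]; congr 1; omega
        rw [e]
        calc (p : ℝ) ^ min i j * (v * θ' w) ≤ p ^ min i j * (v * (p ^ (i - j) * θ (p ^ j * w))) := by
              gcongr
          _ = _ := by ring
      · intro q hq
        have hq' := Nat.mem_primeFactors.1 hq
        have hmem : q ∈ (p ^ min i j * v.gcd w).primeFactors :=
          Nat.mem_primeFactors.2 ⟨hq'.1, hq'.2.1.mul_left _,
            mul_ne_zero (pow_ne_zero _ hp.ne_zero) hq'.2.2⟩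
        rcases Finset.mem_insert.1 (h3 hmem) with rfl | h4
        · exact absurd ⟨hq'.2.1.trans (Nat.gcd_dvd_left _ _), hq'.2.1.trans (Nat.gcd_dvd_right _ _)⟩
            hpd
        · exact h4
    unfold pairTerm
    rw [if_pos h, if_pos h', phiPart_insert_mul hR hp hpR, phiPart_insert_mul hR hp hpR]
    have f1 := phiPart_nonneg hR v
    have f2 := phiPart_nonneg hR w
    have f3 := diffProd_nonneg hc (p ^ i * v) (p ^ j * w)
    have f4 := mul_nonneg hL (mul_nonneg (hψ' v) (hθ' w))
    calc _ = ((p : ℝ) ^ natGap i j *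
          ((ψ (p ^ i * v) * (if p ∣ p ^ i * v then 1 - 1 / (p : ℝ) else 1)) *
          (θ (p ^ j * w) * (if p ∣ p ^ j * w then 1 - 1 / (p : ℝ) else 1)))) *
          (phiPart R v * phiPart R w) * diffProd P c (p ^ i * v) (p ^ j * w) := by ring
      _ ≤ (L * (ψ' v * θ' w)) * (phiPart R v * phiPart R w) * (D * diffProd P c v w) := by
          refine mul_le_mul (mul_le_mul_of_nonneg_right hval (mul_nonneg f1 f2)) hdiff f3
            (mul_nonneg f4 (mul_nonneg f1 f2))
      _ = _ := by ring
  · have : pairTerm P c (insert p R) ψ θ (p ^ i * v) (p ^ j * w) = 0 := if_neg h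
    rw [this, mul_zero]
    exact mul_nonneg (mul_nonneg hL hD) (pairTerm_nonneg hR hc hψ' hθ' v w)

theorem sum_dvd_eq_of_support {a : ℕ} (ha : 0 < a) {f : ℕ → ℝ} (hf : ∀ v, N < v → f v = 0) :
    ∑ v ∈ Finset.Icc 1 N, (if a ∣ v then f v else 0) = ∑ v ∈ Finset.Icc 1 N, f (a * v) := by
  rw [sum_dvd_eq ha]
  refine Finset.sum_subset (Finset.Icc_subset_Icc_right (Nat.div_le_self N a)) ?_
  intro v hv hv'
  simp only [Finset.mem_Icc, not_and, not_le] at hv hv'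
  apply hf
  have := hv' hv.1
  rw [Nat.div_lt_iff_lt_mul ha] at this
  linarith

theorem factorization_pow_mul_self (hp : p.Prime) {v : ℕ} (hv : v ≠ 0) (i : ℕ) :
    (p ^ i * v).factorization p = i + v.factorization p := by
  rw [Nat.factorization_mul (pow_ne_zero _ hp.ne_zero) hv, Nat.factorization_pow]
  simp [hp.factorization_self]

theorem factorization_pow_mul_of_ne (hp : p.Prime) {q : ℕ} (hq : q ≠ p) {v : ℕ} (hv : v ≠ 0)
    (i : ℕ) : (p ^ i * v).factorization q = v.factorization q := by
  rw [Nat.factorization_mul (pow_ne_zero _ hp.ne_zero) hv, Nat.factorization_pow]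
  simp [hp.factorization, hq.symm]

theorem factorization_pow_mul_eq_iff (hp : p.Prime) {v : ℕ} (hv : v ≠ 0) (i : ℕ) :
    (p ^ i * v).factorization p = i ↔ ¬ p ∣ v := by
  rw [factorization_pow_mul_self hp hv]
  constructor
  · intro h hd
    have := (hp.dvd_iff_one_le_factorization hv).1 hd
    omega
  · intro h
    rw [Nat.factorization_eq_zero_of_not_dvd h]; rfl

/-- Reindexing a sum over the `v` with a given `p`-adic valuation. -/
theorem sum_factorization_eq (hp : p.Prime) (i : ℕ) {f : ℕ → ℝ} (hf : ∀ v, N < v → f v = 0) :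
    ∑ v ∈ Finset.Icc 1 N, (if v.factorization p = i then f v else 0) =
      ∑ v ∈ Finset.Icc 1 N, (if p ∣ v then 0 else f (p ^ i * v)) := by
  have h := sum_dvd_eq_of_support (N := N) (pow_pos hp.pos i)
    (f := fun v => if v.factorization p = i then f v else 0)
    (fun v hv => by simp [hf v hv])
  refine Eq.trans (Finset.sum_congr rfl fun v hv => ?_) (h.trans
    (Finset.sum_congr rfl fun v hv => ?_))
  · have hv0 : v ≠ 0 := by simp only [Finset.mem_Icc] at hv; omega
    split_ifs with h1 h2
    · rfl
    · exact absurd ((hp.pow_dvd_iff_le_factorization hv0).2 h1.ge) h2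
    · rfl
    · rfl
  · have hv0 : v ≠ 0 := by simp only [Finset.mem_Icc] at hv; omega
    have := factorization_pow_mul_eq_iff hp hv0 i
    by_cases h1 : p ∣ v
    · simp only [this, h1, not_true, if_false, if_true]
    · simp only [this, h1, not_false_iff, if_false, if_true]

theorem diffProd_pow_mul_same (hp : p.Prime) {v w : ℕ} (hv : v ≠ 0) (hw : w ≠ 0)
    (k : ℕ) : diffProd P c (p ^ k * v) (p ^ k * w) = diffProd P c v w := by
  unfold diffProd
  congr 1
  refine Finset.filter_congr fun q _ => ?_
  by_cases hq : q = p
  · subst hq; rw [factorization_pow_mul_self hp hv, factorization_pow_mul_self hp hw]; simp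
  · rw [factorization_pow_mul_of_ne hp hq hv, factorization_pow_mul_of_ne hp hq hw]

theorem diffProd_pow_mul_le (hp : p.Prime) (hpP : p ∈ P)
    {v w : ℕ} (hv : v ≠ 0) (hw : w ≠ 0) (i j : ℕ) (hpv : ¬ p ∣ v) (hpw : ¬ p ∣ w) :
    diffProd P c (p ^ i * v) (p ^ j * w) ≤ (if i = j then 1 else c p) * diffProd P c v w := by
  rcases eq_or_ne i j with rfl | hij
  · rw [if_pos rfl, one_mul, diffProd_pow_mul_same hp hv hw]
  rw [if_neg hij]
  unfold diffProd
  rw [Finset.prod_filter, Finset.prod_filter, ← Finset.mul_prod_erase _ _ hpP,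
    ← Finset.mul_prod_erase _ (fun q => if v.factorization q ≠ w.factorization q then c q else 1) hpP]
  have e1 : v.factorization p = w.factorization p := by
    rw [Nat.factorization_eq_zero_of_not_dvd hpv, Nat.factorization_eq_zero_of_not_dvd hpw]
  have e2 : (p ^ i * v).factorization p ≠ (p ^ j * w).factorization p := by
    rw [factorization_pow_mul_self hp hv, factorization_pow_mul_self hp hw, e1]; omega
  rw [if_pos e2, if_neg (not_not.2 e1), one_mul]
  refine le_of_eq (congrArg _ (Finset.prod_congr rfl fun q hq => ?_))
  have hq := Finset.ne_of_mem_erase hq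
  rw [factorization_pow_mul_of_ne hp hq hv, factorization_pow_mul_of_ne hp hq hw]

theorem gcd_pow_mul_of_not_dvd (hp : p.Prime) {v w : ℕ} (i j : ℕ) (hpv : ¬ p ∣ v) (hpw : ¬ p ∣ w) :
    (p ^ i * v).gcd (p ^ j * w) = p ^ min i j * v.gcd w := by
  have cv : ∀ m, Nat.Coprime (p ^ m) v := fun m => Nat.Coprime.pow_left m
    ((Nat.Prime.coprime_iff_not_dvd hp).2 hpv)
  have cw : ∀ m, Nat.Coprime (p ^ m) w := fun m => Nat.Coprime.pow_left m
    ((Nat.Prime.coprime_iff_not_dvd hp).2 hpw)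
  rcases le_total i j with h | h
  · obtain ⟨d, rfl⟩ := Nat.exists_eq_add_of_le h
    rw [min_eq_left h, pow_add, mul_assoc, Nat.gcd_mul_left, Nat.Coprime.gcd_mul_left_cancel_right _ (cv d)]
  · obtain ⟨d, rfl⟩ := Nat.exists_eq_add_of_le h
    rw [min_eq_right h, pow_add, mul_assoc, Nat.gcd_mul_left, Nat.Coprime.gcd_mul_left_cancel _ (cw d)]

end pairTerm

section insertPrime

variable {P : Finset ℕ} {c : ℕ → ℝ} {R : Finset ℕ} {p N : ℕ} {ψ θ : ℕ → ℝ}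

/-- The part of `∑ ψ φ_R` over the `v` with `p`-adic valuation `i`. -/
def valPart (R : Finset ℕ) (p N : ℕ) (ψ : ℕ → ℝ) (i : ℕ) : ℝ :=
  ∑ v ∈ Finset.Icc 1 N, if v.factorization p = i then ψ v * phiPart R v else 0

/-- The part of the pair sum with prescribed `p`-adic valuations. -/
def valPairPart (P : Finset ℕ) (c : ℕ → ℝ) (R : Finset ℕ) (p N : ℕ) (ψ θ : ℕ → ℝ) (i j : ℕ) : ℝ :=
  ∑ v ∈ Finset.Icc 1 N, ∑ w ∈ Finset.Icc 1 N,
    if v.factorization p = i ∧ w.factorization p = j then pairTerm P c R ψ θ v w else 0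

theorem pairTerm_eq_zero_left {v : ℕ} (h : ψ v = 0) (w : ℕ) : pairTerm P c R ψ θ v w = 0 := by
  unfold pairTerm; rw [h]; simp

theorem pairTerm_eq_zero_right {w : ℕ} (h : θ w = 0) (v : ℕ) : pairTerm P c R ψ θ v w = 0 := by
  unfold pairTerm; rw [h]; simp

/-- The inductive hypothesis: the moment bound for gcds supported on `R`. -/
def MomentBound (P : Finset ℕ) (c : ℕ → ℝ) (N : ℕ) (R : Finset ℕ) (K : ℝ) : Prop :=
  ∀ ψ θ : ℕ → ℝ, (∀ v, 0 ≤ ψ v) → (∀ v, 0 ≤ θ v) → (∀ v, N < v → ψ v = 0) →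
    (∀ v, N < v → θ v = 0) →
    ∑ v ∈ Finset.Icc 1 N, ∑ w ∈ Finset.Icc 1 N, pairTerm P c R ψ θ v w ≤
      K * ((∑ v ∈ Finset.Icc 1 N, ψ v * phiPart R v) *
        ∑ v ∈ Finset.Icc 1 N, θ v * phiPart R v) ^ (3 / 4 : ℝ)

theorem prime_pow_natGap (i j : ℕ) : (p : ℝ) ^ natGap i j = p ^ (j - i) * p ^ (i - j) := by
  rw [← pow_add]; congr 1; unfold natGap; omega

theorem valPairPart_le {K : ℝ} (hR : ∀ q ∈ R, q.Prime) (hc : ∀ q ∈ P, 1 ≤ c q)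
    (hp : p.Prime) (hpR : p ∉ R) (hpP : p ∈ P) (ih : MomentBound P c N R K)
    (hψ : ∀ v, 0 ≤ ψ v) (hθ : ∀ v, 0 ≤ θ v) (hψN : ∀ v, N < v → ψ v = 0)
    (hθN : ∀ v, N < v → θ v = 0) (i j : ℕ) :
    valPairPart P c (insert p R) p N ψ θ i j ≤
      K * ((if i = j then 1 else c p * ((p : ℝ) ^ (-(1 / 4) : ℝ)) ^ natGap i j) *
        (valPart (insert p R) p N ψ i * valPart (insert p R) p N θ j) ^ (3 / 4 : ℝ)) := by
  have hp0 : (0 : ℝ) < p := by exact_mod_cast hp.pos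
  have heps := (one_sub_inv_prime_pos hp).le
  have heps1 : 1 - 1 / (p : ℝ) ≤ 1 := by have : 0 ≤ 1 / (p : ℝ) := by positivity
                                         linarith
  set ε : ℕ → ℝ := fun v => if p ∣ v then 1 - 1 / (p : ℝ) else 1 with hε
  have hε0 : ∀ v, 0 ≤ ε v := fun v => by simp only [hε]; split_ifs <;> linarith
  have hε1 : ∀ v, ε v ≤ 1 := fun v => by simp only [hε]; split_ifs <;> linarith
  set ψ₁ : ℕ → ℝ := fun v => if p ∣ v then 0 else p ^ (j - i) * (ψ (p ^ i * v) * ε (p ^ i * v))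
    with hψ₁
  set θ₁ : ℕ → ℝ := fun w => if p ∣ w then 0 else p ^ (i - j) * (θ (p ^ j * w) * ε (p ^ j * w))
    with hθ₁
  have hψ₁0 : ∀ v, 0 ≤ ψ₁ v := fun v => by
    have := hψ (p ^ i * v); have := hε0 (p ^ i * v)
    simp only [hψ₁]; split_ifs <;> positivity
  have hθ₁0 : ∀ v, 0 ≤ θ₁ v := fun v => by
    have := hθ (p ^ j * v); have := hε0 (p ^ j * v)
    simp only [hθ₁]; split_ifs <;> positivity
  have hbig : ∀ i v : ℕ, N < v → N < p ^ i * v := fun i v h =>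
    h.trans_le (Nat.le_mul_of_pos_left v (pow_pos hp.pos i))
  have hψ₁N : ∀ v, N < v → ψ₁ v = 0 := fun v h => by
    simp only [hψ₁, hψN _ (hbig i v h)]; simp
  have hθ₁N : ∀ v, N < v → θ₁ v = 0 := fun v h => by
    simp only [hθ₁, hθN _ (hbig j v h)]; simp
  have ih := ih ψ₁ θ₁ hψ₁0 hθ₁0 hψ₁N hθ₁N
  have eA : ∑ v ∈ Finset.Icc 1 N, ψ₁ v * phiPart R v =
      p ^ (j - i) * valPart (insert p R) p N ψ i := by
    unfold valPart
    rw [sum_factorization_eq hp i (fun v h => by rw [hψN v h, zero_mul]), Finset.mul_sum]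
    refine Finset.sum_congr rfl fun v _ => ?_
    simp only [hψ₁]
    split_ifs with h
    · simp
    · rw [phiPart_insert_mul hR hp hpR]; ring
  have eB : ∑ v ∈ Finset.Icc 1 N, θ₁ v * phiPart R v =
      p ^ (i - j) * valPart (insert p R) p N θ j := by
    unfold valPart
    rw [sum_factorization_eq hp j (fun v h => by rw [hθN v h, zero_mul]), Finset.mul_sum]
    refine Finset.sum_congr rfl fun v _ => ?_
    simp only [hθ₁]
    split_ifs with h
    · simp
    · rw [phiPart_insert_mul hR hp hpR]; ring
  have eM : valPairPart P c (insert p R) p N ψ θ i j = ∑ v ∈ Finset.Icc 1 N,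
      ∑ w ∈ Finset.Icc 1 N, if p ∣ v then 0 else if p ∣ w then 0 else
        pairTerm P c (insert p R) ψ θ (p ^ i * v) (p ^ j * w) := by
    unfold valPairPart
    have e1 : ∀ v, ∑ w ∈ Finset.Icc 1 N, (if v.factorization p = i ∧ w.factorization p = j then
        pairTerm P c (insert p R) ψ θ v w else 0) = if v.factorization p = i then
        ∑ w ∈ Finset.Icc 1 N, (if p ∣ w then 0 else
          pairTerm P c (insert p R) ψ θ v (p ^ j * w)) else 0 := by
      intro v
      rw [← sum_factorization_eq hp j fun w h => pairTerm_eq_zero_right (hθN w h) v]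
      split_ifs with h <;> simp [h]
    simp_rw [e1]
    rw [sum_factorization_eq hp i]
    · refine Finset.sum_congr rfl fun v _ => ?_
      split_ifs <;> simp
    · intro v h
      refine Finset.sum_eq_zero fun w _ => ?_
      rw [pairTerm_eq_zero_left (hψN v h)]; simp
  have hcp : 1 ≤ c p := hc p hpP
  set D : ℝ := if i = j then 1 else c p with hD
  have hD0 : 0 ≤ D := by rw [hD]; split_ifs <;> linarith
  have hkey : (p : ℝ) ^ natGap i j * valPairPart P c (insert p R) p N ψ θ i j ≤
      D * ∑ v ∈ Finset.Icc 1 N, ∑ w ∈ Finset.Icc 1 N, pairTerm P c R ψ₁ θ₁ v w := by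
    rw [eM, Finset.mul_sum, Finset.mul_sum]
    refine Finset.sum_le_sum fun v hv => ?_
    rw [Finset.mul_sum, Finset.mul_sum]
    refine Finset.sum_le_sum fun w hw => ?_
    have hv0 : v ≠ 0 := by simp only [Finset.mem_Icc] at hv; omega
    have hw0 : w ≠ 0 := by simp only [Finset.mem_Icc] at hw; omega
    have hnn := mul_nonneg hD0 (pairTerm_nonneg hR hc hψ₁0 hθ₁0 v w)
    split_ifs with h1 h2
    · simpa using hnn
    · simpa using hnn
    · have := pairTerm_insert_le (ψ := ψ) (θ := θ) (ψ' := ψ₁) (θ' := θ₁) (L := 1) (D := D)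
        (i := i) (j := j) (v := v) (w := w) hR hc hp hpR hψ₁0 hθ₁0 zero_le_one hD0
        (gcd_pow_mul_of_not_dvd hp i j h1 h2) (fun h => h1 h.1) ?_ ?_ ?_
        (diffProd_pow_mul_le hp hpP hv0 hw0 i j h1 h2)
      · rwa [one_mul] at this
      · simp only [hψ₁, if_neg h1]
        exact mul_le_mul_of_nonneg_left (mul_le_of_le_one_right (hψ _) (hε1 _)) (by positivity)
      · simp only [hθ₁, if_neg h2]
        exact mul_le_mul_of_nonneg_left (mul_le_of_le_one_right (hθ _) (hε1 _)) (by positivity)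
      · simp only [hψ₁, hθ₁, if_neg h1, if_neg h2]
        rw [prime_pow_natGap]
        exact le_of_eq (by ring)
  rw [eA, eB] at ih
  have hA0 : 0 ≤ valPart (insert p R) p N ψ i * valPart (insert p R) p N θ j := by
    have hR' : ∀ q ∈ insert p R, q.Prime := by
      intro q hq; rcases Finset.mem_insert.1 hq with rfl | h
      · exact hp
      · exact hR q h
    unfold valPart
    refine mul_nonneg (Finset.sum_nonneg fun v _ => ?_) (Finset.sum_nonneg fun v _ => ?_)
    · split_ifs
      · exact mul_nonneg (hψ _) (phiPart_nonneg hR' _)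
      · exact le_rfl
    · split_ifs
      · exact mul_nonneg (hθ _) (phiPart_nonneg hR' _)
      · exact le_rfl
  have hpg : (0 : ℝ) < p ^ natGap i j := by positivity
  have hpow : ((p : ℝ) ^ (j - i) * valPart (insert p R) p N ψ i *
      (p ^ (i - j) * valPart (insert p R) p N θ j)) ^ (3 / 4 : ℝ) =
      p ^ natGap i j * ((p : ℝ) ^ (-(1 / 4) : ℝ)) ^ natGap i j *
      (valPart (insert p R) p N ψ i * valPart (insert p R) p N θ j) ^ (3 / 4 : ℝ) := by
    have e1 : (p : ℝ) ^ (j - i) * valPart (insert p R) p N ψ i *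
      (p ^ (i - j) * valPart (insert p R) p N θ j) = p ^ natGap i j *
      (valPart (insert p R) p N ψ i * valPart (insert p R) p N θ j) := by
      rw [prime_pow_natGap]; ring
    rw [e1, Real.mul_rpow hpg.le hA0]
    congr 1
    rw [← Real.rpow_natCast, ← Real.rpow_natCast, ← Real.rpow_mul hp0.le, ← Real.rpow_mul hp0.le,
      ← Real.rpow_add hp0]
    congr 1; ring
  rw [hpow] at ih
  have hfin := hkey.trans (mul_le_mul_of_nonneg_left ih hD0)
  refine le_of_mul_le_mul_left (hfin.trans (le_of_eq ?_)) hpg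
  rcases eq_or_ne i j with h | h
  · have h0 : natGap i j = 0 := by unfold natGap; omega
    rw [hD, if_pos h, if_pos h, h0]; ring
  · rw [hD, if_neg h, if_neg h]; ring

theorem min_valPairPart_le {K : ℝ} (hR : ∀ q ∈ R, q.Prime) (hc : ∀ q ∈ P, 1 ≤ c q)
    (hp : p.Prime) (hpR : p ∉ R) (ih : MomentBound P c N R K)
    (hψ : ∀ v, 0 ≤ ψ v) (hθ : ∀ v, 0 ≤ θ v) (hψN : ∀ v, N < v → ψ v = 0)
    (hθN : ∀ v, N < v → θ v = 0) (k : ℕ) :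
    ∑ v ∈ Finset.Icc 1 N, ∑ w ∈ Finset.Icc 1 N,
      (if min (v.factorization p) (w.factorization p) = k then
        pairTerm P c (insert p R) ψ θ v w else 0) ≤
      K * ((if k = 0 then 1 else (1 - 1 / (p : ℝ)) ^ (1 / 2 : ℝ)) *
        ((∑ v ∈ Finset.Icc 1 N, if k ≤ v.factorization p then ψ v * phiPart (insert p R) v else 0) *
        (∑ v ∈ Finset.Icc 1 N, if k ≤ v.factorization p then θ v * phiPart (insert p R) v else 0))
          ^ (3 / 4 : ℝ)) := by
  have hp0 : (0 : ℝ) < p := by exact_mod_cast hp.pos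
  have heps := one_sub_inv_prime_pos hp
  set E : ℝ := 1 - 1 / (p : ℝ) with hE
  have heps1 : E ≤ 1 := by have : 0 ≤ 1 / (p : ℝ) := by positivity
                           linarith
  set δ : ℕ → ℝ := fun v => if k = 0 then (if p ∣ v then E else 1) else 1 with hδ
  have hδ0 : ∀ v, 0 ≤ δ v := fun v => by simp only [hδ]; split_ifs <;> linarith
  have hδ1 : ∀ v, δ v ≤ 1 := fun v => by simp only [hδ]; split_ifs <;> linarith
  set ρ : ℝ := if k = 0 then 1 else E with hρ
  have hρ0 : 0 < ρ := by rw [hρ]; split_ifs <;> linarith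
  have hδρ : ∀ v, (if p ∣ p ^ k * v then E else 1) = ρ * δ v := by
    intro v
    simp only [hρ, hδ]
    rcases Nat.eq_zero_or_pos k with rfl | hk
    · simp
    · rw [if_pos ((dvd_pow_self p hk.ne').mul_right v), if_neg hk.ne', if_neg hk.ne', mul_one]
  have hbig : ∀ v : ℕ, N < v → N < p ^ k * v := fun v h =>
    h.trans_le (Nat.le_mul_of_pos_left v (pow_pos hp.pos k))
  have hsum : ∀ f : ℕ → ℝ, (∀ v, N < v → f v = 0) →
      ∑ v ∈ Finset.Icc 1 N, (if k ≤ v.factorization p then f v * phiPart (insert p R) v else 0) =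
      ρ * ∑ v ∈ Finset.Icc 1 N, f (p ^ k * v) * δ v * phiPart R v := by
    intro f hf
    have h := sum_dvd_eq_of_support (N := N) (pow_pos hp.pos k)
      (f := fun v => f v * phiPart (insert p R) v) (fun v hv => by simp [hf v hv])
    rw [Finset.mul_sum]
    refine Eq.trans (Finset.sum_congr rfl fun v hv => ?_) (h.trans
      (Finset.sum_congr rfl fun v hv => ?_))
    · have hv0 : v ≠ 0 := by simp only [Finset.mem_Icc] at hv; omega
      simp only [hp.pow_dvd_iff_le_factorization hv0]
    · rw [phiPart_insert_mul hR hp hpR, ← hE, hδρ]; ring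
  rw [hsum ψ hψN, hsum θ hθN]
  have hpos : ∀ f : ℕ → ℝ, (∀ v, 0 ≤ f v) → 0 ≤ ∑ v ∈ Finset.Icc 1 N,
      f (p ^ k * v) * δ v * phiPart R v := fun f hf => Finset.sum_nonneg fun v _ =>
    mul_nonneg (mul_nonneg (hf _) (hδ0 _)) (phiPart_nonneg hR _)
  have ih := ih (fun v => ψ (p ^ k * v) * δ v) (fun v => θ (p ^ k * v) * δ v)
    (fun v => mul_nonneg (hψ _) (hδ0 _)) (fun v => mul_nonneg (hθ _) (hδ0 _))
    (fun v h => by simp [hψN _ (hbig v h)]) (fun v h => by simp [hθN _ (hbig v h)])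
  set A := ∑ v ∈ Finset.Icc 1 N, ψ (p ^ k * v) * δ v * phiPart R v with hA
  set B := ∑ v ∈ Finset.Icc 1 N, θ (p ^ k * v) * δ v * phiPart R v with hB
  have hA0 : 0 ≤ A := hpos ψ hψ
  have hB0 : 0 ≤ B := hpos θ hθ
  have eM : ∑ v ∈ Finset.Icc 1 N, ∑ w ∈ Finset.Icc 1 N,
      (if min (v.factorization p) (w.factorization p) = k then
        pairTerm P c (insert p R) ψ θ v w else 0) = ∑ v ∈ Finset.Icc 1 N, ∑ w ∈ Finset.Icc 1 N,
      (if p ∣ v ∧ p ∣ w then 0 else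
        pairTerm P c (insert p R) ψ θ (p ^ k * v) (p ^ k * w)) := by
    have e1 : ∀ v ∈ Finset.Icc 1 N, ∑ w ∈ Finset.Icc 1 N,
        (if min (v.factorization p) (w.factorization p) = k then
          pairTerm P c (insert p R) ψ θ v w else 0) = if p ^ k ∣ v then
        ∑ w ∈ Finset.Icc 1 N, (if min (v.factorization p) ((p ^ k * w).factorization p) = k then
          pairTerm P c (insert p R) ψ θ v (p ^ k * w) else 0) else 0 := by
      intro v hv
      have hv0 : v ≠ 0 := by simp only [Finset.mem_Icc] at hv; omega
      rw [← sum_dvd_eq_of_support (N := N) (pow_pos hp.pos k)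
        (f := fun w => if min (v.factorization p) (w.factorization p) = k then
          pairTerm P c (insert p R) ψ θ v w else 0)
        fun w h => by rw [pairTerm_eq_zero_right (hθN w h) v]; simp]
      split_ifs with h
      · refine Finset.sum_congr rfl fun w hw => ?_
        have hw0 : w ≠ 0 := by simp only [Finset.mem_Icc] at hw; omega
        split_ifs with h1 h2
        · rfl
        · rw [hp.pow_dvd_iff_le_factorization hw0] at h2
          exact absurd (h1 ▸ min_le_right _ _) h2
        · rfl
        · rfl
      · refine Finset.sum_eq_zero fun w hw => ?_
        rw [hp.pow_dvd_iff_le_factorization hv0] at h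
        rw [if_neg]
        intro h1; exact h (h1 ▸ min_le_left _ _)
    rw [Finset.sum_congr rfl e1, sum_dvd_eq_of_support (pow_pos hp.pos k)]
    · refine Finset.sum_congr rfl fun v hv => Finset.sum_congr rfl fun w hw => ?_
      have hv0 : v ≠ 0 := by simp only [Finset.mem_Icc] at hv; omega
      have hw0 : w ≠ 0 := by simp only [Finset.mem_Icc] at hw; omega
      have hiff : min ((p ^ k * v).factorization p) ((p ^ k * w).factorization p) = k ↔
          ¬ (p ∣ v ∧ p ∣ w) := by
        rw [factorization_pow_mul_self hp hv0, factorization_pow_mul_self hp hw0,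
          hp.dvd_iff_one_le_factorization hv0, hp.dvd_iff_one_le_factorization hw0]
        omega
      by_cases h : p ∣ v ∧ p ∣ w
      · rw [if_neg (by rw [hiff]; exact not_not.2 h), if_pos h]
      · rw [if_pos (hiff.2 h), if_neg h]
    · intro v h
      refine Finset.sum_eq_zero fun w _ => ?_
      rw [pairTerm_eq_zero_left (hψN v h)]; simp
  have hkey : ∑ v ∈ Finset.Icc 1 N, ∑ w ∈ Finset.Icc 1 N, (if p ∣ v ∧ p ∣ w then 0 else
        pairTerm P c (insert p R) ψ θ (p ^ k * v) (p ^ k * w)) ≤ ρ ^ 2 *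
      ∑ v ∈ Finset.Icc 1 N, ∑ w ∈ Finset.Icc 1 N,
        pairTerm P c R (fun v => ψ (p ^ k * v) * δ v) (fun v => θ (p ^ k * v) * δ v) v w := by
    rw [Finset.mul_sum]
    refine Finset.sum_le_sum fun v hv => ?_
    rw [Finset.mul_sum]
    refine Finset.sum_le_sum fun w hw => ?_
    have hv0 : v ≠ 0 := by simp only [Finset.mem_Icc] at hv; omega
    have hw0 : w ≠ 0 := by simp only [Finset.mem_Icc] at hw; omega
    split_ifs with h
    · exact mul_nonneg (sq_nonneg _) (pairTerm_nonneg hR hc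
        (fun v => mul_nonneg (hψ _) (hδ0 _)) (fun v => mul_nonneg (hθ _) (hδ0 _)) v w)
    · have := pairTerm_insert_le (P := P) (c := c) (R := R) (ψ := ψ) (θ := θ)
        (ψ' := fun v => ψ (p ^ k * v) * δ v)
        (θ' := fun v => θ (p ^ k * v) * δ v) (L := ρ ^ 2) (D := 1)
        (i := k) (j := k) (v := v) (w := w) hR hc hp hpR
        (fun v => mul_nonneg (hψ _) (hδ0 _)) (fun v => mul_nonneg (hθ _) (hδ0 _)) (sq_nonneg _)
        zero_le_one (by rw [min_self, Nat.gcd_mul_left]) h ?_ ?_ ?_ ?_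
      · simpa [natGap] using this
      · simpa using mul_le_of_le_one_right (hψ (p ^ k * v)) (hδ1 v)
      · simpa using mul_le_of_le_one_right (hθ (p ^ k * w)) (hδ1 w)
      · have h0 : natGap k k = 0 := by simp [natGap]
        simp only [h0, pow_zero, one_mul]
        rw [← hE, hδρ, hδρ]; exact le_of_eq (by ring)
      · rw [diffProd_pow_mul_same hp hv0 hw0, one_mul]
  rw [eM]
  refine hkey.trans ((mul_le_mul_of_nonneg_left ih (sq_nonneg ρ)).trans (le_of_eq ?_))
  have e3 : ρ * A * (ρ * B) = ρ ^ 2 * (A * B) := by ring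
  rw [e3, Real.mul_rpow (sq_nonneg ρ) (mul_nonneg hA0 hB0)]
  have e4 : ρ ^ 2 = (if k = 0 then 1 else E ^ (1 / 2 : ℝ)) * (ρ ^ 2) ^ (3 / 4 : ℝ) := by
    rw [hρ]
    split_ifs
    · simp
    · rw [← Real.rpow_natCast, ← Real.rpow_mul heps.le, ← Real.rpow_add heps]
      congr 1; norm_num
  calc ρ ^ 2 * (K * (A * B) ^ (3 / 4 : ℝ)) = K * (ρ ^ 2 * (A * B) ^ (3 / 4 : ℝ)) := by ring
    _ = K * (((if k = 0 then 1 else E ^ (1 / 2 : ℝ)) * (ρ ^ 2) ^ (3 / 4 : ℝ)) *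
        (A * B) ^ (3 / 4 : ℝ)) := by rw [← e4]
    _ = _ := by ring

end insertPrime

section insertPrime

variable {P : Finset ℕ} {c : ℕ → ℝ} {R : Finset ℕ} {p N : ℕ} {ψ θ : ℕ → ℝ}

theorem sum_valPart_filter (k : ℕ) :
    ∑ i ∈ (Finset.range (N + 1)).filter (k ≤ ·), valPart R p N ψ i =
      ∑ v ∈ Finset.Icc 1 N, if k ≤ v.factorization p then ψ v * phiPart R v else 0 := by
  unfold valPart
  rw [Finset.sum_comm]
  refine Finset.sum_congr rfl fun v hv => ?_
  rw [Finset.sum_ite_eq]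
  simp only [Finset.mem_Icc] at hv
  have := Nat.factorization_lt (n := v) p (by omega)
  congr 1
  simp only [Finset.mem_filter, Finset.mem_range, eq_iff_iff]
  omega

theorem sum_valPairPart (Q : ℕ → ℕ → Prop) [∀ i j, Decidable (Q i j)] :
    ∑ i ∈ Finset.range (N + 1), ∑ j ∈ Finset.range (N + 1),
      (if Q i j then valPairPart P c R p N ψ θ i j else 0) =
    ∑ v ∈ Finset.Icc 1 N, ∑ w ∈ Finset.Icc 1 N,
      if Q (v.factorization p) (w.factorization p) then pairTerm P c R ψ θ v w else 0 := by
  have e1 : ∀ i j, (if Q i j then valPairPart P c R p N ψ θ i j else 0) =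
      ∑ v ∈ Finset.Icc 1 N, ∑ w ∈ Finset.Icc 1 N, if v.factorization p = i then
        if w.factorization p = j then
          if Q i j then pairTerm P c R ψ θ v w else 0 else 0 else 0 := by
    intro i j
    unfold valPairPart
    split_ifs with h
    · simp_rw [ite_and]
    · simp
  simp_rw [e1]
  have e2 : ∀ i, ∑ j ∈ Finset.range (N + 1), ∑ v ∈ Finset.Icc 1 N, ∑ w ∈ Finset.Icc 1 N,
      (if v.factorization p = i then if w.factorization p = j then
          if Q i j then pairTerm P c R ψ θ v w else 0 else 0 else 0) =
      ∑ v ∈ Finset.Icc 1 N, if v.factorization p = i then ∑ w ∈ Finset.Icc 1 N,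
          if Q i (w.factorization p) then pairTerm P c R ψ θ v w else 0 else 0 := by
    intro i
    rw [Finset.sum_comm]
    refine Finset.sum_congr rfl fun v hv => ?_
    split_ifs with h
    · rw [Finset.sum_comm]
      refine Finset.sum_congr rfl fun w hw => ?_
      simp only [Finset.mem_Icc] at hw
      have := Nat.factorization_lt (n := w) p (by omega)
      rw [Finset.sum_ite_eq, if_pos (Finset.mem_range.2 (by omega))]
    · simp
  simp_rw [e2]
  rw [Finset.sum_comm]
  refine Finset.sum_congr rfl fun v hv => ?_
  simp only [Finset.mem_Icc] at hv
  have := Nat.factorization_lt (n := v) p (by omega)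
  rw [Finset.sum_ite_eq, if_pos (Finset.mem_range.2 (by omega))]

/-- The loss incurred at the prime `p` with weight `a` in the moment bound. -/
def primeLoss (p : ℕ) (a : ℝ) : ℝ :=
  if 2 ^ 88 ≤ p then 1 + 2 ^ 100 * ((p : ℝ) ^ (-(3 / 2) : ℝ) + (a - 1) / p) else 769

theorem momentBound_insert {K : ℝ} (hK : 0 < K) (hR : ∀ q ∈ R, q.Prime) (hc : ∀ q ∈ P, 1 ≤ c q)
    (hc' : ∀ q ∈ P, c q ≤ 64)
    (hp : p.Prime) (hpR : p ∉ R) (hpP : p ∈ P) (ih : MomentBound P c N R K) :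
    MomentBound P c N (insert p R) (K * primeLoss p (c p)) := by
  intro ψ θ hψ hθ hψN hθN
  have hp0 : (0 : ℝ) < p := by exact_mod_cast hp.pos
  set R' := insert p R with hR'
  have hR'p : ∀ q ∈ R', q.Prime := by
    intro q hq; rcases Finset.mem_insert.1 hq with rfl | h
    · exact hp
    · exact hR q h
  have hm1 := valPairPart_le hR hc hp hpR hpP ih hψ hθ hψN hθN
  have hm2 := min_valPairPart_le hR hc hp hpR ih hψ hθ hψN hθN
  rw [← hR'] at hm1 hm2
  set r : ℝ := (p : ℝ) ^ (-(1 / 4) : ℝ) with hr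
  have hr0 : 0 < r := Real.rpow_pos_of_pos hp0 _
  have hr4 : r ^ 4 = 1 / p := by
    rw [hr, ← Real.rpow_natCast, ← Real.rpow_mul hp0.le, one_div]
    norm_num [Real.rpow_neg_one]
  have hr6 : r ^ 6 = (p : ℝ) ^ (-(3 / 2) : ℝ) := by
    rw [hr, ← Real.rpow_natCast, ← Real.rpow_mul hp0.le]; norm_num
  set A := ∑ v ∈ Finset.Icc 1 N, ψ v * phiPart R' v with hA
  set B := ∑ v ∈ Finset.Icc 1 N, θ v * phiPart R' v with hB
  set m := valPairPart P c R' p N ψ θ with hmdef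
  set a := valPart R' p N ψ with hadef
  set b := valPart R' p N θ with hbdef
  have ha0 : ∀ i, 0 ≤ a i := fun i => Finset.sum_nonneg fun v _ => by
    split_ifs
    · exact mul_nonneg (hψ _) (phiPart_nonneg hR'p _)
    · exact le_rfl
  have hb0 : ∀ i, 0 ≤ b i := fun i => Finset.sum_nonneg fun v _ => by
    split_ifs
    · exact mul_nonneg (hθ _) (phiPart_nonneg hR'p _)
    · exact le_rfl
  have hm0 : ∀ i j, 0 ≤ m i j := fun i j => Finset.sum_nonneg fun v _ =>
    Finset.sum_nonneg fun w _ => by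
      split_ifs
      · exact pairTerm_nonneg hR'p hc hψ hθ v w
      · exact le_rfl
  have hsa : ∑ i ∈ Finset.range (N + 1), a i = A := by
    have := sum_valPart_filter (R := R') (p := p) (N := N) (ψ := ψ) 0
    simpa using this
  have hsb : ∑ i ∈ Finset.range (N + 1), b i = B := by
    have := sum_valPart_filter (R := R') (p := p) (N := N) (ψ := θ) 0
    simpa using this
  have hsm : ∑ v ∈ Finset.Icc 1 N, ∑ w ∈ Finset.Icc 1 N, pairTerm P c R' ψ θ v w =
      ∑ i ∈ Finset.range (N + 1), ∑ j ∈ Finset.range (N + 1), m i j := by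
    have := sum_valPairPart (P := P) (c := c) (R := R') (p := p) (N := N) (ψ := ψ) (θ := θ)
      (fun _ _ => True)
    simpa using this.symm
  rw [hsm]
  have hA0 : 0 ≤ A := hsa ▸ Finset.sum_nonneg fun i _ => ha0 i
  have hB0 : 0 ≤ B := hsb ▸ Finset.sum_nonneg fun i _ => hb0 i
  rcases (mul_nonneg hA0 hB0).eq_or_lt with h0 | h0
  · rw [← h0, Real.zero_rpow (by norm_num), mul_zero]
    refine Finset.sum_nonpos fun i hi => Finset.sum_nonpos fun j hj => ?_
    refine (hm1 i j).trans (le_of_eq ?_)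
    have h1 : a i * b j = 0 := by
      have i1 : a i ≤ A := hsa ▸ Finset.single_le_sum (fun i _ => ha0 i) hi
      have i2 : b j ≤ B := hsb ▸ Finset.single_le_sum (fun i _ => hb0 i) hj
      exact le_antisymm (h0 ▸ mul_le_mul i1 i2 (hb0 j) hA0) (mul_nonneg (ha0 i) (hb0 j))
    rw [h1, Real.zero_rpow (by norm_num)]; simp
  have hAp : 0 < A := lt_of_le_of_ne hA0 fun h => by rw [← h] at h0; simp at h0
  have hBp : 0 < B := lt_of_le_of_ne hB0 fun h => by rw [← h] at h0; simp at h0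
  set Z := K * (A * B) ^ (3 / 4 : ℝ) with hZ
  have hZ0 : 0 < Z := mul_pos hK (Real.rpow_pos_of_pos h0 _)
  have hx4 : ∀ i, ((a i / A) ^ (1 / 4 : ℝ)) ^ 4 = a i / A := fun i => by
    rw [← Real.rpow_natCast, ← Real.rpow_mul (div_nonneg (ha0 i) hA0)]; norm_num
  have hy4 : ∀ i, ((b i / B) ^ (1 / 4 : ℝ)) ^ 4 = b i / B := fun i => by
    rw [← Real.rpow_natCast, ← Real.rpow_mul (div_nonneg (hb0 i) hB0)]; norm_num
  have hxs : ∑ i ∈ Finset.range (N + 1), ((a i / A) ^ (1 / 4 : ℝ)) ^ 4 ≤ 1 := by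
    simp_rw [hx4]; rw [← Finset.sum_div, hsa, div_self hAp.ne']
  have hys : ∑ i ∈ Finset.range (N + 1), ((b i / B) ^ (1 / 4 : ℝ)) ^ 4 ≤ 1 := by
    simp_rw [hy4]; rw [← Finset.sum_div, hsb, div_self hBp.ne']
  have hcube : ∀ i j, ((a i / A) ^ (1 / 4 : ℝ) * (b j / B) ^ (1 / 4 : ℝ)) ^ 3 =
      (a i * b j) ^ (3 / 4 : ℝ) / (A * B) ^ (3 / 4 : ℝ) := by
    intro i j
    rw [← Real.mul_rpow (div_nonneg (ha0 i) hA0) (div_nonneg (hb0 j) hB0), ← Real.rpow_natCast,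
      ← Real.rpow_mul (mul_nonneg (div_nonneg (ha0 i) hA0) (div_nonneg (hb0 j) hB0)),
      div_mul_div_comm, ← Real.div_rpow (mul_nonneg (ha0 i) (hb0 j)) h0.le]
    norm_num
  have hcp := hc p hpP
  have hmn : ∀ i j, m i j / Z ≤ (if i = j then 1 else c p * r ^ natGap i j) *
      ((a i / A) ^ (1 / 4 : ℝ) * (b j / B) ^ (1 / 4 : ℝ)) ^ 3 := by
    intro i j
    rw [hcube, div_le_iff₀ hZ0]
    refine (hm1 i j).trans (le_of_eq ?_)
    rw [hZ]
    have := (Real.rpow_pos_of_pos h0 (3 / 4 : ℝ)).ne'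
    field_simp
  have goal : ∀ κ : ℝ, ∑ i ∈ Finset.range (N + 1), ∑ j ∈ Finset.range (N + 1), m i j / Z ≤ κ →
      ∑ i ∈ Finset.range (N + 1), ∑ j ∈ Finset.range (N + 1), m i j ≤
        K * κ * (A * B) ^ (3 / 4 : ℝ) := by
    intro κ h
    simp_rw [← Finset.sum_div] at h
    rw [div_le_iff₀ hZ0] at h
    refine h.trans (le_of_eq ?_)
    rw [hZ]; ring
  have hx0 : ∀ i, 0 ≤ (a i / A) ^ (1 / 4 : ℝ) := fun i =>
    Real.rpow_nonneg (div_nonneg (ha0 i) hA0) _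
  have hy0 : ∀ i, 0 ≤ (b i / B) ^ (1 / 4 : ℝ) := fun i =>
    Real.rpow_nonneg (div_nonneg (hb0 i) hB0) _
  have hmn0 : ∀ i j, 0 ≤ m i j / Z := fun i j => div_nonneg (hm0 i j) hZ0.le
  apply goal
  unfold primeLoss
  split_ifs with hbig
  · rw [← hr6]
    have e : (c p - 1) / p = (c p - 1) * r ^ 4 := by rw [hr4]; ring
    rw [e]
    refine bilinear_refined hr0 ?_ hcp (hc' p hpP) hx0 hy0 hmn0 hxs hys hmn ?_
    · refine le_of_pow_le_pow_left₀ (n := 4) (by norm_num) (by positivity) ?_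
      rw [hr4, div_pow, one_pow, ← pow_mul]
      refine one_div_le_one_div_of_le (by positivity) ?_
      exact_mod_cast hbig
    · intro k
      simp_rw [hx4, hy4]
      rw [← Finset.sum_div, ← Finset.sum_div, sum_valPart_filter, sum_valPart_filter,
        div_mul_div_comm, Real.div_rpow _ h0.le, hr4]
      · have e1 : ∀ i j, (if min i j = k then m i j / Z else 0) =
            (if min i j = k then m i j else 0) / Z := by
          intro i j; split_ifs <;> simp
        simp_rw [e1, ← Finset.sum_div]
        rw [hmdef, sum_valPairPart fun i j => min i j = k, div_le_iff₀ hZ0]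
        refine (hm2 k).trans (le_of_eq ?_)
        rw [hZ]
        have := (Real.rpow_pos_of_pos h0 (3 / 4 : ℝ)).ne'
        field_simp
      · refine mul_nonneg (Finset.sum_nonneg fun v _ => ?_) (Finset.sum_nonneg fun v _ => ?_)
        · split_ifs
          · exact mul_nonneg (hψ _) (phiPart_nonneg hR'p _)
          · exact le_rfl
        · split_ifs
          · exact mul_nonneg (hθ _) (phiPart_nonneg hR'p _)
          · exact le_rfl
  · have hr85 : r ≤ 17 / 20 := by
      refine le_of_pow_le_pow_left₀ (n := 4) (by norm_num) (by positivity) ?_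
      rw [hr4]
      have : (2 : ℝ) ≤ p := by exact_mod_cast hp.two_le
      refine (one_div_le_one_div_of_le (by norm_num) this).trans (by norm_num)
    refine (bilinear_crude hr0.le (by linarith) (by linarith) hxs hys hmn).trans ?_
    have h6 : r / (1 - r) ≤ 6 := by rw [div_le_iff₀ (by linarith)]; linarith
    have h60 : 0 ≤ r / (1 - r) := div_nonneg hr0.le (by linarith)
    have := hc' p hpP
    nlinarith

end insertPrime

/-- The weight attached to the prime `q` in the moment bound at level `t`. -/
def momentWeight (t q : ℕ) : ℝ := if t < q then Real.exp (4 * t / q) else 1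

theorem one_le_momentWeight (t q : ℕ) : 1 ≤ momentWeight t q := by
  unfold momentWeight
  split_ifs
  · exact Real.one_le_exp (by positivity)
  · exact le_rfl

theorem momentWeight_le (t q : ℕ) : momentWeight t q ≤ 64 := by
  unfold momentWeight
  split_ifs with h
  · have hq : (0 : ℝ) < q := by exact_mod_cast (Nat.zero_le t).trans_lt h
    have hle : 4 * (t : ℝ) / q ≤ 4 := by
      rw [div_le_iff₀ hq]
      have : (t : ℝ) ≤ q := by exact_mod_cast h.le
      linarith
    refine (Real.exp_le_exp.2 hle).trans ?_
    have e : Real.exp 4 = Real.exp 1 ^ 4 := by rw [← Real.exp_nat_mul]; norm_num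
    rw [e]
    have h1 := Real.exp_one_lt_d9.le
    refine (pow_le_pow_left₀ (Real.exp_pos 1).le h1 4).trans (by norm_num)
  · norm_num

theorem exp_sub_one_le_mul_exp (x : ℝ) : Real.exp x - 1 ≤ x * Real.exp x := by
  have h := Real.add_one_le_exp (-x)
  have h2 := Real.exp_pos x
  have h3 : Real.exp (-x) * Real.exp x = 1 := by rw [← Real.exp_add]; simp
  nlinarith

theorem sum_inv_sq_gt_le {t : ℕ} (ht : 1 ≤ t) (P : Finset ℕ) :
    ∑ q ∈ P.filter (t < ·), (t : ℝ) / (q : ℝ) ^ 2 ≤ 2 := by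
  obtain ⟨n, hn⟩ : ∃ n, P ⊆ Finset.range n := ⟨P.sup id + 1, fun q hq =>
    Finset.mem_range.2 (Nat.lt_succ_of_le (Finset.le_sup (f := id) hq))⟩
  have ht0 : (0 : ℝ) < t := by exact_mod_cast ht
  calc ∑ q ∈ P.filter (t < ·), (t : ℝ) / (q : ℝ) ^ 2
      ≤ ∑ q ∈ Finset.Ioo t n, (t : ℝ) / (q : ℝ) ^ 2 := by
        refine Finset.sum_le_sum_of_subset_of_nonneg ?_ fun _ _ _ => by positivity
        intro q hq
        rw [Finset.mem_filter] at hq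
        exact Finset.mem_Ioo.2 ⟨hq.2, Finset.mem_range.1 (hn hq.1)⟩
    _ = t * ∑ q ∈ Finset.Ioo t n, ((q : ℝ) ^ 2)⁻¹ := by
        rw [Finset.mul_sum]; rfl
    _ ≤ t * (2 / (t + 1)) := by gcongr; exact sum_Ioo_inv_sq_le t n
    _ ≤ 2 := by
        rw [mul_div_assoc', div_le_iff₀ (by linarith)]; linarith

theorem sum_momentWeight_pow_le {t : ℕ} (ht : 1 ≤ t) (k : ℕ) (P : Finset ℕ) :
    ∑ q ∈ P, (momentWeight t q ^ k - 1) / q ≤ 8 * k * Real.exp (4 * k) := by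
  have ht0 : (0 : ℝ) < t := by exact_mod_cast ht
  have h1 : ∀ q ∈ P, (momentWeight t q ^ k - 1) / q ≤
      if t < q then 4 * k * Real.exp (4 * k) * ((t : ℝ) / (q : ℝ) ^ 2) else 0 := by
    intro q _
    unfold momentWeight
    split_ifs with h
    · have hq : (0 : ℝ) < q := by exact_mod_cast (Nat.zero_le t).trans_lt h
      rw [← Real.exp_nat_mul, div_le_iff₀ hq]
      refine (exp_sub_one_le_mul_exp _).trans ?_
      have hle : (k : ℝ) * (4 * t / q) ≤ 4 * k := by
        have : (t : ℝ) / q ≤ 1 := by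
          rw [div_le_one hq]; exact_mod_cast h.le
        calc (k : ℝ) * (4 * t / q) = 4 * k * (t / q) := by ring
          _ ≤ 4 * k * 1 := by gcongr
          _ = _ := mul_one _
      calc (k : ℝ) * (4 * t / q) * Real.exp (k * (4 * t / q))
          ≤ k * (4 * t / q) * Real.exp (4 * k) := by gcongr
        _ = _ := by field_simp
    · simp
  refine (Finset.sum_le_sum h1).trans ?_
  rw [← Finset.sum_filter, ← Finset.mul_sum]
  have := sum_inv_sq_gt_le ht P
  have h0 : 0 ≤ 4 * k * Real.exp (4 * k) := by positivity
  nlinarith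

theorem prod_ite_le_pow {a : ℝ} (ha : 1 ≤ a) (M : ℕ) (P : Finset ℕ) :
    ∏ q ∈ P, (if M ≤ q then 1 else a) ≤ a ^ M := by
  rw [Finset.prod_ite, Finset.prod_const_one, one_mul, Finset.prod_const]
  refine pow_le_pow_right₀ ha ?_
  refine (Finset.card_le_card (t := Finset.range M) fun q hq => ?_).trans (by simp)
  simp only [Finset.mem_filter, not_le] at hq
  exact Finset.mem_range.2 hq.2

theorem exists_prod_primeLoss_le : ∃ A : ℝ, 0 < A ∧ ∀ t : ℕ, 1 ≤ t → ∀ P : Finset ℕ,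
    ∏ q ∈ P, primeLoss q (momentWeight t q) ≤ A := by
  unfold primeLoss
  obtain ⟨M, hM⟩ : ∃ M : ℕ, M = 2 ^ 88 := ⟨_, rfl⟩
  obtain ⟨L, hL⟩ : ∃ L : ℝ, L = 2 ^ 100 := ⟨_, rfl⟩
  have hL0 : 0 ≤ L := by rw [hL]; positivity
  rw [← hM, ← hL]
  have hs : Summable fun q : ℕ => (q : ℝ) ^ (-(3 / 2) : ℝ) := Real.summable_nat_rpow.2 (by norm_num)
  refine ⟨Real.exp (L * ((∑' q : ℕ, (q : ℝ) ^ (-(3 / 2) : ℝ)) +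
      8 * (1 : ℕ) * Real.exp (4 * (1 : ℕ))))
    * 769 ^ M, by positivity, fun t ht P => ?_⟩
  have h1 : ∀ q ∈ P, (if M ≤ q then 1 + L * ((q : ℝ) ^ (-(3 / 2) : ℝ) + (momentWeight t q - 1) / q)
      else 769) ≤ Real.exp (L * ((q : ℝ) ^ (-(3 / 2) : ℝ) + (momentWeight t q ^ 1 - 1) / q)) *
        (if M ≤ q then 1 else 769) := by
    intro q _
    rw [pow_one]
    have := one_le_momentWeight t q
    have hx : 0 ≤ L * ((q : ℝ) ^ (-(3 / 2) : ℝ) + (momentWeight t q - 1) / q) :=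
      mul_nonneg hL0 (add_nonneg (by positivity) (div_nonneg (by linarith) (by positivity)))
    split_ifs
    · rw [mul_one, add_comm]; exact Real.add_one_le_exp _
    · have := Real.one_le_exp hx
      linarith
  have h0 : ∀ q ∈ P, 0 ≤ (if M ≤ q then 1 + L * ((q : ℝ) ^ (-(3 / 2) : ℝ) +
      (momentWeight t q - 1) / q) else 769) := by
    intro q _
    have := one_le_momentWeight t q
    have hx : 0 ≤ L * ((q : ℝ) ^ (-(3 / 2) : ℝ) + (momentWeight t q - 1) / q) :=
      mul_nonneg hL0 (add_nonneg (by positivity) (div_nonneg (by linarith) (by positivity)))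
    split_ifs <;> linarith
  refine (Finset.prod_le_prod h0 h1).trans ?_
  rw [Finset.prod_mul_distrib, ← Real.exp_sum, ← Finset.mul_sum, Finset.sum_add_distrib]
  refine mul_le_mul ?_ (prod_ite_le_pow (by norm_num) M P) (Finset.prod_nonneg fun q _ => ?_)
    (Real.exp_pos _).le
  · refine Real.exp_le_exp.2 (mul_le_mul_of_nonneg_left (add_le_add ?_ ?_) hL0)
    · exact hs.sum_le_tsum P fun q _ => by positivity
    · exact sum_momentWeight_pow_le ht 1 P
  · split_ifs <;> norm_num

theorem primeLoss_pos (p : ℕ) {a : ℝ} (ha : 1 ≤ a) : 0 < primeLoss p a := by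
  unfold primeLoss
  have : 0 ≤ (a - 1) / (p : ℝ) := div_nonneg (by linarith) (by positivity)
  have : 0 ≤ (p : ℝ) ^ (-(3 / 2) : ℝ) := by positivity
  split_ifs <;> positivity

theorem momentBound_empty {P : Finset ℕ} {c : ℕ → ℝ} {C : ℝ} (N : ℕ) (hP : ∀ q ∈ P, q.Prime)
    (hc : ∀ q ∈ P, 1 ≤ c q) (hC : ∏ q ∈ P, (1 + (c q ^ 4 - 1) / q) ≤ C) :
    MomentBound P c N ∅ (√(2 * C)) := by
  intro ψ θ hψ hθ _ _
  have h1 : ∀ v, phiPart ∅ v = 1 := fun v => by simp [phiPart, dvdProd]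
  simp only [h1, mul_one]
  refine le_trans (Finset.sum_le_sum fun v hv => Finset.sum_le_sum fun w hw => ?_)
    (base_le hP hc hC hψ hθ)
  have hv0 : v ≠ 0 := by simp only [Finset.mem_Icc] at hv; omega
  unfold pairTerm
  have hnn : 0 ≤ ψ v * θ w * diffProd P c v w :=
    mul_nonneg (mul_nonneg (hψ v) (hθ w)) (diffProd_nonneg hc v w)
  rw [h1, h1, mul_one, mul_one]
  split_ifs with h h' h'
  · exact le_rfl
  · exfalso
    obtain ⟨a1, a2, a3⟩ := h
    have : v.gcd w = 1 := by
      have := Finset.subset_empty.1 a3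
      rcases Nat.primeFactors_eq_empty.1 this with h | h
      · exact absurd (Nat.eq_zero_of_gcd_eq_zero_left h) hv0
      · exact h
    rw [this] at a1 a2
    exact h' ⟨by simpa using a1, by simpa using a2⟩
  · exact hnn
  · exact le_rfl

/-- The moment bound with a constant independent of `t` and `N`. -/
theorem exists_momentBound : ∃ A : ℝ, 0 < A ∧ ∀ t : ℕ, 1 ≤ t → ∀ N : ℕ,
    MomentBound (N + 1).primesBelow (momentWeight t) N (N + 1).primesBelow A := by
  obtain ⟨A, hA, hAp⟩ := exists_prod_primeLoss_le
  set C : ℝ := Real.exp (8 * (4 : ℕ) * Real.exp (4 * (4 : ℕ))) with hC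
  have hC0 : 0 < C := Real.exp_pos _
  refine ⟨√(2 * C) * A, by positivity, fun t ht N => ?_⟩
  set P := (N + 1).primesBelow with hPdef
  have hP : ∀ q ∈ P, q.Prime := fun q hq => Nat.prime_of_mem_primesBelow hq
  have hbase : ∏ q ∈ P, (1 + (momentWeight t q ^ 4 - 1) / q) ≤ C := by
    refine (Finset.prod_le_prod (fun q _ => ?_) fun q _ => ?_).trans
      ((Real.exp_sum P fun q => (momentWeight t q ^ 4 - 1) / (q : ℝ)).symm.le.trans
        (Real.exp_le_exp.2 (sum_momentWeight_pow_le ht 4 P)))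
    · have := one_le_pow₀ (one_le_momentWeight t q) (n := 4)
      have : 0 ≤ (momentWeight t q ^ 4 - 1) / (q : ℝ) := div_nonneg (by linarith) (by positivity)
      linarith
    · rw [add_comm]; exact Real.add_one_le_exp _
  have hind : ∀ R : Finset ℕ, R ⊆ P → MomentBound P (momentWeight t) N R
      (√(2 * C) * ∏ q ∈ R, primeLoss q (momentWeight t q)) := by
    intro R
    induction R using Finset.induction_on with
    | empty =>
      intro _
      rw [Finset.prod_empty, mul_one]
      exact momentBound_empty N hP (fun q _ => one_le_momentWeight t q) hbase
    | insert q R hq ih =>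
      intro hR
      rw [Finset.prod_insert hq, mul_comm (primeLoss _ _), ← mul_assoc]
      have hqP := hR (Finset.mem_insert_self q R)
      refine momentBound_insert ?_ (fun r hr => hP r (hR (Finset.mem_insert_of_mem hr)))
        (fun q _ => one_le_momentWeight t q) (fun q _ => momentWeight_le t q) (hP q hqP) hq hqP
        (ih fun r hr => hR (Finset.mem_insert_of_mem hr))
      have := Finset.prod_pos fun r (_ : r ∈ R) => primeLoss_pos r (one_le_momentWeight t r)
      positivity
  intro ψ θ hψ hθ hψN hθN
  refine (hind P subset_rfl ψ θ hψ hθ hψN hθN).trans ?_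
  have := hAp t ht P
  refine mul_le_mul_of_nonneg_right (mul_le_mul_of_nonneg_left this (by positivity)) ?_
  have h0 : ∀ ψ : ℕ → ℝ, (∀ v, 0 ≤ ψ v) → 0 ≤ ∑ v ∈ Finset.Icc 1 N, ψ v * phiPart P v :=
    fun ψ hψ => Finset.sum_nonneg fun v _ => mul_nonneg (hψ v) (phiPart_nonneg hP v)
  exact Real.rpow_nonneg (mul_nonneg (h0 ψ hψ) (h0 θ hθ)) _

theorem sum_zmod_prod_eq (Q : Finset ℕ) (hQ : ∀ q ∈ Q, q.Prime) (f : (q : ℕ) → ZMod q → ℝ)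
    [∀ q : Q, Fintype (ZMod q)] [Fintype (ZMod (∏ q : Q, (q : ℕ)))] :
    ∑ x : ZMod (∏ q : Q, (q : ℕ)), ∏ q : Q, f q (x.cast : ZMod q) =
      ∏ q : Q, ∑ y : ZMod q, f q y := by
  have hco : Pairwise fun i j : Q => ((i : ℕ)).Coprime (j : ℕ) := fun i j hij =>
    (Nat.coprime_primes (hQ i i.2) (hQ j j.2)).2 fun h => hij (Subtype.ext h)
  rw [Finset.prod_univ_sum, Fintype.piFinset_univ]
  refine Fintype.sum_equiv (ZMod.prodEquivPi (fun q : Q => (q : ℕ)) hco).toEquiv _ _ fun x => ?_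
  refine Finset.prod_congr rfl fun q _ => congrArg _ ?_
  exact (ZMod.prodEquivPi_apply _ _ _ _).symm

theorem sum_Ico_eq_sum_zmod {L : ℕ} [NeZero L] (F : ZMod L → ℝ) (x : ℤ) :
    ∑ j ∈ Finset.Ico x (x + L), F (j : ZMod L) = ∑ y : ZMod L, F y := by
  refine Finset.sum_bij' (fun j _ => (j : ZMod L)) (fun y _ => x + ((y - (x : ZMod L)).val : ℤ))
    ?_ ?_ ?_ ?_ ?_
  · simp
  · intro y _
    have := ZMod.val_lt (y - (x : ZMod L))
    rw [Finset.mem_Ico]; omega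
  · intro j hj
    rw [Finset.mem_Ico] at hj
    have e : ((j : ZMod L) - (x : ZMod L)) = ((j - x).toNat : ZMod L) := by
      rw [← Int.cast_sub, ← Int.cast_natCast, Int.toNat_of_nonneg (by omega)]
    rw [e, ZMod.val_natCast, Nat.mod_eq_of_lt (by omega)]
    omega
  · intro y _
    simp
  · simp

theorem sum_Ico_mul_periodic {L : ℕ} (F : ℤ → ℝ) (S : ℝ)
    (hF : ∀ x : ℤ, ∑ j ∈ Finset.Ico x (x + L), F j = S) (m : ℕ) (x : ℤ) :
    ∑ j ∈ Finset.Ico x (x + (L * m : ℕ)), F j = m * S := by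
  induction m with
  | zero => simp
  | succ m ih =>
    have e0 : Finset.Ico x (x + (L * (m + 1) : ℕ)) = Finset.Ico x (x + (L * m : ℕ)) ∪
        Finset.Ico (x + (L * m : ℕ)) (x + (L * (m + 1) : ℕ)) := by
      rw [Finset.Ico_union_Ico_eq_Ico (by omega) (by push_cast; nlinarith)]
    rw [e0, Finset.sum_union (Finset.Ico_disjoint_Ico_consecutive _ _ _), ih]
    have e : x + ((L * (m + 1) : ℕ) : ℤ) = x + (L * m : ℕ) + L := by push_cast; ring
    rw [e, hF]
    push_cast; ring

/-- The average over a common period of a product of functions periodic modulo distinct primes. -/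
theorem sum_Ico_prod_eq {Q : Finset ℕ} (hQ : ∀ q ∈ Q, q.Prime) (f : (q : ℕ) → ZMod q → ℝ)
    {L : ℕ} (hL : ∏ q ∈ Q, q ∣ L) (x : ℤ) {A : ℕ → ℝ}
    (hA : ∀ q ∈ Q, ∑ j ∈ Finset.range q, f q (j : ZMod q) = q * A q) :
    ∑ j ∈ Finset.Ico x (x + L), ∏ q ∈ Q, f q (j : ZMod q) = L * ∏ q ∈ Q, A q := by
  obtain ⟨m, rfl⟩ := hL
  have : ∀ q : Q, NeZero (q : ℕ) := fun q => ⟨(hQ q q.2).ne_zero⟩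
  have hprod : ∏ q : Q, (q : ℕ) = ∏ q ∈ Q, q := Finset.prod_coe_sort Q fun q => q
  have : NeZero (∏ q : Q, (q : ℕ)) :=
    ⟨Finset.prod_ne_zero_iff.2 fun q _ => (hQ q q.2).ne_zero⟩
  rw [sum_Ico_mul_periodic _ ((∏ q ∈ Q, (q : ℝ)) * ∏ q ∈ Q, A q)]
  · push_cast; ring
  intro x
  rw [← hprod, ← Finset.prod_mul_distrib]
  have e1 : ∀ j : ℤ, ∏ q ∈ Q, f q (j : ZMod q) =
      ∏ q : Q, f q (((j : ZMod (∏ q : Q, (q : ℕ))).cast : ZMod q)) := by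
    intro j
    rw [← Finset.prod_coe_sort Q fun q => f q (j : ZMod q)]
    refine Finset.prod_congr rfl fun q _ => ?_
    rw [ZMod.cast_intCast (Finset.dvd_prod_of_mem _ (Finset.mem_univ q))]
  simp_rw [e1]
  rw [sum_Ico_eq_sum_zmod (fun y : ZMod (∏ q : Q, (q : ℕ)) => ∏ q : Q, f q (y.cast : ZMod q)),
    sum_zmod_prod_eq Q hQ, ← Finset.prod_coe_sort Q fun q => (q : ℝ) * A q]
  refine Finset.prod_congr rfl fun q _ => ?_
  rw [← hA q q.2, ← sum_Ico_eq_sum_zmod (f q) 0]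
  symm
  refine Finset.sum_bij (fun j _ => (j : ℤ)) ?_ ?_ ?_ ?_
  · intro j hj; rw [Finset.mem_range] at hj; rw [Finset.mem_Ico]; omega
  · intro a _ b _ h; exact_mod_cast h
  · intro b hb
    rw [Finset.mem_Ico] at hb
    exact ⟨b.toNat, Finset.mem_range.2 (by omega), by omega⟩
  · intro j _; simp

/-- The integers `a` with `|a| ≤ n` coprime to `n`. -/
def unitsUpTo (n : ℕ) : Finset ℤ := (Finset.Icc (-(n : ℤ)) n).filter fun a => Int.gcd a n = 1

theorem mem_unitsUpTo {n : ℕ} {a : ℤ} : a ∈ unitsUpTo n ↔ |a| ≤ n ∧ Int.gcd a n = 1 := by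
  unfold unitsUpTo
  rw [Finset.mem_filter, Finset.mem_Icc, abs_le]

theorem intCast_ne_zero_of_mem_unitsUpTo {n q : ℕ} {a : ℤ} (ha : a ∈ unitsUpTo n) (hq : q.Prime)
    (hqn : q ∣ n) : (a : ZMod q) ≠ 0 := by
  rw [Ne, ZMod.intCast_zmod_eq_zero_iff_dvd]
  intro h
  have := Int.dvd_gcd h (Int.natCast_dvd_natCast.2 hqn)
  rw [(mem_unitsUpTo.1 ha).2] at this
  exact hq.one_lt.ne' (by simpa using this)

/-- The local factor at the prime `q` of the number of coprime solutions of `a w - b v = y`. -/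
def localFactor (g s q : ℕ) (y : ZMod q) : ℝ :=
  if q ∣ s then (if y = 0 then 0 else 1) * (if q ∣ g then 1 - 1 / (q : ℝ) else 1)
  else 1 - 2 / q + (if y = 0 then 1 / (q : ℝ) else 0)

/-- The average of `localFactor`. -/
def localMean (g s q : ℕ) : ℝ :=
  if q ∣ s then (1 - 1 / (q : ℝ)) * (if q ∣ g then 1 - 1 / (q : ℝ) else 1)
  else (1 - 1 / (q : ℝ)) ^ 2

theorem sum_range_eq_sum_zmod {q : ℕ} [NeZero q] (F : ZMod q → ℝ) :
    ∑ j ∈ Finset.range q, F (j : ZMod q) = ∑ y : ZMod q, F y := by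
  rw [← sum_Ico_eq_sum_zmod F 0]
  refine Finset.sum_bij (fun j _ => (j : ℤ)) ?_ ?_ ?_ ?_
  · intro j hj; rw [Finset.mem_range] at hj; rw [Finset.mem_Ico]; omega
  · intro a _ b _ h; exact_mod_cast h
  · intro b hb
    rw [Finset.mem_Ico] at hb
    exact ⟨b.toNat, Finset.mem_range.2 (by omega), by omega⟩
  · intro j _; simp

theorem localFactor_nonneg {g s q : ℕ} (hq : q.Prime) (y : ZMod q) : 0 ≤ localFactor g s q y := by
  have h1 := (one_sub_inv_prime_pos hq).le
  have h2 : (2 : ℝ) / q ≤ 1 := by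
    rw [div_le_one (by exact_mod_cast hq.pos)]; exact_mod_cast hq.two_le
  have h3 : (0 : ℝ) ≤ 1 / q := by positivity
  unfold localFactor
  split_ifs <;> positivity

theorem sum_localFactor {g s q : ℕ} (hq : q.Prime) :
    ∑ j ∈ Finset.range q, localFactor g s q (j : ZMod q) = q * localMean g s q := by
  have : NeZero q := ⟨hq.ne_zero⟩
  have hq0 : (q : ℝ) ≠ 0 := by exact_mod_cast hq.ne_zero
  rw [sum_range_eq_sum_zmod]
  have e0 : ∑ y : ZMod q, (if y = 0 then 1 / (q : ℝ) else 0) = 1 / q := by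
    rw [Finset.sum_ite_eq']; simp
  have e1 : ∑ y : ZMod q, (if y = 0 then (0 : ℝ) else 1) = q - 1 := by
    have : ∀ y : ZMod q, (if y = 0 then (0 : ℝ) else 1) = 1 - if y = 0 then 1 else 0 := by
      intro y; split_ifs <;> simp
    simp_rw [this]
    rw [Finset.sum_sub_distrib, Finset.sum_ite_eq']
    simp [ZMod.card]
  unfold localFactor localMean
  by_cases h : q ∣ s
  · simp only [h, if_true]
    rw [← Finset.sum_mul, e1]
    field_simp
  · simp only [h, if_false]
    rw [Finset.sum_add_distrib, e0, Finset.sum_const, Finset.card_univ, ZMod.card, nsmul_eq_mul]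
    field_simp
    ring

theorem sum_avoid_one_le {q : ℕ} [NeZero q] {B : ZMod q → Prop} [DecidablePred B] {y₁ : ZMod q}
    (h₁ : B y₁) : ∑ y : ZMod q, (if B y then (0 : ℝ) else 1) ≤ q - 1 := by
  have : ∀ y : ZMod q, (if B y then (0 : ℝ) else 1) ≤ 1 - if y = y₁ then 1 else 0 := by
    intro y
    by_cases h : y = y₁
    · subst h; simp [h₁]
    · rw [if_neg h]; split_ifs <;> norm_num
  refine (Finset.sum_le_sum fun y _ => this y).trans ?_
  rw [Finset.sum_sub_distrib, Finset.sum_ite_eq']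
  simp [ZMod.card]

theorem sum_avoid_two_le {q : ℕ} [NeZero q] {B : ZMod q → Prop} [DecidablePred B] {y₁ y₂ : ZMod q}
    (h₁ : B y₁) (h₂ : B y₂) (hne : y₁ ≠ y₂) :
    ∑ y : ZMod q, (if B y then (0 : ℝ) else 1) ≤ q - 2 := by
  have : ∀ y : ZMod q, (if B y then (0 : ℝ) else 1) ≤
      1 - (if y = y₁ then 1 else 0) - if y = y₂ then 1 else 0 := by
    intro y
    by_cases h : y = y₁
    · subst h; simp [h₁, hne]
    · by_cases h' : y = y₂
      · subst h'; simp [h₂, h]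
      · rw [if_neg h, if_neg h']; split_ifs <;> norm_num
  refine (Finset.sum_le_sum fun y _ => this y).trans ?_
  rw [Finset.sum_sub_distrib, Finset.sum_sub_distrib, Finset.sum_ite_eq', Finset.sum_ite_eq']
  simp [ZMod.card]
  linarith

theorem avoid_mean_le {q v w : ℕ} (hq : q.Prime) (hvw : v.Coprime w) {g : ℕ} (hg : q ∣ g)
    (a b : ZMod q) (ha : q ∣ v → a ≠ 0) (hb : q ∣ w → b ≠ 0) :
    (∑ j ∈ Finset.range q, if a + v * (j : ZMod q) = 0 ∨ b + w * (j : ZMod q) = 0 then (0 : ℝ)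
      else 1) / q ≤ localFactor g (v * w) q (a * w - b * v) := by
  have : NeZero q := ⟨hq.ne_zero⟩
  have : Fact q.Prime := ⟨hq⟩
  have hq0 : (0 : ℝ) < q := by exact_mod_cast hq.pos
  rw [sum_range_eq_sum_zmod fun y : ZMod q => if a + v * y = 0 ∨ b + w * y = 0 then (0 : ℝ) else 1]
  have hz : ∀ n : ℕ, (n : ZMod q) = 0 ↔ q ∣ n := fun n => ZMod.natCast_eq_zero_iff n q
  have hbad : ∀ (c : ZMod q) (n : ℕ), ¬ q ∣ n → c + n * (-c / n) = 0 := by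
    intro c n hn
    have : (n : ZMod q) ≠ 0 := fun h => hn ((hz n).1 h)
    field_simp
    ring
  by_cases hs : q ∣ v * w
  · have hone : ∃ y₁ : ZMod q, a + v * y₁ = 0 ∨ b + w * y₁ = 0 := by
      by_cases h : q ∣ v
      · have hw : ¬ q ∣ w := fun h' => Nat.not_coprime_of_dvd_of_dvd hq.one_lt h h' hvw
        exact ⟨_, Or.inr (hbad b w hw)⟩
      · exact ⟨_, Or.inl (hbad a v h)⟩
    obtain ⟨y₁, hy₁⟩ := hone
    have h := sum_avoid_one_le (B := fun y : ZMod q => a + v * y = 0 ∨ b + w * y = 0) hy₁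
    have hne : a * w - b * v ≠ 0 := by
      rcases (Nat.Prime.dvd_mul hq).1 hs with h | h
      · have hw : ¬ q ∣ w := fun h' => Nat.not_coprime_of_dvd_of_dvd hq.one_lt h h' hvw
        rw [(hz v).2 h, mul_zero, sub_zero]
        exact mul_ne_zero (ha h) fun h => hw ((hz w).1 h)
      · have hv : ¬ q ∣ v := fun h' => Nat.not_coprime_of_dvd_of_dvd hq.one_lt h' h hvw
        rw [(hz w).2 h, mul_zero, zero_sub, neg_ne_zero]
        exact mul_ne_zero (hb h) fun h => hv ((hz v).1 h)
    unfold localFactor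
    rw [if_pos hs, if_neg hne, if_pos hg, div_le_iff₀ hq0]
    refine h.trans (le_of_eq ?_)
    field_simp
  · have hv : ¬ q ∣ v := fun h => hs (h.mul_right w)
    have hw : ¬ q ∣ w := fun h => hs (h.mul_left v)
    unfold localFactor
    rw [if_neg hs, div_le_iff₀ hq0]
    split_ifs with h0
    · refine (sum_avoid_one_le (B := fun y : ZMod q => a + v * y = 0 ∨ b + w * y = 0)
        (Or.inl (hbad a v hv))).trans (le_of_eq ?_)
      field_simp; ring
    · refine (sum_avoid_two_le (B := fun y : ZMod q => a + v * y = 0 ∨ b + w * y = 0)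
        (Or.inl (hbad a v hv)) (Or.inr (hbad b w hw)) ?_).trans (le_of_eq ?_)
      · intro h
        have h1 : (v : ZMod q) ≠ 0 := fun h => hv ((hz v).1 h)
        have h2 : (w : ZMod q) ≠ 0 := fun h => hw ((hz w).1 h)
        rw [div_eq_div_iff h1 h2] at h
        exact h0 (by linear_combination -h)
      · field_simp; ring

/-- The number of coprime solutions of a linear equation is controlled by the local factors. -/
theorem card_linear_solutions_le {g v w : ℕ} (hg : 0 < g) (hv : 0 < v) (hw : 0 < w)
    (hvw : v.Coprime w) (u : ℤ) :
    (((unitsUpTo (g * v) ×ˢ unitsUpTo (g * w)).filter fun x => x.1 * w - x.2 * v = u).card : ℝ) ≤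
      5 * g * ∏ q ∈ (g * (v * w)).primeFactors, localFactor g (v * w) q (u : ZMod q) := by
  set S := (unitsUpTo (g * v) ×ˢ unitsUpTo (g * w)).filter fun x => x.1 * w - x.2 * v = u with hS
  have hpr : ∀ q ∈ (g * (v * w)).primeFactors, q.Prime := fun q hq =>
      Nat.prime_of_mem_primeFactors hq
  rcases S.eq_empty_or_nonempty with h0 | ⟨⟨a, b⟩, hab⟩
  · rw [h0]
    have := Finset.prod_nonneg fun q hq => localFactor_nonneg (g := g) (s := v * w)
        (hpr q hq) (u : ZMod q)
    simp only [Finset.card_empty, Nat.cast_zero]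
    positivity
  have hmem : ∀ x, x ∈ S ↔ (x.1 ∈ unitsUpTo (g * v) ∧ x.2 ∈ unitsUpTo (g * w)) ∧
      x.1 * w - x.2 * v = u := fun x => by rw [hS, Finset.mem_filter, Finset.mem_product]
  obtain ⟨⟨ha, hb⟩, hu⟩ := (hmem _).1 hab
  simp only at ha hb hu
  set f : (q : ℕ) → ZMod q → ℝ := fun q y =>
    if (a : ZMod q) + v * y = 0 ∨ (b : ZMod q) + w * y = 0 then 0 else 1 with hf
  have hf0 : ∀ q y, 0 ≤ f q y := fun q y => by simp only [hf]; split_ifs <;> norm_num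
  set good : ℤ → Prop := fun j => a + v * j ∈ unitsUpTo (g * v) ∧ b + w * j ∈ unitsUpTo (g * w)
    with hgood
  have hcard : S.card ≤ ((Finset.Ico (-(2 * g : ℤ)) (-(2 * g : ℤ) + (5 * g : ℕ))).filter
      fun j : ℤ => a + v * j ∈ unitsUpTo (g * v) ∧ b + w * j ∈ unitsUpTo (g * w)).card := by
    refine le_trans (Finset.card_le_card fun x hx => ?_)
      (Finset.card_image_le (f := fun j : ℤ => (a + v * j, b + w * j)))
    obtain ⟨⟨hx1, hx2⟩, hxu⟩ := (hmem _).1 hx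
    have hd : (v : ℤ) ∣ x.1 - a := by
      have h1 : (v : ℤ) ∣ (x.1 - a) * w := ⟨x.2 - b, by linear_combination hxu - hu⟩
      exact (Int.isCoprime_iff_gcd_eq_one.2 (by simpa using hvw)).dvd_of_dvd_mul_right h1
    obtain ⟨j, hj⟩ := hd
    have hv' : (0 : ℤ) < v := by exact_mod_cast hv
    have e1 : x.1 = a + v * j := by linarith
    have e2 : x.2 = b + w * j := by
      have : (x.2 - b) * v = (w * j) * v := by
        linear_combination hu - hxu + (w : ℤ) * hj
      have := mul_right_cancel₀ hv'.ne' this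
      linarith
    have hx1' := (mem_unitsUpTo.1 hx1).1
    have ha' := (mem_unitsUpTo.1 ha).1
    rw [abs_le] at hx1' ha'
    push_cast at hx1' ha'
    have hj1 : -(2 * g : ℤ) ≤ j := by nlinarith
    have hj2 : j ≤ 2 * g := by nlinarith
    refine Finset.mem_image.2 ⟨j, Finset.mem_filter.2 ⟨Finset.mem_Ico.2 ⟨hj1, ?_⟩, ?_, ?_⟩, ?_⟩
    · push_cast; omega
    · rwa [← e1]
    · rwa [← e2]
    · rw [← e1, ← e2]
  have hcard2 : (((Finset.Ico (-(2 * g : ℤ)) (-(2 * g : ℤ) + (5 * g : ℕ))).filter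
      fun j : ℤ => a + v * j ∈ unitsUpTo (g * v) ∧ b + w * j ∈ unitsUpTo (g * w)).card : ℝ) ≤
      ∑ j ∈ Finset.Ico (-(2 * g : ℤ)) (-(2 * g : ℤ) + (5 * g : ℕ)),
        ∏ q ∈ g.primeFactors, f q (j : ZMod q) := by
    rw [Finset.card_filter, Nat.cast_sum]
    refine Finset.sum_le_sum fun j _ => ?_
    split_ifs with h
    · rw [Finset.prod_eq_one]
      · simp
      intro q hq
      have hqp := Nat.prime_of_mem_primeFactors hq
      have hqg := Nat.dvd_of_mem_primeFactors hq
      have h1 := intCast_ne_zero_of_mem_unitsUpTo h.1 hqp (hqg.mul_right v)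
      have h2 := intCast_ne_zero_of_mem_unitsUpTo h.2 hqp (hqg.mul_right w)
      push_cast at h1 h2
      simp only [hf]
      rw [if_neg (not_or.2 ⟨h1, h2⟩)]
    · exact_mod_cast Finset.prod_nonneg fun q _ => hf0 q _
  have hsum := sum_Ico_prod_eq (Q := g.primeFactors) (fun q hq =>
      Nat.prime_of_mem_primeFactors hq) f
    (L := 5 * g) ((Nat.prod_primeFactors_dvd g).mul_left 5) (-(2 * g : ℤ))
    (A := fun q => (∑ j ∈ Finset.range q, f q (j : ZMod q)) / q) (fun q hq => by
      have : (q : ℝ) ≠ 0 := by exact_mod_cast (Nat.prime_of_mem_primeFactors hq).ne_zero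
      field_simp)
  rw [hsum] at hcard2
  refine le_trans (by exact_mod_cast hcard) (hcard2.trans ?_)
  push_cast
  refine mul_le_mul_of_nonneg_left ?_ (by positivity)
  have hsub : g.primeFactors ⊆ (g * (v * w)).primeFactors :=
    Nat.primeFactors_mono (dvd_mul_right _ _) (by positivity)
  have hav : ∀ q, q.Prime → q ∣ v → (a : ZMod q) ≠ 0 := fun q hq h =>
    intCast_ne_zero_of_mem_unitsUpTo ha hq (h.mul_left g)
  have hbw : ∀ q, q.Prime → q ∣ w → (b : ZMod q) ≠ 0 := fun q hq h =>
    intCast_ne_zero_of_mem_unitsUpTo hb hq (h.mul_left g)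
  have hucast : ∀ q : ℕ, (u : ZMod q) = a * w - b * v := fun q => by rw [← hu]; push_cast; ring
  have hle : ∏ q ∈ g.primeFactors, (∑ j ∈ Finset.range q, f q (j : ZMod q)) / (q : ℝ) ≤
      ∏ q ∈ g.primeFactors, localFactor g (v * w) q (u : ZMod q) := by
    refine Finset.prod_le_prod (fun q _ => div_nonneg (Finset.sum_nonneg fun j _ => hf0 q _)
      (Nat.cast_nonneg q)) fun q hq => ?_
    have hqp := Nat.prime_of_mem_primeFactors hq
    rw [hucast]
    exact avoid_mean_le hqp hvw (Nat.dvd_of_mem_primeFactors hq) a b (hav q hqp) (hbw q hqp)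
  refine hle.trans (le_of_eq (Finset.prod_subset hsub fun q hq hq' => ?_))
  have hqp := hpr q hq
  have hqg : ¬ q ∣ g := fun h => hq' (Nat.mem_primeFactors.2 ⟨hqp, h, hg.ne'⟩)
  have hqs : q ∣ v * w :=
      ((Nat.Prime.dvd_mul hqp).1 (Nat.dvd_of_mem_primeFactors hq)).resolve_left hqg
  have : Fact q.Prime := ⟨hqp⟩
  have hz : ∀ n : ℕ, (n : ZMod q) = 0 ↔ q ∣ n := fun n => ZMod.natCast_eq_zero_iff n q
  have hne : (u : ZMod q) ≠ 0 := by
    rw [hucast]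
    rcases (Nat.Prime.dvd_mul hqp).1 hqs with h | h
    · have hw : ¬ q ∣ w := fun h' => Nat.not_coprime_of_dvd_of_dvd hqp.one_lt h h' hvw
      rw [(hz v).2 h, mul_zero, sub_zero]
      exact mul_ne_zero (hav q hqp h) fun h => hw ((hz w).1 h)
    · have hv : ¬ q ∣ v := fun h' => Nat.not_coprime_of_dvd_of_dvd hqp.one_lt h' h hvw
      rw [(hz w).2 h, mul_zero, zero_sub, neg_ne_zero]
      exact mul_ne_zero (hbw q hqp h) fun h => hv ((hz v).1 h)
  unfold localFactor
  rw [if_pos hqs, if_neg hne, if_neg hqg, mul_one]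

theorem localMean_nonneg {g s q : ℕ} (hq : q.Prime) : 0 ≤ localMean g s q := by
  have h1 := (one_sub_inv_prime_pos hq).le
  unfold localMean
  split_ifs <;> positivity

theorem one_le_inv_one_sub {q : ℕ} (hq : q.Prime) : 1 ≤ (1 - 1 / (q : ℝ))⁻¹ := by
  have h1 := one_sub_inv_prime_pos hq
  refine (one_le_inv₀ h1).2 ?_
  have : (0 : ℝ) ≤ 1 / q := by positivity
  linarith

theorem localFactor_le {g s q : ℕ} (hq : q.Prime) (y : ZMod q) :
    localFactor g s q y ≤ localMean g s q * (if q ∣ s then (1 - 1 / (q : ℝ))⁻¹ else 1) *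
      (if y = 0 then (1 - 1 / (q : ℝ))⁻¹ else 1) := by
  have h1 := one_sub_inv_prime_pos hq
  have h2 := one_le_inv_one_sub hq
  have h0 : (0 : ℝ) ≤ 1 / q := by positivity
  have e : (2 : ℝ) / q = 2 * (1 / q) := by ring
  unfold localFactor localMean
  rw [e]
  generalize 1 / (q : ℝ) = x at *
  have h3 : (1 - x) * (1 - x)⁻¹ = 1 := mul_inv_cancel₀ h1.ne'
  by_cases hs : q ∣ s
  · simp only [hs, if_true]
    set d : ℝ := if q ∣ g then 1 - x else 1 with hd
    have hd0 : 0 ≤ d := by rw [hd]; split_ifs <;> linarith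
    have e2 : (1 - x) * d * (1 - x)⁻¹ = d := by rw [mul_right_comm, h3, one_mul]
    rw [e2]
    split_ifs
    · nlinarith
    · linarith
  · simp only [hs, if_false, mul_one]
    split_ifs
    · have e2 : (1 - x) ^ 2 * (1 - x)⁻¹ = 1 - x := by rw [sq, mul_assoc, h3, mul_one]
      rw [e2]; linarith
    · nlinarith

theorem prod_large_prime_divisors_le {S : Finset ℕ} (hS : ∀ q ∈ S, q.Prime) {z M : ℕ}
    (hM : M < 4 ^ (z + 1)) {c : ℤ} (hc0 : c ≠ 0) (hcM : |c| ≤ M) :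
    ∏ q ∈ S.filter (z < ·), (if (c : ZMod q) = 0 then (1 - 1 / (q : ℝ))⁻¹ else 1) ≤
      Real.exp 4 := by
  rw [← Finset.prod_filter]
  set Q := (S.filter (z < ·)).filter fun q => (c : ZMod q) = 0 with hQ
  have hmem : ∀ q ∈ Q, q.Prime ∧ z < q ∧ q ∣ c.natAbs := by
    intro q hq
    rw [hQ, Finset.mem_filter, Finset.mem_filter] at hq
    exact ⟨hS q hq.1.1, hq.1.2, Int.natCast_dvd.1 ((ZMod.intCast_zmod_eq_zero_iff_dvd c q).1 hq.2)⟩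
  have hcard : Q.card ≤ 2 * (z + 1) := by
    have h1 : ∏ q ∈ Q, q ∣ c.natAbs := Finset.prod_primes_dvd _
      (fun q hq => (hmem q hq).1.prime) fun q hq => (hmem q hq).2.2
    have h2 : 2 ^ Q.card ≤ ∏ q ∈ Q, q := Finset.pow_card_le_prod _ _ _ fun q hq => (hmem q hq).1.two_le
    have h3 := Nat.le_of_dvd (Int.natAbs_pos.2 hc0) h1
    have h4 : c.natAbs ≤ M := by rw [Int.abs_eq_natAbs] at hcM; exact_mod_cast hcM
    have h5 : 2 ^ Q.card < 2 ^ (2 * (z + 1)) := by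
      rw [pow_mul]; norm_num; omega
    exact ((Nat.pow_lt_pow_iff_right (by norm_num)).1 h5).le
  have hz : (0 : ℝ) < z + 1 := by positivity
  have hterm : ∀ q ∈ Q, (1 - 1 / (q : ℝ))⁻¹ ≤ Real.exp (2 / (z + 1)) := by
    intro q hq
    have h2 : (2 : ℝ) ≤ q := by exact_mod_cast (hmem q hq).1.two_le
    have h3 : (z : ℝ) + 1 ≤ q := by exact_mod_cast (hmem q hq).2.1
    refine le_trans ?_ (Real.add_one_le_exp _)
    have e : (1 - 1 / (q : ℝ))⁻¹ = 1 / (q - 1) + 1 := by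
      have : (q : ℝ) - 1 ≠ 0 := by linarith
      have : (q : ℝ) ≠ 0 := by linarith
      field_simp
      ring
    rw [e]
    gcongr ?_ + 1
    rw [div_le_div_iff₀ (by linarith) hz]
    linarith
  refine (Finset.prod_le_prod (fun q hq => ?_) hterm).trans ?_
  · exact zero_le_one.trans (one_le_inv_one_sub (hmem q hq).1)
  · rw [Finset.prod_const, ← Real.exp_nat_mul]
    refine Real.exp_le_exp.2 ?_
    have : (Q.card : ℝ) ≤ 2 * (z + 1) := by exact_mod_cast hcard
    rw [mul_div_assoc', div_le_iff₀ hz]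
    linarith

theorem sum_localFactor_le {S : Finset ℕ} (hS : ∀ q ∈ S, q.Prime) (g s : ℕ) {M : ℕ} (hM : 0 < M) :
    ∑ c ∈ (Finset.Icc (-(M : ℤ)) M).erase 0, ∏ q ∈ S, localFactor g s q (c : ZMod q) ≤
      4 * M * Real.exp 4 * ((∏ q ∈ S, localMean g s q) *
        ∏ q ∈ S.filter (fun q => q ∣ s ∧ Nat.log 4 M < q), (1 - 1 / (q : ℝ))⁻¹) := by
  set z := Nat.log 4 M with hz
  have hMz : M < 4 ^ (z + 1) := Nat.lt_pow_succ_log_self (by norm_num) M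
  have hzM : 4 ^ z ≤ M := Nat.pow_log_le_self 4 hM.ne'
  set A := S.filter (z < ·) with hA
  set B := S.filter (¬ z < ·) with hB
  have hAp : ∀ q ∈ A, q.Prime := fun q hq => hS q (Finset.mem_of_mem_filter q hq)
  have hBp : ∀ q ∈ B, q.Prime := fun q hq => hS q (Finset.mem_of_mem_filter q hq)
  have hsplit : ∀ F : ℕ → ℝ, ∏ q ∈ S, F q = (∏ q ∈ A, F q) * ∏ q ∈ B, F q := fun F =>
    (Finset.prod_filter_mul_prod_filter_not S (z < ·) F).symm
  set G := ∏ q ∈ A, (localMean g s q * (if q ∣ s then (1 - 1 / (q : ℝ))⁻¹ else 1)) with hG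
  have hif : ∀ q, q.Prime → (0 : ℝ) ≤ if q ∣ s then (1 - 1 / (q : ℝ))⁻¹ else 1 := fun q hq => by
    have := one_le_inv_one_sub hq
    split_ifs <;> linarith
  have hG0 : 0 ≤ G := Finset.prod_nonneg fun q hq =>
    mul_nonneg (localMean_nonneg (hAp q hq)) (hif q (hAp q hq))
  have h1 : ∀ c ∈ (Finset.Icc (-(M : ℤ)) M).erase 0, ∏ q ∈ S, localFactor g s q (c : ZMod q) ≤
      G * Real.exp 4 * ∏ q ∈ B, localFactor g s q (c : ZMod q) := by
    intro c hc
    rw [Finset.mem_erase, Finset.mem_Icc] at hc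
    rw [hsplit]
    refine mul_le_mul_of_nonneg_right ?_ (Finset.prod_nonneg fun q hq => localFactor_nonneg (hBp q hq) _)
    refine (Finset.prod_le_prod (fun q hq => localFactor_nonneg (hAp q hq) _) fun q hq =>
      localFactor_le (hAp q hq) _).trans ?_
    rw [Finset.prod_mul_distrib]
    exact mul_le_mul_of_nonneg_left (prod_large_prime_divisors_le hS hMz hc.1 (abs_le.2 hc.2)) hG0
  refine (Finset.sum_le_sum h1).trans ?_
  rw [← Finset.mul_sum]
  set L := ∏ q ∈ B, q with hL
  have hLpos : 0 < L := Finset.prod_pos fun q hq => (hBp q hq).pos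
  have hLM : L ≤ M := by
    refine le_trans ?_ ((primorial_le_four_pow z).trans hzM)
    unfold primorial
    refine Finset.prod_le_prod_of_subset_of_one_le' ?_ fun q hq _ => ?_
    · intro q hq
      have h2 := (Finset.mem_filter.1 hq).2
      exact Finset.mem_filter.2 ⟨Finset.mem_range.2 (by omega), hBp q hq⟩
    · exact (Finset.mem_filter.1 hq).2.one_lt.le
  set L' := L * (3 * M / L + 1) with hL'
  have hL'1 : 3 * M < L' := by
    rw [hL', mul_add, mul_one]
    exact (Nat.div_add_mod (3 * M) L).symm.le.trans_lt
      (Nat.add_lt_add_left (Nat.mod_lt _ hLpos) _)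
  have hL'2 : L' ≤ 4 * M := by
    rw [hL', mul_add, mul_one]
    have := Nat.mul_div_le (3 * M) L
    omega
  have h2 : ∑ c ∈ (Finset.Icc (-(M : ℤ)) M).erase 0, ∏ q ∈ B, localFactor g s q (c : ZMod q) ≤
      4 * M * ∏ q ∈ B, localMean g s q := by
    refine (Finset.sum_le_sum_of_subset_of_nonneg (t := Finset.Ico (-(M : ℤ)) (-(M : ℤ) + L')) ?_
      fun c _ _ => Finset.prod_nonneg fun q hq => localFactor_nonneg (hBp q hq) _).trans ?_
    · intro c hc
      rw [Finset.mem_erase, Finset.mem_Icc] at hc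
      rw [Finset.mem_Ico]
      omega
    · rw [sum_Ico_prod_eq hBp (localFactor g s) (dvd_mul_right L _) _
        fun q hq => sum_localFactor (hBp q hq)]
      refine mul_le_mul_of_nonneg_right (by exact_mod_cast hL'2)
        (Finset.prod_nonneg fun q hq => localMean_nonneg (hBp q hq))
  refine (mul_le_mul_of_nonneg_left h2 (mul_nonneg hG0 (Real.exp_pos _).le)).trans (le_of_eq ?_)
  rw [hsplit, hG, Finset.prod_mul_distrib, ← Finset.prod_filter]
  have e : A.filter (fun q => q ∣ s) = S.filter fun q => q ∣ s ∧ z < q := by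
    rw [hA, Finset.filter_filter]
    exact Finset.filter_congr fun q _ => and_comm
  rw [e]
  ring

theorem prod_localMean {g v w : ℕ} (hg : 0 < g) (hv : 0 < v) (hw : 0 < w) (hvw : v.Coprime w) :
    ∏ q ∈ (g * (v * w)).primeFactors, localMean g (v * w) q =
      ((g * v).totient : ℝ) / (g * v : ℕ) * (((g * w).totient : ℝ) / (g * w : ℕ)) := by
  have hphi : ∀ n : ℕ, 0 < n → n ∣ g * (v * w) → (n.totient : ℝ) / n =
      ∏ q ∈ (g * (v * w)).primeFactors, if q ∣ n then 1 - 1 / (q : ℝ) else 1 := by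
    intro n hn hd
    rw [← Finset.prod_filter]
    have e : (g * (v * w)).primeFactors.filter (· ∣ n) = n.primeFactors := by
      ext q
      rw [Finset.mem_filter, Nat.mem_primeFactors, Nat.mem_primeFactors]
      constructor
      · rintro ⟨⟨h1, _, _⟩, h2⟩; exact ⟨h1, h2, hn.ne'⟩
      · rintro ⟨h1, h2, _⟩; exact ⟨⟨h1, h2.trans hd, by positivity⟩, h2⟩
    rw [e]
    have h := Nat.totient_eq_mul_prod_factors n
    have h' := congrArg (fun x : ℚ => (x : ℝ)) h
    push_cast at h'
    have hn0 : (n : ℝ) ≠ 0 := by exact_mod_cast hn.ne'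
    rw [h', mul_div_cancel_left₀ _ hn0]
    simp [one_div]
  rw [hphi (g * v) (by positivity) ⟨w, by ring⟩, hphi (g * w) (by positivity) ⟨v, by ring⟩,
    ← Finset.prod_mul_distrib]
  refine Finset.prod_congr rfl fun q hq => ?_
  have hqp := Nat.prime_of_mem_primeFactors hq
  have hq' := Nat.dvd_of_mem_primeFactors hq
  unfold localMean
  by_cases hqg : q ∣ g
  · rw [if_pos (hqg.mul_right v), if_pos (hqg.mul_right w), if_pos hqg]
    split_ifs <;> ring
  · have hs := ((Nat.Prime.dvd_mul hqp).1 hq').resolve_left hqg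
    rw [if_pos hs, if_neg hqg, mul_one]
    simp only [Nat.Prime.dvd_mul hqp, hqg, false_or]
    rcases (Nat.Prime.dvd_mul hqp).1 hs with h | h
    · have hw : ¬ q ∣ w := fun h' => Nat.not_coprime_of_dvd_of_dvd hqp.one_lt h h' hvw
      rw [if_pos h, if_neg hw, mul_one]
    · have hv : ¬ q ∣ v := fun h' => Nat.not_coprime_of_dvd_of_dvd hqp.one_lt h' h hvw
      rw [if_pos h, if_neg hv, one_mul]

theorem localFactor_congr {g s q : ℕ} {x y : ZMod q} (h : x = 0 ↔ y = 0) :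
    localFactor g s q x = localFactor g s q y := by
  unfold localFactor
  simp only [h]

theorem card_zero_solutions_le {g v w : ℕ} (hvw : v.Coprime w) :
    ((unitsUpTo (g * v) ×ˢ unitsUpTo (g * w)).filter fun x : ℤ × ℤ =>
      x.1 * (w : ℤ) - x.2 * (v : ℤ) = 0).card ≤
      if v = w then (unitsUpTo (g * v)).card else 0 := by
  have key : ∀ x ∈ (unitsUpTo (g * v) ×ˢ unitsUpTo (g * w)).filter fun x : ℤ × ℤ =>
      x.1 * (w : ℤ) - x.2 * (v : ℤ) = 0,
      v = 1 ∧ w = 1 := by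
    intro x hx
    rw [Finset.mem_filter, Finset.mem_product, mem_unitsUpTo, mem_unitsUpTo] at hx
    obtain ⟨⟨⟨_, h1⟩, ⟨_, h2⟩⟩, h3⟩ := hx
    have hco : IsCoprime (v : ℤ) w := Int.isCoprime_iff_gcd_eq_one.2 (by simpa using hvw)
    have d1 : (v : ℤ) ∣ x.1 := hco.dvd_of_dvd_mul_right ⟨x.2, by linarith⟩
    have d2 : (w : ℤ) ∣ x.2 := hco.symm.dvd_of_dvd_mul_right ⟨x.1, by linarith⟩
    constructor
    · have := Int.dvd_gcd d1 (Int.natCast_dvd_natCast.2 (dvd_mul_left v g))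
      rw [h1] at this
      simpa using this
    · have := Int.dvd_gcd d2 (Int.natCast_dvd_natCast.2 (dvd_mul_left w g))
      rw [h2] at this
      simpa using this
  split_ifs with h
  · subst h
    refine (Finset.card_le_card (t := (unitsUpTo (g * v)).image fun a => (a, a)) fun x hx => ?_).trans
      Finset.card_image_le
    have h1 := key x hx
    rw [Finset.mem_filter, Finset.mem_product] at hx
    rw [Finset.mem_image]
    refine ⟨x.1, hx.1.1, ?_⟩
    have h2 := hx.2
    rw [h1.1] at h2
    ext
    · rfl
    · push_cast at h2; simp only; linarith
  · rw [Nat.le_zero, Finset.card_eq_zero]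
    refine Finset.eq_empty_of_forall_notMem fun x hx => h ?_
    rw [(key x hx).1, (key x hx).2]

theorem card_overlap_le_aux {p k g v w : ℕ} (hp : p.Prime) (hg : 0 < g) (hv : 0 < v) (hw : 0 < w)
    (hvw : v.Coprime w) (hpn : ¬ p ∣ g * (v * w)) (M : ℕ) (hM : M = 2 * (g * (v * w)) / p ^ k) :
    (((unitsUpTo (g * v) ×ˢ unitsUpTo (g * w)).filter fun x =>
      (p ^ k : ℤ) ∣ x.1 * (g * w : ℕ) - x.2 * (g * v : ℕ)).card : ℝ) ≤
      (if v = w then ((unitsUpTo (g * v)).card : ℝ) else 0) + if M = 0 then 0 else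
        40 * Real.exp 4 * (((g * v).totient * (g * w).totient : ℝ) / p ^ k *
          ∏ q ∈ (g * (v * w)).primeFactors.filter (fun q => q ∣ v * w ∧ Nat.log 4 M < q),
            (1 - 1 / (q : ℝ))⁻¹) := by
  have hpg : ¬ p ∣ g := fun h => hpn (h.mul_right _)
  have hpk : (0 : ℝ) < (p : ℝ) ^ k := by have := hp.pos; positivity
  have hpkn : 0 < p ^ k := pow_pos hp.pos k
  have hco : IsCoprime ((p : ℤ) ^ k) g :=
    IsCoprime.pow_left (Nat.isCoprime_iff_coprime.2 ((Nat.Prime.coprime_iff_not_dvd hp).2 hpg))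
  set N : ℤ → ℕ := fun c =>
    ((unitsUpTo (g * v) ×ˢ unitsUpTo (g * w)).filter fun x => x.1 * w - x.2 * v = c * p ^ k).card
    with hN
  have hsub : ((unitsUpTo (g * v) ×ˢ unitsUpTo (g * w)).filter fun x =>
      (p ^ k : ℤ) ∣ x.1 * (g * w : ℕ) - x.2 * (g * v : ℕ)) ⊆
      (Finset.Icc (-(M : ℤ)) M).biUnion fun c =>
      (unitsUpTo (g * v) ×ˢ unitsUpTo (g * w)).filter fun x => x.1 * w - x.2 * v = c * p ^ k := by
    intro x hx
    rw [Finset.mem_filter, Finset.mem_product] at hx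
    obtain ⟨⟨h1, h2⟩, h3⟩ := hx
    have h4 : (p ^ k : ℤ) ∣ (x.1 * w - x.2 * v) * g := by
      refine h3.trans (dvd_of_eq ?_); push_cast; ring
    obtain ⟨c, hc⟩ := hco.dvd_of_dvd_mul_right h4
    rw [Finset.mem_biUnion]
    refine ⟨c, ?_, Finset.mem_filter.2 ⟨Finset.mem_product.2 ⟨h1, h2⟩, by rw [hc, mul_comm]⟩⟩
    have b1 := (mem_unitsUpTo.1 h1).1
    have b2 := (mem_unitsUpTo.1 h2).1
    have hcabs : |c| * p ^ k ≤ 2 * (g * (v * w)) := by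
      have e1 : |c| * p ^ k = |x.1 * w - x.2 * v| := by
        rw [hc, abs_mul, abs_of_pos (by exact_mod_cast hpkn : (0 : ℤ) < p ^ k), mul_comm]
      rw [e1]
      refine (abs_sub _ _).trans ?_
      rw [abs_mul, abs_mul, Nat.abs_cast, Nat.abs_cast]
      push_cast at b1 b2
      nlinarith
    have hcn : c.natAbs ≤ M := by
      rw [hM, Nat.le_div_iff_mul_le hpkn]
      rw [Int.abs_eq_natAbs] at hcabs
      exact_mod_cast hcabs
    rw [Finset.mem_Icc]
    omega
  have hcard := (Finset.card_le_card hsub).trans Finset.card_biUnion_le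
  have h0 : (0 : ℤ) ∈ Finset.Icc (-(M : ℤ)) M := by rw [Finset.mem_Icc]; omega
  rw [← Finset.add_sum_erase _ _ h0] at hcard
  have hz := card_zero_solutions_le (g := g) hvw
  have hfirst : N 0 ≤ if v = w then (unitsUpTo (g * v)).card else 0 := by
    simp only [hN, zero_mul]; exact hz
  have hrest : ((∑ c ∈ (Finset.Icc (-(M : ℤ)) M).erase 0, N c : ℕ) : ℝ) ≤ if M = 0 then 0 else
        40 * Real.exp 4 * (((g * v).totient * (g * w).totient : ℝ) / p ^ k *
          ∏ q ∈ (g * (v * w)).primeFactors.filter (fun q => q ∣ v * w ∧ Nat.log 4 M < q),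
            (1 - 1 / (q : ℝ))⁻¹) := by
    split_ifs with hM0
    · rw [hM0]; simp
    have hterm : ∀ c : ℤ, (N c : ℝ) ≤
        5 * g * ∏ q ∈ (g * (v * w)).primeFactors, localFactor g (v * w) q (c : ZMod q) := by
      intro c
      refine (card_linear_solutions_le hg hv hw hvw (c * p ^ k)).trans (le_of_eq ?_)
      congr 1
      refine Finset.prod_congr rfl fun q hq => localFactor_congr ?_
      have hqp := Nat.prime_of_mem_primeFactors hq
      have : Fact q.Prime := ⟨hqp⟩
      have hne : (p : ZMod q) ≠ 0 := by
        rw [Ne, ZMod.natCast_eq_zero_iff, Nat.prime_dvd_prime_iff_eq hqp hp]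
        rintro rfl
        exact hpn (Nat.dvd_of_mem_primeFactors hq)
      push_cast
      simp [hne]
    push_cast
    refine (Finset.sum_le_sum fun c _ => hterm c).trans ?_
    rw [← Finset.mul_sum]
    refine (mul_le_mul_of_nonneg_left (sum_localFactor_le
      (fun q hq => Nat.prime_of_mem_primeFactors hq) g (v * w) (Nat.pos_of_ne_zero hM0))
      (by positivity)).trans ?_
    rw [prod_localMean hg hv hw hvw]
    set X := ∏ q ∈ (g * (v * w)).primeFactors.filter (fun q => q ∣ v * w ∧ Nat.log 4 M < q),
            (1 - 1 / (q : ℝ))⁻¹ with hX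
    have hX0 : 0 ≤ X := Finset.prod_nonneg fun q hq => zero_le_one.trans
      (one_le_inv_one_sub (Nat.prime_of_mem_primeFactors (Finset.mem_of_mem_filter q hq)))
    have hMle : (M : ℝ) ≤ 2 * (g * (v * w)) / p ^ k := by
      rw [hM]
      refine Nat.cast_div_le.trans (le_of_eq ?_)
      push_cast; rfl
    have hg' : (0 : ℝ) < g := by exact_mod_cast hg
    have hv' : (0 : ℝ) < v := by exact_mod_cast hv
    have hw' : (0 : ℝ) < w := by exact_mod_cast hw
    set F := ((g * v).totient : ℝ) with hF
    set G := ((g * w).totient : ℝ) with hG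
    have hF0 : 0 ≤ F := Nat.cast_nonneg _
    have hG0 : 0 ≤ G := Nat.cast_nonneg _
    push_cast
    calc 5 * (g : ℝ) * (4 * M * Real.exp 4 * (F / (g * v) * (G / (g * w)) * X))
        = M * (20 * g * Real.exp 4 * (F / (g * v) * (G / (g * w)) * X)) := by ring
      _ ≤ 2 * (g * (v * w)) / p ^ k * (20 * g * Real.exp 4 * (F / (g * v) * (G / (g * w)) * X)) := by
          gcongr
      _ = _ := by field_simp; ring
  have : (((unitsUpTo (g * v) ×ˢ unitsUpTo (g * w)).filter fun x =>
      (p ^ k : ℤ) ∣ x.1 * (g * w : ℕ) - x.2 * (g * v : ℕ)).card : ℝ) ≤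
      (N 0 : ℝ) + ((∑ c ∈ (Finset.Icc (-(M : ℤ)) M).erase 0, N c : ℕ) : ℝ) := by
    exact_mod_cast hcard
  refine this.trans (add_le_add ?_ hrest)
  calc (N 0 : ℝ) ≤ ((if v = w then (unitsUpTo (g * v)).card else 0 : ℕ) : ℝ) := by
        exact_mod_cast hfirst
    _ = _ := by split_ifs <;> simp

/-- The number of coprime pairs `(a, b)` for which `a / v` and `b / w` are `p`-adically close. -/
theorem card_overlap_le {p k v w N : ℕ} (hp : p.Prime) (hv : 0 < v) (hw : 0 < w) (hvN : v ≤ N)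
    (hwN : w ≤ N) (hpv : ¬ p ∣ v) (hpw : ¬ p ∣ w) :
    (((unitsUpTo v ×ˢ unitsUpTo w).filter fun x => (p ^ k : ℤ) ∣ x.1 * w - x.2 * v).card : ℝ) ≤
      (if v = w then ((unitsUpTo v).card : ℝ) else 0) + if 2 * v.lcm w / p ^ k = 0 then 0 else
        40 * Real.exp 4 * ((v.totient * w.totient : ℝ) / p ^ k *
          ∏ q ∈ (N + 1).primesBelow.filter (fun q => v.factorization q ≠ w.factorization q ∧
            Nat.log 4 (2 * v.lcm w / p ^ k) < q), (1 - 1 / (q : ℝ))⁻¹) := by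
  obtain ⟨g, v', w', hg, hco, rfl, rfl⟩ : ∃ g v' w' : ℕ, 0 < g ∧ v'.Coprime w' ∧ v = g * v' ∧
      w = g * w' := by
    obtain ⟨g, v', w', hg, hco, h1, h2⟩ := Nat.exists_coprime' (Nat.gcd_pos_of_pos_left w hv)
    exact ⟨g, v', w', hg, hco, by rw [h1, mul_comm], by rw [h2, mul_comm]⟩
  have hv' : 0 < v' := Nat.pos_of_ne_zero fun h => by simp [h] at hv
  have hw' : 0 < w' := Nat.pos_of_ne_zero fun h => by simp [h] at hw
  have hlcm : (g * v').lcm (g * w') = g * (v' * w') := by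
    rw [Nat.lcm_mul_left, hco.lcm_eq_mul]
  have hpn : ¬ p ∣ g * (v' * w') := by
    rw [← mul_assoc]
    exact fun h => ((Nat.Prime.dvd_mul hp).1 h).elim hpv fun h => hpw (h.mul_left g)
  rw [hlcm]
  refine (card_overlap_le_aux hp hg hv' hw' hco hpn _ rfl).trans ?_
  refine add_le_add (le_of_eq ?_) ?_
  · simp only [Nat.mul_right_inj hg.ne']
  split_ifs with h
  · exact le_rfl
  refine mul_le_mul_of_nonneg_left (mul_le_mul_of_nonneg_left ?_ (by positivity)) (by positivity)
  refine Finset.prod_le_prod_of_subset_of_one_le (fun q hq => ?_) ?_ ?_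
  · rw [Finset.mem_filter] at hq ⊢
    obtain ⟨h1, h2, h3⟩ := hq
    have hqp := Nat.prime_of_mem_primeFactors h1
    have hfac : ∀ n : ℕ, 0 < n → (g * n).factorization q = g.factorization q + n.factorization q :=
      fun n hn => by rw [Nat.factorization_mul hg.ne' hn.ne']; rfl
    refine ⟨Nat.mem_primesBelow.2 ⟨Nat.lt_succ_of_le ?_, hqp⟩, ?_, h3⟩
    · rcases (Nat.Prime.dvd_mul hqp).1 h2 with h | h
      · exact (Nat.le_of_dvd hv (h.mul_left g)).trans hvN
      · exact (Nat.le_of_dvd hw (h.mul_left g)).trans hwN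
    · rw [hfac v' hv', hfac w' hw']
      rcases (Nat.Prime.dvd_mul hqp).1 h2 with h | h
      · have h' : ¬ q ∣ w' := fun h' => Nat.not_coprime_of_dvd_of_dvd hqp.one_lt h h' hco
        have := (hqp.dvd_iff_one_le_factorization hv'.ne').1 h
        rw [Nat.factorization_eq_zero_of_not_dvd h']
        omega
      · have h' : ¬ q ∣ v' := fun h' => Nat.not_coprime_of_dvd_of_dvd hqp.one_lt h' h hco
        have := (hqp.dvd_iff_one_le_factorization hw'.ne').1 h
        rw [Nat.factorization_eq_zero_of_not_dvd h']
        omega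
  · intro q hq
    have hqp := Nat.prime_of_mem_primeFactors (Finset.mem_of_mem_filter q hq)
    exact zero_le_one.trans (one_le_inv_one_sub hqp)
  · intro q hq _
    exact one_le_inv_one_sub (Nat.prime_of_mem_primesBelow (Finset.mem_of_mem_filter q hq))

theorem totient_eq_mul_phiPart {v N : ℕ} (hv : 0 < v) (hvN : v ≤ N) :
    (v.totient : ℝ) = v * phiPart (N + 1).primesBelow v := by
  have e : (N + 1).primesBelow.filter (· ∣ v) = v.primeFactors := by
    ext q
    rw [Finset.mem_filter, Nat.mem_primesBelow, Nat.mem_primeFactors]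
    constructor
    · rintro ⟨⟨_, h1⟩, h2⟩; exact ⟨h1, h2, hv.ne'⟩
    · rintro ⟨h1, h2, _⟩
      exact ⟨⟨by have := Nat.le_of_dvd hv h2; omega, h1⟩, h2⟩
  unfold phiPart dvdProd
  rw [e]
  have h' := congrArg (fun x : ℚ => (x : ℝ)) (Nat.totient_eq_mul_prod_factors v)
  push_cast at h'
  rw [h']
  simp [one_div]

theorem inv_one_sub_inv_prime_le {q : ℕ} (hq : q.Prime) :
    (1 - 1 / (q : ℝ))⁻¹ ≤ Real.exp (2 / q) := by
  have hq2 : (2 : ℝ) ≤ q := by exact_mod_cast hq.two_le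
  have h1 := one_sub_inv_prime_pos hq
  have h2 := Real.add_one_le_exp (2 / (q : ℝ))
  refine le_trans ?_ h2
  rw [inv_le_iff_one_le_mul₀ h1]
  have : (2 / (q : ℝ) + 1) * (1 - 1 / q) = 1 + (1 / q) * (1 - 2 / q) := by
    field_simp; ring
  rw [this]
  have h3 : (2 : ℝ) / q ≤ 1 := by rw [div_le_one (by linarith)]; exact hq2
  have : 0 ≤ (1 / (q : ℝ)) * (1 - 2 / q) := mul_nonneg (by positivity) (by linarith)
  linarith

theorem diffProd_momentWeight (P : Finset ℕ) (t v w : ℕ) :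
    diffProd P (momentWeight t) v w = Real.exp (4 * t *
      ∑ q ∈ P.filter fun q => v.factorization q ≠ w.factorization q ∧ t < q, 1 / (q : ℝ)) := by
  unfold diffProd momentWeight
  rw [Finset.mul_sum, Real.exp_sum, ← Finset.filter_filter, Finset.prod_filter (· > t) _]
  refine Finset.prod_congr (by ext; simp) fun q _ => ?_
  simp [div_eq_mul_inv]

/-- The Mertens product over large primes is bounded up to an exponential moment. -/
theorem prod_inv_one_sub_le_exp_add {P : Finset ℕ} (hP : ∀ q ∈ P, q.Prime) {t : ℕ} (ht : 1 ≤ t)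
    (v w : ℕ) :
    ∏ q ∈ P.filter (fun q => v.factorization q ≠ w.factorization q ∧ t < q), (1 - 1 / (q : ℝ))⁻¹ ≤
      Real.exp 4 + Real.exp (4 - 8 * t) * diffProd P (momentWeight t) v w := by
  rw [diffProd_momentWeight, ← Real.exp_add]
  set G := ∑ q ∈ P.filter fun q => v.factorization q ≠ w.factorization q ∧ t < q, 1 / (q : ℝ)
  have h1 : ∏ q ∈ P.filter (fun q => v.factorization q ≠ w.factorization q ∧ t < q),
      (1 - 1 / (q : ℝ))⁻¹ ≤ Real.exp (2 * G) := by
    rw [Finset.mul_sum, Real.exp_sum]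
    refine Finset.prod_le_prod (fun q hq => ?_) fun q hq => ?_
    · exact inv_nonneg.2 (one_sub_inv_prime_pos (hP q (Finset.mem_filter.1 hq).1)).le
    · rw [mul_one_div]; exact inv_one_sub_inv_prime_le (hP q (Finset.mem_filter.1 hq).1)
  refine h1.trans ?_
  have ht' : (1 : ℝ) ≤ t := by exact_mod_cast ht
  rcases le_total G 2 with h | h
  · have := Real.exp_le_exp.2 (show 2 * G ≤ 4 by linarith)
    have := Real.exp_pos (4 - 8 * t + 4 * t * G)
    linarith
  · have := Real.exp_le_exp.2 (show 2 * G ≤ 4 - 8 * t + 4 * t * G by nlinarith)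
    have := Real.exp_pos 4
    linarith

/-- The exponential moment over pairs whose lcm is at most `T p ^ k`. -/
theorem exists_sum_diffProd_le : ∃ A : ℝ, 0 < A ∧ ∀ (t : ℕ), 1 ≤ t → ∀ (p N : ℕ), 0 < p →
    ∀ (k : ℕ → ℕ) (G : Finset ℕ), G ⊆ Finset.Icc 1 N →
    1 ≤ ∑ v ∈ G, (v.totient : ℝ) / p ^ k v → ∀ T : ℝ, 1 ≤ T →
    ∑ x ∈ (G ×ˢ G).filter (fun x => (x.1.lcm x.2 : ℝ) ≤ T * p ^ min (k x.1) (k x.2)),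
      ((x.1.totient : ℝ) / p ^ k x.1) * ((x.2.totient : ℝ) / p ^ k x.2) *
        diffProd (N + 1).primesBelow (momentWeight t) x.1 x.2 ≤
      A * T * (∑ v ∈ G, (v.totient : ℝ) / p ^ k v) ^ 2 := by
  classical
  obtain ⟨A, hA, hb⟩ := exists_momentBound
  refine ⟨A, hA, ?_⟩
  intro t ht p N hp k G hG hS T hT
  set P := (N + 1).primesBelow with hP
  set S := ∑ v ∈ G, (v.totient : ℝ) / p ^ k v with hSdef
  have hp0 : (0 : ℝ) < p := by exact_mod_cast hp
  have hp1 : (1 : ℝ) ≤ p := by exact_mod_cast hp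
  have hT0 : 0 < T := by linarith
  have hPp : ∀ q ∈ P, q.Prime := fun q hq => Nat.prime_of_mem_primesBelow hq
  have hc : ∀ q ∈ P, 1 ≤ momentWeight t q := fun q _ => one_le_momentWeight ..
  set f : ℕ → ℝ := fun v => if v ∈ G then (v : ℝ) / p ^ k v / T else 0 with hf
  have hf0 : ∀ v, 0 ≤ f v := fun v => by simp only [hf]; split_ifs <;> positivity
  have hfN : ∀ v, N < v → f v = 0 := fun v hv => by
    simp only [hf]; rw [if_neg]; intro h; have := Finset.mem_Icc.1 (hG h); omega
  have hval : ∀ v ∈ G, f v * phiPart P v = (v.totient : ℝ) / p ^ k v / T := by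
    intro v hv
    have hv' := Finset.mem_Icc.1 (hG hv)
    rw [totient_eq_mul_phiPart hv'.1 hv'.2]
    simp only [hf, if_pos hv]; ring
  have hsum : ∑ v ∈ Finset.Icc 1 N, f v * phiPart P v = S / T := by
    rw [hSdef, Finset.sum_div, ← Finset.sum_subset hG]
    · exact Finset.sum_congr rfl hval
    · intro v _ hv; simp [hf, hv]
  have hm := hb t ht N f f hf0 hf0 hfN hfN
  rw [hsum] at hm
  have hkey : ∑ x ∈ (G ×ˢ G).filter (fun x => (x.1.lcm x.2 : ℝ) ≤ T * p ^ min (k x.1) (k x.2)),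
      ((x.1.totient : ℝ) / p ^ k x.1) * ((x.2.totient : ℝ) / p ^ k x.2) *
        diffProd P (momentWeight t) x.1 x.2 ≤
      T ^ 2 * ∑ v ∈ Finset.Icc 1 N, ∑ w ∈ Finset.Icc 1 N,
        pairTerm P (momentWeight t) P f f v w := by
    rw [← Finset.sum_product', Finset.mul_sum]
    have hsub : (G ×ˢ G).filter (fun x => (x.1.lcm x.2 : ℝ) ≤ T * p ^ min (k x.1) (k x.2)) ⊆
        Finset.Icc 1 N ×ˢ Finset.Icc 1 N := fun x hx =>
      Finset.product_subset_product hG hG (Finset.mem_filter.1 hx).1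
    refine le_trans ?_ (Finset.sum_le_sum_of_subset_of_nonneg
      hsub
      fun x _ _ => mul_nonneg (by positivity) (pairTerm_nonneg hPp hc hf0 hf0 _ _))
    refine Finset.sum_le_sum fun x hx => ?_
    rw [Finset.mem_filter, Finset.mem_product] at hx
    obtain ⟨⟨h1, h2⟩, h3⟩ := hx
    obtain ⟨v, w⟩ := x
    simp only at h1 h2 h3 ⊢
    have hv' := Finset.mem_Icc.1 (hG h1)
    have hw' := Finset.mem_Icc.1 (hG h2)
    have hgl : (v.gcd w : ℝ) * v.lcm w = v * w := by exact_mod_cast Nat.gcd_mul_lcm v w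
    have hg0 : (0 : ℝ) ≤ v.gcd w := by positivity
    have hmain : ∀ j, min (k v) (k w) ≤ j → (v : ℝ) * w / p ^ j / T ≤ v.gcd w := by
      intro j hj
      rw [div_div, div_le_iff₀ (by positivity), ← hgl]
      refine mul_le_mul_of_nonneg_left (h3.trans ?_) hg0
      rw [mul_comm]
      exact mul_le_mul_of_nonneg_right (pow_le_pow_right₀ hp1 hj) hT0.le
    unfold pairTerm
    rw [if_pos, hval v h1, hval w h2]
    · apply le_of_eq; field_simp
    · refine ⟨?_, ?_, ?_⟩
      · simp only [hf, if_pos h1]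
        refine le_trans (le_of_eq ?_) (hmain _ (min_le_left _ _)); ring
      · simp only [hf, if_pos h2]
        refine le_trans (le_of_eq ?_) (hmain _ (min_le_right _ _)); ring
      · intro q hq
        have hqp := Nat.prime_of_mem_primeFactors hq
        have := Nat.le_of_dvd hv'.1 ((Nat.dvd_of_mem_primeFactors hq).trans (Nat.gcd_dvd_left v w))
        rw [hP, Nat.mem_primesBelow]
        exact ⟨by omega, hqp⟩
  refine hkey.trans ((mul_le_mul_of_nonneg_left hm (by positivity)).trans ?_)
  have hS0 : 0 < S := by linarith
  have e : T ^ 2 * (S / T * (S / T)) ^ (3 / 4 : ℝ) ≤ T * S ^ 2 := by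
    have e1 : (S / T * (S / T)) ^ (3 / 4 : ℝ) = S ^ (3 / 2 : ℝ) / T ^ (3 / 2 : ℝ) := by
      rw [show S / T * (S / T) = (S / T) ^ (2 : ℝ) by rw [Real.rpow_two]; ring,
        ← Real.rpow_mul (by positivity), ← Real.div_rpow hS0.le hT0.le]
      norm_num
    have e2 : S ^ (3 / 2 : ℝ) ≤ S ^ 2 := by
      rw [← Real.rpow_two]; exact Real.rpow_le_rpow_of_exponent_le hS (by norm_num)
    have e3 : T ≤ T ^ (3 / 2 : ℝ) := by
      conv_lhs => rw [← Real.rpow_one T]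
      exact Real.rpow_le_rpow_of_exponent_le hT (by norm_num)
    rw [e1, ← mul_div_assoc, div_le_iff₀ (by positivity)]
    calc T ^ 2 * S ^ (3 / 2 : ℝ) ≤ T ^ 2 * S ^ 2 := by gcongr
      _ = T * S ^ 2 * T := by ring
      _ ≤ T * S ^ 2 * T ^ (3 / 2 : ℝ) := by gcongr
  calc T ^ 2 * (A * (S / T * (S / T)) ^ (3 / 4 : ℝ))
      = A * (T ^ 2 * (S / T * (S / T)) ^ (3 / 4 : ℝ)) := by ring
    _ ≤ A * (T * S ^ 2) := by gcongr
    _ = _ := by ring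

theorem card_unitsUpTo_le {n : ℕ} (hn : 0 < n) : (unitsUpTo n).card ≤ 4 * n.totient := by
  set B := (Finset.range (n + 1)).filter (n.Coprime) with hB
  have hBc : B.card ≤ n.totient + 1 := by
    rw [hB, Finset.range_add_one, Finset.filter_insert]
    have : ((Finset.range n).filter n.Coprime).card = n.totient :=
      (Nat.totient_eq_card_coprime n).symm
    split_ifs
    · exact (Finset.card_insert_le _ _).trans (by omega)
    · omega
  have hsub : unitsUpTo n ⊆ B.image (fun b : ℕ => (b : ℤ)) ∪ B.image (fun b : ℕ => -(b : ℤ)) := by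
    intro a ha
    rw [mem_unitsUpTo] at ha
    have hmem : a.natAbs ∈ B := by
      rw [hB, Finset.mem_filter, Finset.mem_range]
      refine ⟨by have := abs_le.1 ha.1; omega, ?_⟩
      have := ha.2
      rw [Int.gcd_eq_natAbs] at this
      exact Nat.Coprime.symm (by simpa using this)
    rw [Finset.mem_union, Finset.mem_image, Finset.mem_image]
    rcases le_total 0 a with h | h
    · exact Or.inl ⟨a.natAbs, hmem, by omega⟩
    · exact Or.inr ⟨a.natAbs, hmem, by omega⟩
  have h1 := Finset.card_le_card hsub
  have h2 := Finset.card_union_le (B.image (fun b : ℕ => (b : ℤ))) (B.image (fun b : ℕ => -(b : ℤ)))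
  have h3 := Finset.card_image_le (s := B) (f := fun b : ℕ => (b : ℤ))
  have h4 := Finset.card_image_le (s := B) (f := fun b : ℕ => -(b : ℤ))
  have h5 := Nat.totient_pos.2 hn
  omega

/-- The scale above which primes matter for a parameter of binary size `i`. -/
def primeScale (i : ℕ) : ℕ := max 1 (i / 2)

theorem prod_filter_log_le {P : Finset ℕ} (hP : ∀ q ∈ P, q.Prime) (v w : ℕ) {M : ℕ}
    (hM : M ≠ 0) :
    ∏ q ∈ P.filter (fun q => v.factorization q ≠ w.factorization q ∧ Nat.log 4 M < q),
      (1 - 1 / (q : ℝ))⁻¹ ≤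
    ∏ q ∈ P.filter (fun q => v.factorization q ≠ w.factorization q ∧ primeScale (Nat.log 2 M) < q),
      (1 - 1 / (q : ℝ))⁻¹ := by
  have hsub : P.filter (fun q => v.factorization q ≠ w.factorization q ∧ Nat.log 4 M < q) ⊆
      P.filter (fun q => v.factorization q ≠ w.factorization q ∧
        primeScale (Nat.log 2 M) < q) := by
    intro q hq
    rw [Finset.mem_filter] at hq ⊢
    refine ⟨hq.1, hq.2.1, ?_⟩
    have h1 := (hP q hq.1).two_le
    have h2 : Nat.log 2 M / 2 ≤ Nat.log 4 M := by
      refine Nat.le_log_of_pow_le (by norm_num) ?_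
      rw [show 4 = 2 ^ 2 by norm_num, ← pow_mul]
      exact (Nat.pow_le_pow_right (by norm_num) (by omega)).trans (Nat.pow_log_le_self 2 hM)
    unfold primeScale
    have := hq.2.2
    omega
  have h1 : ∀ q ∈ P, 1 ≤ (1 - 1 / (q : ℝ))⁻¹ := fun q hq => one_le_inv_one_sub (hP q hq)
  exact Finset.prod_le_prod_of_subset_of_one_le hsub
    (fun q hq => zero_le_one.trans (h1 q (Finset.mem_filter.1 hq).1))
    fun q hq _ => h1 q (Finset.mem_filter.1 hq).1

theorem sum_exp_primeScale_le (B : ℕ) :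
    ∑ i ∈ Finset.range B, Real.exp (4 - 8 * primeScale i) * 2 ^ i ≤ 2 * Real.exp 8 := by
  have h : ∀ i : ℕ, Real.exp (4 - 8 * primeScale i) * 2 ^ i ≤ Real.exp 8 * (1 / 2) ^ i := by
    intro i
    have h1 : (4 : ℝ) - 8 * primeScale i ≤ 8 - i * 4 := by
      have : i ≤ 2 * primeScale i + 1 := by unfold primeScale; omega
      have : (i : ℝ) ≤ 2 * primeScale i + 1 := by exact_mod_cast this
      linarith
    have h4 : (4 : ℝ) ≤ Real.exp 4 := by have := Real.add_one_le_exp (4 : ℝ); linarith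
    calc Real.exp (4 - 8 * primeScale i) * 2 ^ i ≤ Real.exp (8 - i * 4) * 2 ^ i := by gcongr
      _ = Real.exp 8 * (2 ^ i / Real.exp 4 ^ i) := by
        rw [Real.exp_sub, Real.exp_nat_mul]; ring
      _ ≤ Real.exp 8 * (2 ^ i / 4 ^ i) := by gcongr
      _ = Real.exp 8 * (1 / 2) ^ i := by rw [← div_pow]; norm_num
  refine (Finset.sum_le_sum fun i _ => h i).trans ?_
  rw [← Finset.mul_sum, mul_comm]
  have := sum_le_hasSum (Finset.range B) (fun i _ => by positivity) hasSum_geometric_two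
  gcongr

/-- The second moment of the counting function is bounded by the square of its first moment. -/
theorem exists_secondMoment_le : ∃ C : ℝ, 0 < C ∧ ∀ (p N : ℕ), p.Prime →
    ∀ (k : ℕ → ℕ) (G : Finset ℕ), G ⊆ Finset.Icc 1 N → (∀ n ∈ G, ¬ p ∣ n) →
    1 ≤ ∑ v ∈ G, (v.totient : ℝ) / p ^ k v →
    ∑ x ∈ G ×ˢ G, (((unitsUpTo x.1 ×ˢ unitsUpTo x.2).filter fun y =>
        (p ^ min (k x.1) (k x.2) : ℤ) ∣ y.1 * x.2 - y.2 * x.1).card : ℝ) /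
        p ^ max (k x.1) (k x.2) ≤
      C * (∑ v ∈ G, (v.totient : ℝ) / p ^ k v) ^ 2 := by
  classical
  obtain ⟨A, hA, hb⟩ := exists_sum_diffProd_le
  refine ⟨4 + 40 * Real.exp 4 * (Real.exp 4 + A * (2 * Real.exp 8)), by positivity, ?_⟩
  intro p N hp k G hG hpG hS
  set S := ∑ v ∈ G, (v.totient : ℝ) / p ^ k v with hSdef
  set P := (N + 1).primesBelow with hP
  have hp0 : (0 : ℝ) < p := by exact_mod_cast hp.pos
  have hPp : ∀ q ∈ P, q.Prime := fun q hq => Nat.prime_of_mem_primesBelow hq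
  set m : ℕ → ℝ := fun v => (v.totient : ℝ) / p ^ k v with hm
  have hm0 : ∀ v, 0 ≤ m v := fun v => by positivity
  set M : ℕ × ℕ → ℕ := fun x => 2 * x.1.lcm x.2 / p ^ min (k x.1) (k x.2) with hMdef
  set d : ℕ → ℕ × ℕ → ℝ := fun i x => m x.1 * m x.2 *
    diffProd P (momentWeight (primeScale i)) x.1 x.2 with hd
  have hd0 : ∀ i x, 0 ≤ d i x := fun i x => mul_nonneg (mul_nonneg (hm0 _) (hm0 _))
    (diffProd_nonneg (fun q _ => one_le_momentWeight ..) _ _)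
  have hpt : ∀ x ∈ G ×ˢ G, (((unitsUpTo x.1 ×ˢ unitsUpTo x.2).filter fun y =>
        (p ^ min (k x.1) (k x.2) : ℤ) ∣ y.1 * x.2 - y.2 * x.1).card : ℝ) /
        p ^ max (k x.1) (k x.2) ≤
      (if x.1 = x.2 then 4 * m x.1 else 0) + 40 * Real.exp 4 * (Real.exp 4 * (m x.1 * m x.2) +
        if M x = 0 then 0 else Real.exp (4 - 8 * primeScale (Nat.log 2 (M x))) *
          d (Nat.log 2 (M x)) x) := by
    rintro ⟨v, w⟩ hx
    rw [Finset.mem_product] at hx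
    obtain ⟨h1, h2⟩ := hx
    simp only at h1 h2 ⊢
    have hv' := Finset.mem_Icc.1 (hG h1)
    have hw' := Finset.mem_Icc.1 (hG h2)
    have hc := card_overlap_le (k := min (k v) (k w)) hp hv'.1 hw'.1 hv'.2 hw'.2
      (hpG v h1) (hpG w h2)
    rw [div_le_iff₀ (by positivity)]
    refine hc.trans ?_
    rw [add_mul]
    refine add_le_add ?_ ?_
    · split_ifs with h
      · subst h
        have : ((unitsUpTo v).card : ℝ) ≤ 4 * v.totient := by
          exact_mod_cast card_unitsUpTo_le hv'.1
        refine this.trans (le_of_eq ?_)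
        simp only [hm, max_self]; field_simp
      · simp
    · have hMe : 2 * v.lcm w / p ^ min (k v) (k w) = M (v, w) := rfl
      rw [hMe]
      have hmm := mul_nonneg (hm0 v) (hm0 w)
      split_ifs with h
      · have := Real.exp_pos 4; positivity
      · have h3 := (prod_filter_log_le hPp v w h).trans
          (prod_inv_one_sub_le_exp_add hPp (t := primeScale (Nat.log 2 (M (v, w))))
            (by unfold primeScale; omega) v w)
        have e : (v.totient * w.totient : ℝ) / p ^ min (k v) (k w) =
            m v * m w * p ^ max (k v) (k w) := by
          have : (p : ℝ) ^ max (k v) (k w) * p ^ min (k v) (k w) = p ^ k v * p ^ k w := by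
            rw [← pow_add, ← pow_add, max_add_min]
          simp only [hm]
          rw [div_mul_div_comm, ← this]; field_simp
        rw [e]
        refine (mul_le_mul_of_nonneg_left (mul_le_mul_of_nonneg_left h3 (by positivity))
          (by positivity)).trans (le_of_eq ?_)
        simp only [hd]; ring
  refine (Finset.sum_le_sum hpt).trans ?_
  rw [Finset.sum_add_distrib, ← Finset.mul_sum, Finset.sum_add_distrib, ← Finset.mul_sum]
  have hdiag : ∑ x ∈ G ×ˢ G, (if x.1 = x.2 then 4 * m x.1 else 0) ≤ 4 * S ^ 2 := by
    rw [Finset.sum_product]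
    have : ∀ v ∈ G, ∑ w ∈ G, (if (v, w).1 = (v, w).2 then 4 * m (v, w).1 else 0) = 4 * m v := by
      intro v hv
      simp only
      rw [Finset.sum_ite_eq, if_pos hv]
    rw [Finset.sum_congr rfl this, ← Finset.mul_sum]
    nlinarith
  have hmain : ∑ x ∈ G ×ˢ G, m x.1 * m x.2 = S ^ 2 := by
    rw [Finset.sum_product, hSdef, sq, Finset.sum_mul_sum]
  have hoff : ∑ x ∈ G ×ˢ G, (if M x = 0 then 0 else
      Real.exp (4 - 8 * primeScale (Nat.log 2 (M x))) * d (Nat.log 2 (M x)) x) ≤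
      A * (2 * Real.exp 8) * S ^ 2 := by
    set B := (G ×ˢ G).sup (fun x => Nat.log 2 (M x)) + 1 with hB
    have hmaps : ∀ x ∈ G ×ˢ G, Nat.log 2 (M x) ∈ Finset.range B := fun x hx =>
      Finset.mem_range.2 (Nat.lt_succ_of_le (Finset.le_sup (f := fun x => Nat.log 2 (M x)) hx))
    rw [← Finset.sum_fiberwise_of_maps_to hmaps]
    have hi : ∀ i ∈ Finset.range B, ∑ x ∈ (G ×ˢ G).filter (fun x => Nat.log 2 (M x) = i),
        (if M x = 0 then 0 else
          Real.exp (4 - 8 * primeScale (Nat.log 2 (M x))) * d (Nat.log 2 (M x)) x) ≤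
        (Real.exp (4 - 8 * primeScale i) * 2 ^ i) * (A * S ^ 2) := by
      intro i _
      have hb' := hb (primeScale i) (by unfold primeScale; omega) p N hp.pos k G hG hS (2 ^ i)
        (one_le_pow₀ (by norm_num))
      calc _ ≤ ∑ x ∈ (G ×ˢ G).filter (fun x => (x.1.lcm x.2 : ℝ) ≤
              2 ^ i * p ^ min (k x.1) (k x.2)), Real.exp (4 - 8 * primeScale i) * d i x := by
            rw [Finset.sum_filter, Finset.sum_filter]
            refine Finset.sum_le_sum fun x _ => ?_
            by_cases h : Nat.log 2 (M x) = i
            · rw [if_pos h, h]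
              have : (x.1.lcm x.2 : ℝ) ≤ 2 ^ i * p ^ min (k x.1) (k x.2) := by
                have h1 : M x < 2 ^ (i + 1) := by
                  rw [← h]; exact Nat.lt_pow_succ_log_self (by norm_num) _
                have h2 := (Nat.div_lt_iff_lt_mul (pow_pos hp.pos _)).1 h1
                have h3 : x.1.lcm x.2 ≤ 2 ^ i * p ^ min (k x.1) (k x.2) := by
                  rw [pow_succ] at h2; nlinarith
                exact_mod_cast h3
              rw [if_pos this]
              split_ifs
              · exact mul_nonneg (Real.exp_pos _).le (hd0 _ _)
              · exact le_rfl
            · rw [if_neg h]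
              split_ifs
              · exact mul_nonneg (Real.exp_pos _).le (hd0 _ _)
              · exact le_rfl
        _ ≤ Real.exp (4 - 8 * primeScale i) * (A * 2 ^ i * S ^ 2) := by
            rw [← Finset.mul_sum]
            exact mul_le_mul_of_nonneg_left hb' (Real.exp_pos _).le
        _ = _ := by ring
    refine (Finset.sum_le_sum hi).trans ?_
    rw [← Finset.sum_mul]
    calc _ ≤ 2 * Real.exp 8 * (A * S ^ 2) :=
          mul_le_mul_of_nonneg_right (sum_exp_primeScale_le B) (by positivity)
      _ = _ := by ring
  rw [hmain]
  have h40 : (0 : ℝ) ≤ 40 * Real.exp 4 := by positivity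
  calc _ ≤ 4 * S ^ 2 + 40 * Real.exp 4 * (Real.exp 4 * S ^ 2 + A * (2 * Real.exp 8) * S ^ 2) :=
        add_le_add hdiag (mul_le_mul_of_nonneg_left (add_le_add le_rfl hoff) h40)
    _ = _ := by ring

theorem mem_Ico_ceil {x y : ℝ} {i : ℤ} : i ∈ Finset.Ico ⌈x⌉ ⌈y⌉ ↔ x ≤ i ∧ (i : ℝ) < y := by
  rw [Finset.mem_Ico, Int.ceil_le, Int.lt_ceil]

/-- Sieving an interval by one residue class modulo each prime of `Q`. -/
theorem abs_card_sieve_sub_le (Q : Finset ℕ) (hQ : ∀ q ∈ Q, q.Prime) :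
    ∀ (r : ℕ → ℤ) (x y : ℝ), x ≤ y →
    |(((Finset.Ico ⌈x⌉ ⌈y⌉).filter fun i => ∀ q ∈ Q, ¬ (q : ℤ) ∣ i - r q).card : ℝ) -
      (y - x) * ∏ q ∈ Q, (1 - 1 / (q : ℝ))| ≤ 2 ^ Q.card := by
  classical
  induction Q using Finset.induction_on with
  | empty =>
    intro r x y hxy
    have h1 : ⌈x⌉ ≤ ⌈y⌉ := Int.ceil_le_ceil hxy
    have h2 : ((⌈y⌉ - ⌈x⌉).toNat : ℝ) = ⌈y⌉ - ⌈x⌉ := by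
      have : ((⌈y⌉ - ⌈x⌉).toNat : ℤ) = ⌈y⌉ - ⌈x⌉ := Int.toNat_of_nonneg (by omega)
      exact_mod_cast this
    simp only [Finset.notMem_empty, false_implies, implies_true, Finset.filter_true, Int.card_Ico,
      Finset.prod_empty, mul_one, Finset.card_empty, pow_zero]
    rw [h2, abs_le]
    have := Int.ceil_lt_add_one x
    have := Int.ceil_lt_add_one y
    have := Int.le_ceil x
    have := Int.le_ceil y
    constructor <;> linarith
  | insert p Q hpQ ih =>
    intro r x y hxy
    have hp : p.Prime := hQ p (Finset.mem_insert_self _ _)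
    have hQ' : ∀ q ∈ Q, q.Prime := fun q hq => hQ q (Finset.mem_insert_of_mem hq)
    have hp0 : (0 : ℝ) < p := by exact_mod_cast hp.pos
    have hpz : (0 : ℤ) < p := by exact_mod_cast hp.pos
    have hinv : ∀ q ∈ Q, ∃ u : ℤ, (q : ℤ) ∣ p * u - 1 := by
      intro q hq
      have hco : p.Coprime q := (Nat.coprime_primes hp (hQ' q hq)).2 fun h => hpQ (h ▸ hq)
      obtain ⟨u, v, huv⟩ := Nat.isCoprime_iff_coprime.2 hco
      exact ⟨u, -v, by linear_combination huv⟩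
    choose! u hu using hinv
    have ih1 := ih hQ' r x y hxy
    have ih2 := ih hQ' (fun q => (r q - r p) * u q) ((x - r p) / p) ((y - r p) / p)
      (by gcongr)
    have hsplit : ((Finset.Ico ⌈x⌉ ⌈y⌉).filter fun i => ∀ q ∈ Q, ¬ (q : ℤ) ∣ i - r q).card =
        ((Finset.Ico ⌈x⌉ ⌈y⌉).filter fun i => ∀ q ∈ insert p Q, ¬ (q : ℤ) ∣ i - r q).card +
        ((Finset.Ico ⌈(x - r p) / p⌉ ⌈(y - r p) / p⌉).filter fun i =>
          ∀ q ∈ Q, ¬ (q : ℤ) ∣ i - (r q - r p) * u q).card := by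
      rw [← Finset.card_filter_add_card_filter_not (p := fun i => ¬ (p : ℤ) ∣ i - r p),
        Finset.filter_filter, Finset.filter_filter]
      congr 1
      · congr 1
        refine Finset.filter_congr fun i _ => ?_
        rw [Finset.forall_mem_insert, and_comm]
      · symm
        refine Finset.card_bij (fun i _ => r p + p * i) ?_ ?_ ?_
        · intro i hi
          rw [Finset.mem_filter, mem_Ico_ceil, div_le_iff₀ hp0, lt_div_iff₀ hp0] at hi
          rw [Finset.mem_filter, mem_Ico_ceil]
          refine ⟨by push_cast; constructor <;> nlinarith [hi.1.1, hi.1.2], ?_, ?_⟩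
          · intro q hq hd
            refine hi.2 q hq ?_
            have : i - (r q - r p) * u q =
                u q * (r p + p * i - r q) - i * (p * u q - 1) := by ring
            rw [this]
            exact dvd_sub (hd.mul_left _) ((hu q hq).mul_left _)
          · rw [not_not]; exact ⟨i, by ring⟩
        · intro a _ b _ h
          have : (p : ℤ) * a = p * b := by linarith
          exact mul_left_cancel₀ hpz.ne' this
        · intro b hb
          rw [Finset.mem_filter, mem_Ico_ceil, not_not] at hb
          obtain ⟨⟨h1, h2⟩, h3, c, hc⟩ := hb
          have hbe : b = r p + p * c := by linarith
          subst hbe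
          push_cast at h1 h2
          refine ⟨c, ?_, rfl⟩
          rw [Finset.mem_filter, mem_Ico_ceil, div_le_iff₀ hp0, lt_div_iff₀ hp0]
          refine ⟨⟨by linarith, by linarith⟩, fun q hq hd => h3 q hq ?_⟩
          have : r p + p * c - r q =
              p * (c - (r q - r p) * u q) + (r q - r p) * (p * u q - 1) := by ring
          rw [this]
          exact dvd_add (hd.mul_left _) ((hu q hq).mul_left _)
    have hs' := congrArg (fun n : ℕ => (n : ℝ)) hsplit
    push_cast at hs'
    rw [Finset.prod_insert hpQ, Finset.card_insert_of_notMem hpQ, pow_succ]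
    have e : (y - r p) / p - (x - r p) / p = (y - x) / p := by ring
    rw [e] at ih2
    have := abs_sub _ _ |>.trans (add_le_add ih1 ih2)
    rw [mul_two]
    refine le_trans (le_of_eq ?_) this
    congr 1
    rw [hs']; ring

theorem eight_pow_card_primeFactors_le {n : ℕ} (hn : 0 < n) :
    8 ^ n.primeFactors.card ≤ 8 ^ 4 * n := by
  set B := n.primeFactors.filter (8 ≤ ·)
  set S := n.primeFactors.filter (fun q => ¬ 8 ≤ q)
  have h1 : S.card ≤ 4 := by
    have : S ⊆ {2, 3, 5, 7} := by
      intro q hq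
      obtain ⟨h1, h2⟩ := Finset.mem_filter.1 hq
      have h3 := Nat.prime_of_mem_primeFactors h1
      push Not at h2
      interval_cases q <;> first | decide | (exfalso; revert h3; decide)
    exact (Finset.card_le_card this).trans (by decide)
  have h2 : B.card + S.card = n.primeFactors.card :=
    Finset.card_filter_add_card_filter_not _
  have h3 : 8 ^ B.card ≤ n :=
    calc 8 ^ B.card ≤ ∏ q ∈ B, q := Finset.pow_card_le_prod _ _ _ fun q hq =>
          (Finset.mem_filter.1 hq).2
      _ ≤ ∏ q ∈ n.primeFactors, q :=
          Finset.prod_le_prod_of_subset_of_one_le' (Finset.filter_subset _ _) fun q hq _ =>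
            (Nat.prime_of_mem_primeFactors hq).one_le
      _ ≤ n := Nat.le_of_dvd hn (Nat.prod_primeFactors_dvd n)
  rw [← h2, pow_add, mul_comm]
  exact Nat.mul_le_mul (Nat.pow_le_pow_right (by norm_num) h1) h3

theorem le_totient_mul_two_pow (n : ℕ) : n ≤ n.totient * 2 ^ n.primeFactors.card := by
  have h' := congrArg (fun x : ℚ => (x : ℝ)) (Nat.totient_eq_mul_prod_factors n)
  push_cast at h'
  have h : (1 / 2 : ℝ) ^ n.primeFactors.card ≤ ∏ q ∈ n.primeFactors, (1 - (q : ℝ)⁻¹) := by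
    rw [← Finset.prod_const]
    refine Finset.prod_le_prod (fun _ _ => by norm_num) fun q hq => ?_
    have : (2 : ℝ) ≤ q := by exact_mod_cast (Nat.prime_of_mem_primeFactors hq).two_le
    have := inv_anti₀ (by norm_num) this
    linarith
  have h2 : (n : ℝ) ≤ n.totient * 2 ^ n.primeFactors.card := by
    rw [h']
    calc (n : ℝ) = n * (1 / 2) ^ n.primeFactors.card * 2 ^ n.primeFactors.card := by
          rw [mul_assoc, ← mul_pow]; norm_num
      _ ≤ _ := by gcongr
  exact_mod_cast h2

/-- The totient eventually dominates any multiple of `2 ^ ω(n)`. -/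
theorem mul_two_pow_card_primeFactors_le_totient {K n : ℕ} (hn : 8 ^ 8 * K ^ 3 < n) :
    K * 2 ^ n.primeFactors.card ≤ n.totient := by
  by_contra! h
  have h0 : 0 < n := by omega
  set w := n.primeFactors.card
  have h1 := le_totient_mul_two_pow n
  have h2 := eight_pow_card_primeFactors_le h0
  have h3 : n ≤ K * 4 ^ w := by
    calc n ≤ n.totient * 2 ^ w := h1
      _ ≤ K * 2 ^ w * 2 ^ w := Nat.mul_le_mul_right _ h.le
      _ = K * 4 ^ w := by rw [mul_assoc, ← mul_pow]; norm_num
  have h4 : n ^ 3 ≤ (8 ^ 8 * K ^ 3) * n ^ 2 := by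
    calc n ^ 3 ≤ (K * 4 ^ w) ^ 3 := Nat.pow_le_pow_left h3 3
      _ = K ^ 3 * (8 ^ w) ^ 2 := by
        rw [mul_pow, ← pow_mul, ← pow_mul, mul_comm w 3, mul_comm w 2, pow_mul, pow_mul]
        norm_num
      _ ≤ K ^ 3 * (8 ^ 4 * n) ^ 2 := Nat.mul_le_mul_left _ (Nat.pow_le_pow_left h2 2)
      _ = _ := by ring
  have h5 : n * n ^ 2 ≤ (8 ^ 8 * K ^ 3) * n ^ 2 := by rw [← pow_succ']; exact h4
  exact absurd (Nat.le_of_mul_le_mul_right h5 (by positivity)) (by omega)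

/-- The integers up to `n` coprime to `n` meet every residue class modulo a fixed power of `p`
in the expected order of magnitude. -/
theorem exists_card_unitsUpTo_modEq_ge {p : ℕ} (hp : p.Prime) (m : ℕ) :
    ∃ n₀ : ℕ, ∀ n, n₀ ≤ n → ¬ p ∣ n → ∀ j ≤ m, ∀ s : ℤ,
      (n.totient : ℝ) / (2 * p ^ j) ≤
        ((unitsUpTo n).filter fun a => (p ^ j : ℤ) ∣ a - s).card := by
  classical
  refine ⟨8 ^ 8 * (2 * p ^ m) ^ 3 + 1, fun n hn hpn j hj s => ?_⟩
  have hn0 : 0 < n := by omega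
  have hbig := mul_two_pow_card_primeFactors_le_totient (K := 2 * p ^ m) (n := n) (by omega)
  have hp0 : (0 : ℝ) < p := by exact_mod_cast hp.pos
  have hpj : (0 : ℝ) < (p : ℝ) ^ j := by positivity
  have hQ : ∀ q ∈ n.primeFactors, q.Prime := fun q hq => Nat.prime_of_mem_primeFactors hq
  have hinv : ∀ q ∈ n.primeFactors, ∃ u : ℤ, (q : ℤ) ∣ p ^ j * u - 1 := by
    intro q hq
    have hco : (p ^ j).Coprime q := Nat.Coprime.pow_left _
      ((Nat.coprime_primes hp (hQ q hq)).2 fun h => hpn (h ▸ Nat.dvd_of_mem_primeFactors hq))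
    obtain ⟨u, v, huv⟩ := Nat.isCoprime_iff_coprime.2 hco
    push_cast at huv
    exact ⟨u, -v, by linear_combination huv⟩
  choose! u hu using hinv
  have hs := abs_card_sieve_sub_le n.primeFactors hQ (fun q => -s * u q) (-s / p ^ j)
    ((n - s) / p ^ j) (by gcongr; linarith [(Nat.cast_nonneg n : (0 : ℝ) ≤ n)])
  have hphi : (n - s : ℝ) / p ^ j - -s / p ^ j = n / p ^ j := by ring
  have h' := congrArg (fun x : ℚ => (x : ℝ)) (Nat.totient_eq_mul_prod_factors n)
  push_cast at h'
  have hmain : (n : ℝ) / p ^ j * ∏ q ∈ n.primeFactors, (1 - 1 / (q : ℝ)) = n.totient / p ^ j := by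
    rw [h']; simp only [one_div]; ring
  rw [hphi, hmain] at hs
  have hle : ((Finset.Ico ⌈-s / (p : ℝ) ^ j⌉ ⌈(n - s) / (p : ℝ) ^ j⌉).filter fun i =>
      ∀ q ∈ n.primeFactors, ¬ (q : ℤ) ∣ i - -s * u q).card ≤
      ((unitsUpTo n).filter fun a => (p ^ j : ℤ) ∣ a - s).card := by
    refine Finset.card_le_card_of_injOn (fun i => s + p ^ j * i) ?_ ?_
    · intro i hi
      rw [Finset.mem_coe, Finset.mem_filter, mem_Ico_ceil, div_le_iff₀ hpj, lt_div_iff₀ hpj] at hi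
      obtain ⟨⟨h1, h2⟩, h3⟩ := hi
      have h1' : 0 ≤ s + p ^ j * i := by
        have : (0 : ℝ) ≤ s + p ^ j * i := by linarith
        exact_mod_cast this
      have h2' : s + p ^ j * i < n := by
        have : (s + p ^ j * i : ℝ) < n := by linarith
        exact_mod_cast this
      rw [Finset.mem_coe, Finset.mem_filter, mem_unitsUpTo]
      refine ⟨⟨?_, ?_⟩, ⟨i, by ring⟩⟩
      · rw [abs_of_nonneg h1']; exact h2'.le
      · by_contra hg
        obtain ⟨q, hq, hqd⟩ := Nat.exists_prime_and_dvd hg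
        have hqz : (q : ℤ) ∣ (Int.gcd (s + p ^ j * i) n : ℤ) := by exact_mod_cast hqd
        have d1 := hqz.trans (Int.gcd_dvd_left _ _)
        have d2 := hqz.trans (Int.gcd_dvd_right _ _)
        have hqm : q ∈ n.primeFactors :=
          Nat.mem_primeFactors.2 ⟨hq, Int.natCast_dvd_natCast.1 d2, hn0.ne'⟩
        refine h3 q hqm ?_
        have : i - -s * u q = u q * (s + p ^ j * i) - i * (p ^ j * u q - 1) := by ring
        rw [this]
        exact dvd_sub (d1.mul_left _) ((hu q hqm).mul_left _)
    · intro a _ b _ h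
      have hpz : (p : ℤ) ^ j ≠ 0 := pow_ne_zero _ (by exact_mod_cast hp.ne_zero)
      exact mul_left_cancel₀ hpz (add_left_cancel h)
  have hle' : (((Finset.Ico ⌈-s / (p : ℝ) ^ j⌉ ⌈(n - s) / (p : ℝ) ^ j⌉).filter fun i =>
      ∀ q ∈ n.primeFactors, ¬ (q : ℤ) ∣ i - -s * u q).card : ℝ) ≤
      ((unitsUpTo n).filter fun a => (p ^ j : ℤ) ∣ a - s).card := by exact_mod_cast hle
  refine le_trans ?_ hle'
  have hlow := (abs_le.1 hs).1
  have hbig' : (2 * p ^ m : ℝ) * 2 ^ n.primeFactors.card ≤ n.totient := by exact_mod_cast hbig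
  have hpm : (p : ℝ) ^ j ≤ p ^ m := pow_le_pow_right₀ (by exact_mod_cast hp.one_le) hj
  have h2 : (2 : ℝ) ^ n.primeFactors.card ≤ n.totient / (2 * p ^ j) := by
    rw [le_div_iff₀ (by positivity)]
    refine le_trans ?_ hbig'
    rw [mul_comm]; gcongr
  have h3 : (n.totient : ℝ) / p ^ j = n.totient / (2 * p ^ j) + n.totient / (2 * p ^ j) := by
    field_simp; ring
  linarith

/-- A divergent monotone sequence of functions with controlled second moments and a lower bound for
the local first moments is almost everywhere unbounded. -/
theorem measureReal_forall_le_eq_zero {Ω : Type*} [MeasurableSpace Ω] {μ : Measure Ω}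
    [IsProbabilityMeasure μ] {F : ℕ → Ω → ℝ} {Ψ : ℕ → ℝ} {C K : ℝ}
    (hF0 : ∀ N x, 0 ≤ F N x) (hmono : ∀ x, Monotone fun N => F N x)
    (hmeas : ∀ N, Measurable (F N)) (hint : ∀ N, Integrable (F N) μ)
    (hint2 : ∀ N, Integrable (fun x => F N x ^ 2) μ) (hΨ : Tendsto Ψ atTop atTop)
    (hsecond : ∀ N, 1 ≤ Ψ N → ∫ x, F N x ^ 2 ∂μ ≤ C * Ψ N ^ 2)
    (hfirst : ∀ M, ∃ D : ℝ, ∀ N,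
      1 / 2 * μ.real {x | F M x ≤ K} * Ψ N - D ≤ ∫ x in {x | F M x ≤ K}, F N x ∂μ) :
    μ.real {x | ∀ N, F N x ≤ K} = 0 := by
  set A : Set Ω := {x | ∀ N, F N x ≤ K} with hA
  set V : ℕ → Set Ω := fun M => {x | F M x ≤ K} with hV
  have hVm : ∀ M, MeasurableSet (V M) := fun M => measurableSet_le (hmeas M) measurable_const
  have hAV : A = ⋂ M, V M := by ext x; simp [hA, hV]
  have hAm : MeasurableSet A := by rw [hAV]; exact MeasurableSet.iInter hVm
  have hsub : ∀ M, A ⊆ V M := fun M => by rw [hAV]; exact Set.iInter_subset _ _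
  have hlim : Tendsto (fun M => μ.real (V M)) atTop (nhds (μ.real A)) := by
    rw [hAV]
    refine (ENNReal.tendsto_toReal (measure_ne_top μ _)).comp
      (tendsto_measure_iInter_atTop (fun M => (hVm M).nullMeasurableSet) ?_
        ⟨0, measure_ne_top μ _⟩)
    intro M M' h x hx
    exact (hmono x h).trans hx
  rcases lt_or_ge K 0 with hK | hK
  · have : A = ∅ := by
      ext x; simp only [Set.mem_empty_iff_false, iff_false]
      intro h; have h1 : F 0 x ≤ K := h 0
      linarith [hF0 0 x]
    rw [this]; simp
  have hkey : ∀ (l : ℝ), 0 < l → ∀ M,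
      1 / 2 * μ.real A ≤ l / 2 * (μ.real (V M) - μ.real A) + C / (2 * l) := by
    intro l hl M
    obtain ⟨D, hD⟩ := hfirst M
    by_contra! hcon
    set ε := 1 / 2 * μ.real A - (l / 2 * (μ.real (V M) - μ.real A) + C / (2 * l)) with hε
    have hε0 : 0 < ε := by linarith
    obtain ⟨N, hN1, hN2⟩ := ((hΨ.eventually_ge_atTop 1).and
      (hΨ.eventually_gt_atTop ((K + D) / ε))).exists
    have hΨ0 : 0 < Ψ N := by linarith
    have h1 := hD N
    have hsplit : ∫ x in V M, F N x ∂μ = ∫ x in A, F N x ∂μ + ∫ x in V M \ A, F N x ∂μ := by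
      conv_lhs => rw [← Set.union_sdiff_cancel (hsub M)]
      exact setIntegral_union Set.disjoint_sdiff_right ((hVm M).diff hAm)
        (hint N).integrableOn (hint N).integrableOn
    have hAint : ∫ x in A, F N x ∂μ ≤ K := by
      calc ∫ x in A, F N x ∂μ ≤ ∫ _ in A, K ∂μ :=
            setIntegral_mono_on (hint N).integrableOn (integrable_const _).integrableOn hAm
              fun x hx => hx N
        _ = μ.real A * K := by simp
        _ ≤ 1 * K := by gcongr; exact measureReal_le_one
        _ = K := one_mul K
    have hBint : ∫ x in V M \ A, F N x ∂μ ≤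
        l * Ψ N / 2 * (μ.real (V M) - μ.real A) + C / (2 * l) * Ψ N := by
      have hpt : ∀ x, F N x ≤ l * Ψ N / 2 + 1 / (2 * (l * Ψ N)) * F N x ^ 2 := by
        intro x
        have hlΨ : 0 < l * Ψ N := by positivity
        have : l * Ψ N / 2 + 1 / (2 * (l * Ψ N)) * F N x ^ 2 - F N x =
            (l * Ψ N - F N x) ^ 2 / (2 * (l * Ψ N)) := by field_simp; ring
        have : 0 ≤ (l * Ψ N - F N x) ^ 2 / (2 * (l * Ψ N)) := by positivity
        linarith
      have hi2 : Integrable (fun x => 1 / (2 * (l * Ψ N)) * F N x ^ 2) μ := (hint2 N).const_mul _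
      calc ∫ x in V M \ A, F N x ∂μ
          ≤ ∫ x in V M \ A, (l * Ψ N / 2 + 1 / (2 * (l * Ψ N)) * F N x ^ 2) ∂μ :=
            setIntegral_mono (hint N).integrableOn
              ((integrable_const _).add hi2).integrableOn hpt
        _ = l * Ψ N / 2 * (μ.real (V M) - μ.real A) +
            1 / (2 * (l * Ψ N)) * ∫ x in V M \ A, F N x ^ 2 ∂μ := by
            rw [integral_add (integrable_const _) hi2.integrableOn, integral_const_mul]
            simp [measureReal_sdiff (μ := μ) (hsub M) hAm, mul_comm]
        _ ≤ l * Ψ N / 2 * (μ.real (V M) - μ.real A) +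
            1 / (2 * (l * Ψ N)) * (C * Ψ N ^ 2) := by
            gcongr
            exact (setIntegral_le_integral (hint2 N) (ae_of_all _ fun x => sq_nonneg _)).trans
              (hsecond N hN1)
        _ = _ := by field_simp
    have hmonoV : μ.real A ≤ μ.real (V M) := measureReal_mono (hsub M)
    have h2 : 1 / 2 * μ.real A * Ψ N ≤ 1 / 2 * μ.real (V M) * Ψ N := by gcongr
    have h3 : ε * Ψ N ≤ K + D := by
      rw [hsplit] at h1
      rw [hε]; nlinarith
    rw [div_lt_iff₀ hε0] at hN2
    linarith
  have hkey2 : ∀ l : ℝ, 0 < l → μ.real A ≤ C / l := by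
    intro l hl
    have h1 : Tendsto (fun M => l / 2 * (μ.real (V M) - μ.real A) + C / (2 * l)) atTop
        (nhds (l / 2 * (μ.real A - μ.real A) + C / (2 * l))) :=
      ((hlim.sub_const _).const_mul _).add_const _
    have h2 := ge_of_tendsto' h1 (hkey l hl)
    have : C / (2 * l) = 1 / 2 * (C / l) := by field_simp
    rw [sub_self, mul_zero, zero_add, this] at h2
    linarith
  refine le_antisymm ?_ measureReal_nonneg
  exact ge_of_tendsto (tendsto_const_nhds.div_atTop tendsto_id)
    ((eventually_gt_atTop 0).mono hkey2)

section padic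

variable {p : ℕ} [hp : Fact p.Prime]

/-- The residue class of `r` modulo `p ^ k`. -/
def resBall (k : ℕ) (r : ℤ_[p]) : Set ℤ_[p] := {x | (p : ℤ_[p]) ^ k ∣ x - r}

theorem resBall_eq_closedBall (k : ℕ) (r : ℤ_[p]) :
    resBall k r = Metric.closedBall r ((p : ℝ) ^ (-k : ℤ)) := by
  ext x
  rw [Metric.mem_closedBall, dist_eq_norm, PadicInt.norm_le_pow_iff_mem_span_pow,
    Ideal.mem_span_singleton]
  rfl

theorem isClosed_resBall (k : ℕ) (r : ℤ_[p]) : IsClosed (resBall k r) := by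
  rw [resBall_eq_closedBall]; exact Metric.isClosed_closedBall

theorem mem_resBall_self (k : ℕ) (r : ℤ_[p]) : r ∈ resBall k r := by simp [resBall]

theorem resBall_eq_of_mem {k : ℕ} {r x : ℤ_[p]} (h : x ∈ resBall k r) :
    resBall k r = resBall k x := by
  have h' : (p : ℤ_[p]) ^ k ∣ x - r := h
  ext y
  change (p : ℤ_[p]) ^ k ∣ y - r ↔ (p : ℤ_[p]) ^ k ∣ y - x
  rw [show y - r = (y - x) + (x - r) by ring]
  exact dvd_add_left h'

theorem resBall_appr (k : ℕ) (x : ℤ_[p]) : x ∈ resBall k (x.appr k : ℤ_[p]) :=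
  Ideal.mem_span_singleton.1 (PadicInt.appr_spec k x)

theorem disjoint_resBall_natCast {k i j : ℕ} (hi : i < p ^ k) (hj : j < p ^ k) (hij : i ≠ j) :
    Disjoint (resBall k (i : ℤ_[p])) (resBall k (j : ℤ_[p])) := by
  rw [Set.disjoint_left]
  intro x h1 h2
  have h3 : (p : ℤ_[p]) ^ k ∣ ((i - j : ℤ) : ℤ_[p]) := by
    have := dvd_sub (show (p : ℤ_[p]) ^ k ∣ x - j from h2) (show (p : ℤ_[p]) ^ k ∣ x - i from h1)
    push_cast
    convert this using 1; ring
  rw [PadicInt.pow_p_dvd_int_iff] at h3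
  obtain ⟨c, hc⟩ := h3
  have hi' : (i : ℤ) < (p : ℤ) ^ k := by exact_mod_cast hi
  have hj' : (j : ℤ) < (p : ℤ) ^ k := by exact_mod_cast hj
  have hc0 : c = 0 := by
    by_contra h0
    rcases lt_or_gt_of_ne h0 with h | h
    · nlinarith
    · nlinarith
  rw [hc0] at hc
  omega

/-- The points `x` with `p ^ k ∣ n x - a`. -/
def hitSet (n k : ℕ) (a : ℤ) : Set ℤ_[p] := {x | (p : ℤ_[p]) ^ k ∣ n * x - a}

theorem isUnit_natCast_of_not_dvd {n : ℕ} (hn : ¬ p ∣ n) : IsUnit (n : ℤ_[p]) := by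
  rw [PadicInt.isUnit_iff, PadicInt.norm_natCast_eq_one_iff]
  exact (Nat.Prime.coprime_iff_not_dvd hp.out).2 hn

theorem exists_hitSet_eq_resBall {n : ℕ} (hn : ¬ p ∣ n) (k : ℕ) (a : ℤ) :
    ∃ r : ℤ_[p], hitSet n k a = resBall k r := by
  obtain ⟨u, hu⟩ := isUnit_natCast_of_not_dvd hn
  refine ⟨(↑u⁻¹ : ℤ_[p]) * a, ?_⟩
  ext x
  change (p : ℤ_[p]) ^ k ∣ n * x - a ↔ (p : ℤ_[p]) ^ k ∣ x - (↑u⁻¹ : ℤ_[p]) * a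
  have : (n : ℤ_[p]) * x - a = u * (x - (↑u⁻¹ : ℤ_[p]) * a) := by
    rw [mul_sub, ← mul_assoc, Units.mul_inv, one_mul, hu]
  rw [this]
  exact Units.dvd_mul_left

variable [MeasurableSpace ℤ_[p]] [BorelSpace ℤ_[p]]

theorem measurableSet_resBall (k : ℕ) (r : ℤ_[p]) : MeasurableSet (resBall k r) :=
  (isClosed_resBall k r).measurableSet

variable (μ : Measure ℤ_[p]) [IsProbabilityMeasure μ]

/-- Partition of a set into its traces on residue classes. -/
theorem measureReal_eq_sum_resBall (k : ℕ) {U : Set ℤ_[p]} (hU : MeasurableSet U) :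
    μ.real U = ∑ i ∈ Finset.range (p ^ k), μ.real (U ∩ resBall k (i : ℤ_[p])) := by
  rw [← measureReal_biUnion_finset]
  · congr 1
    ext x
    simp only [Set.mem_iUnion, Finset.mem_range, Set.mem_inter_iff, exists_prop]
    exact ⟨fun h => ⟨x.appr k, PadicInt.appr_lt x k, h, resBall_appr k x⟩,
      fun ⟨_, _, h, _⟩ => h⟩
  · intro i hi j hj hij
    rw [Finset.coe_range, Set.mem_Iio] at hi hj
    exact (disjoint_resBall_natCast hi hj hij).mono Set.inter_subset_right Set.inter_subset_right
  · exact fun i _ => hU.inter (measurableSet_resBall k _)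

variable [μ.IsAddHaarMeasure]

theorem measureReal_resBall (k : ℕ) (r : ℤ_[p]) : μ.real (resBall k r) = 1 / (p : ℝ) ^ k := by
  have htr : ∀ r : ℤ_[p], μ.real (resBall k r) = μ.real (resBall k (0 : ℤ_[p])) := by
    intro r
    have : resBall k r = (fun x => -r + x) ⁻¹' resBall k 0 := by
      ext x
      change (p : ℤ_[p]) ^ k ∣ x - r ↔ (p : ℤ_[p]) ^ k ∣ -r + x - 0
      rw [show -r + x - 0 = x - r by ring]
    rw [this, measureReal_def, measure_preimage_add, ← measureReal_def]
  have h := measureReal_eq_sum_resBall μ k MeasurableSet.univ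
  simp only [Set.univ_inter] at h
  have hs : ∑ i ∈ Finset.range (p ^ k), μ.real (resBall k (i : ℤ_[p])) =
      ∑ _i ∈ Finset.range (p ^ k), μ.real (resBall k (0 : ℤ_[p])) :=
    Finset.sum_congr rfl fun i _ => htr (i : ℤ_[p])
  rw [hs, Finset.sum_const, Finset.card_range,
    nsmul_eq_mul, probReal_univ] at h
  have hp0 : (0 : ℝ) < p := by exact_mod_cast hp.out.pos
  rw [htr, eq_div_iff (by positivity), mul_comm]
  push_cast at h
  exact h.symm

theorem measurableSet_hitSet {n : ℕ} (hn : ¬ p ∣ n) (k : ℕ) (a : ℤ) :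
    MeasurableSet (hitSet n k a : Set ℤ_[p]) := by
  obtain ⟨r, hr⟩ := exists_hitSet_eq_resBall (p := p) hn k a
  rw [hr]; exact measurableSet_resBall k r

theorem measureReal_hitSet {n : ℕ} (hn : ¬ p ∣ n) (k : ℕ) (a : ℤ) :
    μ.real (hitSet n k a) = 1 / (p : ℝ) ^ k := by
  obtain ⟨r, hr⟩ := exists_hitSet_eq_resBall (p := p) hn k a
  rw [hr, measureReal_resBall]

theorem measureReal_hitSet_inter_le {v w : ℕ} (hv : ¬ p ∣ v) (hw : ¬ p ∣ w) (k l : ℕ) (a b : ℤ) :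
    μ.real (hitSet v k a ∩ hitSet w l b) ≤
      if (p ^ min k l : ℤ) ∣ a * w - b * v then 1 / (p : ℝ) ^ max k l else 0 := by
  split_ifs with h
  · rcases le_total k l with hkl | hkl
    · rw [max_eq_right hkl, ← measureReal_hitSet μ hw l b]
      exact measureReal_mono Set.inter_subset_right
    · rw [max_eq_left hkl, ← measureReal_hitSet μ hv k a]
      exact measureReal_mono Set.inter_subset_left
  · refine le_of_eq ?_
    have : (hitSet v k a ∩ hitSet w l b : Set ℤ_[p]) = ∅ := by
      rw [Set.eq_empty_iff_forall_notMem]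
      rintro x ⟨h1, h2⟩
      refine h ?_
      rw [← PadicInt.pow_p_dvd_int_iff]
      have h1' := ((pow_dvd_pow (p : ℤ_[p]) (min_le_left k l)).trans
        (show (p : ℤ_[p]) ^ k ∣ v * x - a from h1)).mul_left w
      have h2' := ((pow_dvd_pow (p : ℤ_[p]) (min_le_right k l)).trans
        (show (p : ℤ_[p]) ^ l ∣ w * x - b from h2)).mul_left v
      have := dvd_sub h2' h1'
      push_cast
      convert this using 1; ring
    rw [this]; simp

theorem measureReal_resBall_inter_hitSet {n : ℕ} (hn : ¬ p ∣ n) {k m : ℕ} {a r : ℤ}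
    (h : (p ^ min k m : ℤ) ∣ a - n * r) :
    μ.real (resBall m (r : ℤ_[p]) ∩ hitSet n k a) = 1 / (p : ℝ) ^ max k m := by
  have hz : (p : ℤ_[p]) ^ min k m ∣ a - n * r := by
    have := (PadicInt.pow_p_dvd_int_iff (min k m) (a - n * r)).2 h
    push_cast at this; exact this
  rcases le_total k m with hkm | hkm
  · rw [min_eq_left hkm] at hz
    have hsub : resBall m (r : ℤ_[p]) ⊆ hitSet n k a := by
      intro x hx
      have h1 := ((pow_dvd_pow (p : ℤ_[p]) hkm).trans
        (show (p : ℤ_[p]) ^ m ∣ x - r from hx)).mul_left n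
      change (p : ℤ_[p]) ^ k ∣ n * x - a
      convert dvd_sub h1 hz using 1; ring
    rw [Set.inter_eq_left.2 hsub, measureReal_resBall, max_eq_right hkm]
  · rw [min_eq_right hkm] at hz
    have hsub : hitSet n k a ⊆ resBall m (r : ℤ_[p]) := by
      intro x hx
      have h1 := (pow_dvd_pow (p : ℤ_[p]) hkm).trans
        (show (p : ℤ_[p]) ^ k ∣ n * x - a from hx)
      have h2 : (p : ℤ_[p]) ^ m ∣ n * (x - r) := by
        convert dvd_add h1 hz using 1; ring
      exact (isUnit_natCast_of_not_dvd hn).dvd_mul_left.1 h2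
    rw [Set.inter_eq_right.2 hsub, measureReal_hitSet μ hn, max_eq_left hkm]

/-- The sets `hitSet n k a` are equidistributed in sets invariant modulo a fixed power of `p`. -/
theorem exists_sum_measureReal_inter_hitSet_ge (m : ℕ) {U : Set ℤ_[p]}
    (hU : ∀ x ∈ U, resBall m x ⊆ U) (hUm : MeasurableSet U) :
    ∃ n₀ : ℕ, ∀ n, n₀ ≤ n → ¬ p ∣ n → ∀ k : ℕ,
      1 / 2 * μ.real U * (n.totient / (p : ℝ) ^ k) ≤
        ∑ a ∈ unitsUpTo n, μ.real (U ∩ hitSet n k a) := by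
  classical
  obtain ⟨n₀, h₀⟩ := exists_card_unitsUpTo_modEq_ge hp.out m
  refine ⟨n₀, fun n hn hpn k => ?_⟩
  have hp0 : (0 : ℝ) < p := by exact_mod_cast hp.out.pos
  have e : ∀ a, μ.real (U ∩ hitSet n k a) = ∑ i ∈ Finset.range (p ^ m),
      μ.real (U ∩ hitSet n k a ∩ resBall m (i : ℤ_[p])) := fun a =>
    measureReal_eq_sum_resBall μ m (hUm.inter (measurableSet_hitSet hpn k a))
  rw [Finset.sum_congr rfl fun a _ => e a, Finset.sum_comm, measureReal_eq_sum_resBall μ m hUm,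
    Finset.mul_sum, Finset.sum_mul]
  refine Finset.sum_le_sum fun i _ => ?_
  by_cases hi : (i : ℤ_[p]) ∈ U
  · have hsub : resBall m (i : ℤ_[p]) ⊆ U := hU _ hi
    rw [Set.inter_eq_right.2 hsub, measureReal_resBall]
    have h1 := h₀ n hn hpn (min k m) (min_le_right _ _) (n * i)
    have e2 : (p : ℝ) ^ max k m * p ^ min k m = p ^ k * p ^ m := by
      rw [← pow_add, ← pow_add, max_add_min]
    calc 1 / 2 * (1 / (p : ℝ) ^ m) * (n.totient / (p : ℝ) ^ k)
        = n.totient / (2 * p ^ min k m) * (1 / p ^ max k m) := by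
          rw [div_mul_div_comm, div_mul_div_comm, div_mul_div_comm, mul_assoc 2, mul_assoc 2,
            mul_comm ((p : ℝ) ^ m), ← e2]
          congr 1 <;> ring
      _ ≤ ((unitsUpTo n).filter fun a => (p ^ min k m : ℤ) ∣ a - n * i).card *
            (1 / p ^ max k m) := by gcongr
      _ = ∑ a ∈ (unitsUpTo n).filter fun a => (p ^ min k m : ℤ) ∣ a - n * i,
            1 / (p : ℝ) ^ max k m := by rw [Finset.sum_const, nsmul_eq_mul]
      _ ≤ ∑ a ∈ unitsUpTo n, μ.real (U ∩ hitSet n k a ∩ resBall m (i : ℤ_[p])) := by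
          rw [Finset.sum_filter]
          refine Finset.sum_le_sum fun a _ => ?_
          split_ifs with h
          · have := measureReal_resBall_inter_hitSet μ hpn (r := (i : ℤ)) h
            rw [Int.cast_natCast] at this
            rw [← this]
            exact measureReal_mono fun x hx => ⟨⟨hsub hx.1, hx.2⟩, hx.1⟩
          · exact measureReal_nonneg
  · have : U ∩ resBall m (i : ℤ_[p]) = ∅ := by
      rw [Set.eq_empty_iff_forall_notMem]
      rintro x ⟨h1, h2⟩
      refine hi (hU x h1 ?_)
      rw [← resBall_eq_of_mem h2]
      exact mem_resBall_self _ _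
    rw [this]
    simp only [measureReal_empty, mul_zero, zero_mul]
    exact Finset.sum_nonneg fun _ _ => measureReal_nonneg

end padic

section counting

variable {p : ℕ} [hp : Fact p.Prime]

/-- The number of `a` counted by `unitsUpTo n` with `p ^ k ∣ n x - a`. -/
def hitCount (n k : ℕ) (x : ℤ_[p]) : ℝ :=
  ∑ a ∈ unitsUpTo n, (hitSet n k a).indicator (fun _ => 1) x

theorem hitCount_nonneg (n k : ℕ) (x : ℤ_[p]) : 0 ≤ hitCount n k x :=
  Finset.sum_nonneg fun _ _ => Set.indicator_nonneg (fun _ _ => zero_le_one) _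

theorem hitCount_congr {n k m : ℕ} (hkm : k ≤ m) {x y : ℤ_[p]} (h : y ∈ resBall m x) :
    hitCount n k y = hitCount n k x := by
  have hd : (p : ℤ_[p]) ^ k ∣ n * (y - x) :=
    ((pow_dvd_pow _ hkm).trans (show (p : ℤ_[p]) ^ m ∣ y - x from h)).mul_left _
  refine Finset.sum_congr rfl fun a _ => ?_
  have : y ∈ hitSet n k a ↔ x ∈ hitSet n k a := by
    change (p : ℤ_[p]) ^ k ∣ n * y - a ↔ (p : ℤ_[p]) ^ k ∣ n * x - a
    rw [show (n : ℤ_[p]) * y - a = n * (y - x) + (n * x - a) by ring]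
    exact dvd_add_right hd
  by_cases hx : x ∈ hitSet n k a
  · rw [Set.indicator_of_mem hx, Set.indicator_of_mem (this.2 hx)]
  · rw [Set.indicator_of_notMem hx, Set.indicator_of_notMem (mt this.1 hx)]

theorem hitCount_mul (v w k l : ℕ) (x : ℤ_[p]) : hitCount v k x * hitCount w l x =
    ∑ y ∈ unitsUpTo v ×ˢ unitsUpTo w,
      (hitSet v k y.1 ∩ hitSet w l y.2).indicator (fun _ => (1 : ℝ)) x := by
  unfold hitCount
  rw [Finset.sum_mul_sum, Finset.sum_product]
  refine Finset.sum_congr rfl fun a _ => Finset.sum_congr rfl fun b _ => ?_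
  simpa using (Set.inter_indicator_mul (fun _ => (1 : ℝ)) (fun _ => 1) x).symm

variable [MeasurableSpace ℤ_[p]] [BorelSpace ℤ_[p]]

theorem measurable_hitCount {n : ℕ} (hn : ¬ p ∣ n) (k : ℕ) :
    Measurable (hitCount n k : ℤ_[p] → ℝ) :=
  Finset.measurable_fun_sum _ fun a _ => measurable_const.indicator (measurableSet_hitSet hn k a)

variable (μ : Measure ℤ_[p]) [IsProbabilityMeasure μ]

theorem integrable_hitCount {n : ℕ} (hn : ¬ p ∣ n) (k : ℕ) :
    Integrable (hitCount n k : ℤ_[p] → ℝ) μ :=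
  integrable_finsetSum _ fun a _ => (integrable_const _).indicator (measurableSet_hitSet hn k a)

theorem setIntegral_hitCount {n : ℕ} (hn : ¬ p ∣ n) (k : ℕ) (U : Set ℤ_[p]) :
    ∫ x in U, hitCount n k x ∂μ = ∑ a ∈ unitsUpTo n, μ.real (U ∩ hitSet n k a) := by
  unfold hitCount
  rw [integral_finsetSum]
  · refine Finset.sum_congr rfl fun a _ => ?_
    rw [integral_indicator_const _ (measurableSet_hitSet hn k a), smul_eq_mul, mul_one,
      measureReal_restrict_apply (measurableSet_hitSet hn k a), Set.inter_comm]
  · exact fun a _ => ((integrable_const _).indicator (measurableSet_hitSet hn k a)).integrableOn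

theorem integrable_hitCount_mul {v w : ℕ} (hv : ¬ p ∣ v) (hw : ¬ p ∣ w) (k l : ℕ) :
    Integrable (fun x : ℤ_[p] => hitCount v k x * hitCount w l x) μ := by
  simp only [hitCount_mul]
  exact integrable_finsetSum _ fun y _ => (integrable_const _).indicator
    ((measurableSet_hitSet hv k y.1).inter (measurableSet_hitSet hw l y.2))

variable [μ.IsAddHaarMeasure]

theorem integral_hitCount_mul_le {v w : ℕ} (hv : ¬ p ∣ v) (hw : ¬ p ∣ w) (k l : ℕ) :
    ∫ x : ℤ_[p], hitCount v k x * hitCount w l x ∂μ ≤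
      (((unitsUpTo v ×ˢ unitsUpTo w).filter fun y =>
        (p ^ min k l : ℤ) ∣ y.1 * w - y.2 * v).card : ℝ) / p ^ max k l := by
  have hm : ∀ y : ℤ × ℤ, MeasurableSet (hitSet v k y.1 ∩ hitSet w l y.2 : Set ℤ_[p]) := fun y =>
    (measurableSet_hitSet hv k y.1).inter (measurableSet_hitSet hw l y.2)
  simp only [hitCount_mul]
  rw [integral_finsetSum _ fun y _ => (integrable_const _).indicator (hm y), div_eq_mul_one_div,
    ← nsmul_eq_mul, ← Finset.sum_const, Finset.sum_filter]
  refine Finset.sum_le_sum fun y _ => ?_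
  rw [integral_indicator_const _ (hm y), smul_eq_mul, mul_one]
  exact measureReal_hitSet_inter_le μ hv hw k l y.1 y.2

/-- If the expected number of hits diverges, almost every point is hit infinitely often. -/
theorem measureReal_hitCount_bounded_eq_zero {G : Set ℕ} [DecidablePred (· ∈ G)]
    (hG : ∀ n ∈ G, 0 < n ∧ ¬ p ∣ n) (k : ℕ → ℕ)
    (hdiv : Tendsto (fun N => ∑ n ∈ (Finset.range N).filter (· ∈ G),
      (n.totient : ℝ) / p ^ k n) atTop atTop) (K : ℝ) :
    μ.real {x : ℤ_[p] | ∀ N, ∑ n ∈ (Finset.range N).filter (· ∈ G), hitCount n (k n) x ≤ K} =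
      0 := by
  obtain ⟨C, _, hC⟩ := exists_secondMoment_le
  set GN : ℕ → Finset ℕ := fun N => (Finset.range N).filter (· ∈ G) with hGN
  have hmemG : ∀ N, ∀ n ∈ GN N, 0 < n ∧ ¬ p ∣ n := fun N n hn => hG n (Finset.mem_filter.1 hn).2
  have hsq : ∀ N (x : ℤ_[p]), (∑ n ∈ GN N, hitCount n (k n) x) ^ 2 =
      ∑ y ∈ GN N ×ˢ GN N, hitCount y.1 (k y.1) x * hitCount y.2 (k y.2) x := by
    intro N x
    rw [sq, Finset.sum_mul_sum, Finset.sum_product]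
  have hintm : ∀ N, ∀ y ∈ GN N ×ˢ GN N,
      Integrable (fun x : ℤ_[p] => hitCount y.1 (k y.1) x * hitCount y.2 (k y.2) x) μ :=
    fun N y hy => integrable_hitCount_mul μ (hmemG N _ (Finset.mem_product.1 hy).1).2
      (hmemG N _ (Finset.mem_product.1 hy).2).2 _ _
  have hmeas : ∀ N, Measurable fun x : ℤ_[p] => ∑ n ∈ GN N, hitCount n (k n) x := fun N =>
    Finset.measurable_fun_sum _ fun n hn => measurable_hitCount (hmemG N n hn).2 _
  refine measureReal_forall_le_eq_zero (F := fun N x => ∑ n ∈ GN N, hitCount n (k n) x)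
    (C := C) (Ψ := fun N => ∑ n ∈ GN N, (n.totient : ℝ) / p ^ k n) ?_ ?_ hmeas ?_ ?_ hdiv ?_ ?_
  · exact fun N x => Finset.sum_nonneg fun _ _ => hitCount_nonneg _ _ _
  · intro x N N' h
    refine Finset.sum_le_sum_of_subset_of_nonneg (fun n hn => ?_) fun _ _ _ => hitCount_nonneg _ _ _
    simp only [hGN, Finset.mem_filter, Finset.mem_range] at hn ⊢
    exact ⟨by omega, hn.2⟩
  · exact fun N => integrable_finsetSum _ fun n hn => integrable_hitCount μ (hmemG N n hn).2 _
  · intro N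
    simp only [hsq]
    exact integrable_finsetSum _ (hintm N)
  · intro N hN
    simp only [hsq]
    rw [integral_finsetSum _ (hintm N)]
    refine le_trans (Finset.sum_le_sum fun y hy => ?_) (hC p N hp.out k (GN N) ?_
      (fun n hn => (hmemG N n hn).2) hN)
    · exact integral_hitCount_mul_le μ (hmemG N _ (Finset.mem_product.1 hy).1).2
        (hmemG N _ (Finset.mem_product.1 hy).2).2 _ _
    · intro n hn
      have := Finset.mem_range.1 (Finset.mem_filter.1 hn).1
      exact Finset.mem_Icc.2 ⟨(hmemG N n hn).1, this.le⟩
  · intro M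
    set U : Set ℤ_[p] := {x | ∑ n ∈ GN M, hitCount n (k n) x ≤ K} with hU
    have hinv : ∀ x ∈ U, resBall ((GN M).sup k) x ⊆ U := by
      intro x hx y hy
      have : ∑ n ∈ GN M, hitCount n (k n) y = ∑ n ∈ GN M, hitCount n (k n) x :=
        Finset.sum_congr rfl fun n hn => hitCount_congr (Finset.le_sup hn) hy
      change _ ≤ K
      rw [this]; exact hx
    obtain ⟨n₀, h₀⟩ := exists_sum_measureReal_inter_hitSet_ge μ ((GN M).sup k) hinv
      (measurableSet_le (hmeas M) measurable_const)
    refine ⟨1 / 2 * μ.real U * ∑ n ∈ GN n₀, (n.totient : ℝ) / p ^ k n, fun N => ?_⟩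
    rw [integral_finsetSum _ fun n hn => (integrable_hitCount μ (hmemG N n hn).2 _).integrableOn,
      sub_le_iff_le_add, Finset.mul_sum, Finset.mul_sum,
      ← Finset.sum_filter_add_sum_filter_not (GN N) (fun n => n₀ ≤ n)]
    refine add_le_add ?_ ?_
    · refine (Finset.sum_le_sum fun n hn => ?_).trans (Finset.sum_le_sum_of_subset_of_nonneg
        (Finset.filter_subset (fun n => n₀ ≤ n) (GN N)) fun n hn _ => ?_)
      · have hn' := Finset.mem_filter.1 hn
        rw [setIntegral_hitCount μ (hmemG N n hn'.1).2]
        exact h₀ n hn'.2 (hmemG N n hn'.1).2 (k n)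
      · rw [setIntegral_hitCount μ (hmemG N n hn).2]
        exact Finset.sum_nonneg fun _ _ => measureReal_nonneg
    · refine Finset.sum_le_sum_of_subset_of_nonneg (fun n hn => ?_) fun n _ _ => by positivity
      simp only [hGN, Finset.mem_filter, Finset.mem_range, not_le] at hn ⊢
      exact ⟨hn.2, hn.1.2⟩

end counting

section reduction

variable {p : ℕ} [hp : Fact p.Prime]

theorem norm_sub_div_natCast {n : ℕ} (hn : ¬ p ∣ n) (x : ℤ_[p]) (a : ℤ) :
    ‖(x : ℚ_[p]) - (a : ℚ_[p]) / (n : ℚ_[p])‖ = ‖(n : ℤ_[p]) * x - a‖ := by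
  have h1 : ‖(n : ℚ_[p])‖ = 1 := by
    have := PadicInt.isUnit_iff.1 (isUnit_natCast_of_not_dvd (p := p) hn)
    rwa [← PadicInt.padic_norm_e_of_padicInt, PadicInt.coe_natCast] at this
  have h0 : (n : ℚ_[p]) ≠ 0 := by
    intro h; rw [h, norm_zero] at h1; exact zero_ne_one h1
  rw [← PadicInt.padic_norm_e_of_padicInt]
  push_cast
  rw [show (n : ℚ_[p]) * x - a = n * (x - a / n) by field_simp, norm_mul, h1, one_mul]

theorem mem_hitSet_iff_norm_le {n k : ℕ} {a : ℤ} {x : ℤ_[p]} :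
    x ∈ hitSet n k a ↔ ‖(n : ℤ_[p]) * x - a‖ ≤ (p : ℝ) ^ (-k : ℤ) := by
  rw [PadicInt.norm_le_pow_iff_mem_span_pow, Ideal.mem_span_singleton]
  rfl

theorem hitSet_subset_padicE {ψ : ℕ → ℝ} {n k : ℕ} (hn : ¬ p ∣ n) (hk : (p : ℝ) ^ (-k : ℤ) ≤ ψ n)
    {a : ℤ} (ha : a ∈ unitsUpTo n) : hitSet n k a ⊆ padicE p ψ n := by
  intro x hx
  refine ⟨a, (mem_unitsUpTo.1 ha).1, (mem_unitsUpTo.1 ha).2, ?_⟩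
  rw [norm_sub_div_natCast hn]
  exact (mem_hitSet_iff_norm_le.1 hx).trans hk

theorem padicE_subset_iUnion_hitSet {ψ : ℕ → ℝ} {n k : ℕ} (hn : ¬ p ∣ n)
    (hk : ψ n < (p : ℝ) ^ (-k + 1 : ℤ)) : padicE p ψ n ⊆ ⋃ a ∈ unitsUpTo n, hitSet n k a := by
  rintro x ⟨a, ha1, ha2, hx⟩
  rw [norm_sub_div_natCast hn] at hx
  refine Set.mem_biUnion (mem_unitsUpTo.2 ⟨ha1, ha2⟩) (mem_hitSet_iff_norm_le.2 ?_)
  rw [PadicInt.norm_le_pow_iff_norm_lt_pow_add_one]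
  exact hx.trans_lt hk

theorem hitCount_eq_zero {ψ : ℕ → ℝ} {n k : ℕ} (hn : ¬ p ∣ n) (hk : (p : ℝ) ^ (-k : ℤ) ≤ ψ n)
    {x : ℤ_[p]} (hx : x ∉ padicE p ψ n) : hitCount n k x = 0 :=
  Finset.sum_eq_zero fun _ ha =>
    Set.indicator_of_notMem (fun h => hx (hitSet_subset_padicE hn hk ha h)) _

theorem padicE_zero (ψ : ℕ → ℝ) : padicE p ψ 0 = ∅ := by
  refine Set.eq_empty_of_forall_notMem ?_
  rintro x ⟨a, ha1, ha2, -⟩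
  have : a = 0 := by simpa using ha1
  simp [this] at ha2

theorem padicE_eq_univ_of_one_le {ψ : ℕ → ℝ} {n : ℕ} (hn : ¬ p ∣ n) (h : 1 ≤ ψ n) :
    padicE p ψ n = Set.univ := by
  refine Set.eq_univ_of_forall fun x => ⟨1, ?_, by simp, ?_⟩
  · have : n ≠ 0 := fun h0 => hn (h0 ▸ dvd_zero p)
    rw [abs_one]; omega
  · rw [norm_sub_div_natCast hn]
    exact (PadicInt.norm_le_one _).trans h

theorem padicE_eq_empty_or_univ {n : ℕ} (hn0 : 0 < n) (hn : p ∣ n) (ψ : ℕ → ℝ) :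
    padicE p ψ n = ∅ ∨ padicE p ψ n = Set.univ := by
  rcases Set.eq_empty_or_nonempty (padicE p ψ n) with h | ⟨x, a, ha1, ha2, hx⟩
  · exact Or.inl h
  refine Or.inr (Set.eq_univ_of_forall fun y => ⟨a, ha1, ha2, ?_⟩)
  have ha : ‖(a : ℚ_[p])‖ = 1 := by
    refine le_antisymm (Padic.norm_int_le_one a) (not_lt.1 fun hlt => ?_)
    exact intCast_ne_zero_of_mem_unitsUpTo (mem_unitsUpTo.2 ⟨ha1, ha2⟩) hp.out hn
      ((ZMod.intCast_zmod_eq_zero_iff_dvd a p).2 (Padic.norm_intCast_lt_one_iff.1 hlt))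
  have hn1 : ‖(n : ℚ_[p])‖ < 1 := Padic.norm_natCast_lt_one_iff.2 hn
  have hnpos : 0 < ‖(n : ℚ_[p])‖ := norm_pos_iff.2 (by exact_mod_cast hn0.ne')
  have hbig : 1 < ‖(a : ℚ_[p]) / n‖ := by
    rw [norm_div, ha]; exact (one_lt_div hnpos).2 hn1
  have hnorm : ∀ z : ℤ_[p], ‖(z : ℚ_[p]) - (a : ℚ_[p]) / n‖ = ‖(a : ℚ_[p]) / n‖ := by
    intro z
    have hz : ‖(z : ℚ_[p])‖ < ‖(a : ℚ_[p]) / n‖ := (PadicInt.norm_le_one z).trans_lt hbig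
    rw [sub_eq_add_neg, Padic.add_eq_max_of_ne (by rw [norm_neg]; exact hz.ne), norm_neg,
      max_eq_right hz.le]
  rw [hnorm] at hx ⊢
  exact hx

/-- The exponent of the largest power `p ^ (-k)` not exceeding a given positive number below `1`. -/
theorem exists_zpow_neg_le_lt {t : ℝ} (h0 : 0 < t) (h1 : t < 1) :
    ∃ k : ℕ, (p : ℝ) ^ (-k : ℤ) ≤ t ∧ t < (p : ℝ) ^ (-k + 1 : ℤ) := by
  classical
  have hex : ∃ k : ℕ, (p : ℝ) ^ (-k : ℤ) ≤ t :=
    (PadicInt.exists_pow_neg_lt p h0).imp fun _ h => h.le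
  refine ⟨Nat.find hex, Nat.find_spec hex, ?_⟩
  obtain ⟨m, hm⟩ := Nat.exists_eq_succ_of_ne_zero (n := Nat.find hex) fun h => by
    have := Nat.find_spec hex
    rw [h] at this
    simp at this
    linarith
  have := Nat.find_min hex (m := m) (by omega)
  rw [hm]
  push_cast
  rw [show (-((m : ℤ) + 1) + 1 : ℤ) = -m by ring]
  exact not_le.1 this

variable [MeasurableSpace ℤ_[p]] [BorelSpace ℤ_[p]]
  (μ : Measure ℤ_[p]) [IsProbabilityMeasure μ] [μ.IsAddHaarMeasure]

theorem measureReal_padicE_le {ψ : ℕ → ℝ} {n k : ℕ} (hn0 : 0 < n) (hn : ¬ p ∣ n)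
    (hk : ψ n < (p : ℝ) ^ (-k + 1 : ℤ)) :
    μ.real (padicE p ψ n) ≤ 4 * ((n.totient : ℝ) / p ^ k) := by
  refine (measureReal_mono (padicE_subset_iUnion_hitSet hn hk) (measure_ne_top μ _)).trans
    ((measureReal_biUnion_finset_le _ _).trans ?_)
  simp only [measureReal_hitSet μ hn, Finset.sum_const, nsmul_eq_mul]
  have : ((unitsUpTo n).card : ℝ) ≤ 4 * n.totient := by exact_mod_cast card_unitsUpTo_le hn0
  rw [mul_one_div, ← mul_div_assoc]
  gcongr

theorem measure_padicE_of_eq_zero {ψ : ℕ → ℝ} {n : ℕ} (hn0 : 0 < n) (hn : ¬ p ∣ n)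
    (h : ψ n = 0) : μ (padicE p ψ n) = 0 := by
  rw [← measureReal_eq_zero_iff]
  refine le_antisymm (le_of_forall_pos_lt_add fun ε hε => ?_) measureReal_nonneg
  have hp0 : (0 : ℝ) < p := by exact_mod_cast hp.out.pos
  have hφ : (0 : ℝ) < 4 * n.totient := by
    have := Nat.totient_pos.2 hn0
    positivity
  obtain ⟨k, hk⟩ := PadicInt.exists_pow_neg_lt p (div_pos hε hφ)
  refine (measureReal_padicE_le μ (k := k) hn0 hn (by rw [h]; positivity)).trans_lt ?_
  rw [lt_div_iff₀ hφ, zpow_neg, zpow_natCast] at hk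
  rw [zero_add]
  calc 4 * ((n.totient : ℝ) / p ^ k) = ((p : ℝ) ^ k)⁻¹ * (4 * n.totient) := by ring
    _ < ε := hk

end reduction

/-- **Theorem 4(ii) (Haynes).** Let `p` be prime and `ψ` non-negative with
`Σ μ_p(E_n(ψ)) = ∞`.  If `limsup_N (Σ_{n≤N} φ(n)ψ(n)) / (Σ_{n≤N} nψ(n)) > 0`, then
`μ_p(W_p(ψ)) = 1`. -/
theorem stmt4 (p : ℕ) [Fact p.Prime] [MeasurableSpace ℤ_[p]] [BorelSpace ℤ_[p]]
    (μ : Measure ℤ_[p]) [μ.IsAddHaarMeasure] [IsProbabilityMeasure μ]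
    (ψ : ℕ → ℝ) (hψ : ∀ n, 0 ≤ ψ n)
    (hdiv : ∑' n : ℕ, μ (padicE p ψ n) = ⊤)
    (hlim : 0 < atTop.limsup (fun N : ℕ =>
      (∑ n ∈ Finset.Icc 1 N, (Nat.totient n : ℝ) * ψ n) /
        ∑ n ∈ Finset.Icc 1 N, (n : ℝ) * ψ n)) :
    μ (padicW p ψ) = 1 := by
  classical
  set T : Set ℕ := {n | padicE p ψ n = Set.univ} with hT
  by_cases hTinf : T.Infinite
  · have : padicW p ψ = Set.univ := Set.eq_univ_of_forall fun x =>
      hTinf.mono fun n (hn : padicE p ψ n = Set.univ) => by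
        change x ∈ padicE p ψ n
        rw [hn]; trivial
    rw [this, measure_univ]
  have hTfin : T.Finite := Set.not_infinite.1 hTinf
  set G : Set ℕ := {n | (0 < n ∧ ¬ p ∣ n) ∧ 0 < ψ n ∧ ψ n < 1} with hG
  have hk : ∀ n, ∃ k : ℕ, n ∈ G → (p : ℝ) ^ (-k : ℤ) ≤ ψ n ∧ ψ n < (p : ℝ) ^ (-k + 1 : ℤ) := by
    intro n
    by_cases hn : n ∈ G
    · obtain ⟨k, hk⟩ := exists_zpow_neg_le_lt (p := p) hn.2.1 hn.2.2
      exact ⟨k, fun _ => hk⟩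
    · exact ⟨0, fun h => absurd h hn⟩
  choose k hk using hk
  set m : ℕ → ℝ := fun n => if n ∈ G then (n.totient : ℝ) / p ^ k n else 0 with hm
  have hm0 : ∀ n, 0 ≤ m n := fun n => by
    simp only [hm]; split_ifs <;> positivity
  have hbound : ∀ n, μ (padicE p ψ n) ≤ T.indicator (fun _ => 1) n + ENNReal.ofReal (4 * m n) := by
    intro n
    by_cases hnT : n ∈ T
    · rw [Set.indicator_of_mem hnT]
      exact prob_le_one.trans le_self_add
    rw [Set.indicator_of_notMem hnT, zero_add]
    by_cases hnG : n ∈ G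
    · rw [← ofReal_measureReal]
      refine ENNReal.ofReal_le_ofReal ?_
      simp only [hm, if_pos hnG]
      exact measureReal_padicE_le μ hnG.1.1 hnG.1.2 (hk n hnG).2
    suffices h : μ (padicE p ψ n) = 0 by rw [h]; exact zero_le
    rcases n.eq_zero_or_pos with rfl | hn0
    · rw [padicE_zero, measure_empty]
    by_cases hpn : p ∣ n
    · rw [(padicE_eq_empty_or_univ hn0 hpn ψ).resolve_right hnT, measure_empty]
    have h1 : ψ n < 1 := not_le.1 fun h => hnT (padicE_eq_univ_of_one_le hpn h)
    refine measure_padicE_of_eq_zero μ hn0 hpn ((hψ n).antisymm' (not_lt.1 fun h => ?_))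
    exact hnG ⟨⟨hn0, hpn⟩, h, h1⟩
  have hnsum : ¬ Summable m := by
    intro hs
    refine (lt_top_iff_ne_top.1 ?_) hdiv
    refine (ENNReal.tsum_le_tsum hbound).trans_lt ?_
    rw [ENNReal.tsum_add]
    refine ENNReal.add_lt_top.2 ⟨?_, ?_⟩
    · rw [← tsum_subtype T fun _ => (1 : ENNReal), ENNReal.tsum_set_one]
      simpa using hTfin
    · rw [← ENNReal.ofReal_tsum_of_nonneg (fun n => mul_nonneg zero_le_four (hm0 n))
        (hs.mul_left 4)]
      exact ENNReal.ofReal_lt_top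
  have hmdiv : Tendsto (fun N => ∑ n ∈ (Finset.range N).filter (· ∈ G),
      (n.totient : ℝ) / p ^ k n) atTop atTop := by
    simpa only [Finset.sum_filter] using (not_summable_iff_tendsto_nat_atTop_of_nonneg hm0).1 hnsum
  have hnull : μ (padicW p ψ)ᶜ = 0 := by
    refine measure_mono_null (t := ⋃ K : ℕ, {x : ℤ_[p] | ∀ N,
      ∑ n ∈ (Finset.range N).filter (· ∈ G), hitCount n (k n) x ≤ K}) ?_ ?_
    · intro x hx
      have hfin : {n : ℕ | x ∈ padicE p ψ n}.Finite := Set.not_infinite.1 hx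
      obtain ⟨K, hK⟩ := exists_nat_ge (∑ n ∈ hfin.toFinset, hitCount n (k n) x)
      refine Set.mem_iUnion.2 ⟨K, fun N => ?_⟩
      refine le_trans (le_trans (Finset.sum_filter_ne_zero _).ge
        (Finset.sum_le_sum_of_subset_of_nonneg (fun n hn => ?_)
          fun _ _ _ => hitCount_nonneg _ _ _)) hK
      obtain ⟨hn, hne⟩ := Finset.mem_filter.1 hn
      rw [Set.Finite.mem_toFinset]
      by_contra hxn
      have hnG : n ∈ G := (Finset.mem_filter.1 hn).2
      exact hne (hitCount_eq_zero hnG.1.2 (hk n hnG).1 hxn)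
    · refine measure_iUnion_null fun K => ?_
      rw [← measureReal_eq_zero_iff]
      exact measureReal_hitCount_bounded_eq_zero μ (fun n hn => hn.1) k hmdiv K
  refine le_antisymm prob_le_one ?_
  calc 1 = μ (padicW p ψ ∪ (padicW p ψ)ᶜ) := by rw [Set.union_compl_self, measure_univ]
    _ ≤ μ (padicW p ψ) + μ (padicW p ψ)ᶜ := measure_union_le _ _
    _ = μ (padicW p ψ) := by rw [hnull, add_zero]
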